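/- If EP is a non-4-colorable maximal planar graph of minimum order, then for every edge e of EP, the graph EP − {e} is 4-colorable. -/

import Mathlib

open SimpleGraph

/-- A simple graph is planar if it admits a straight-line drawing in the plane
(by Fáry's theorem this is equivalent to topological planarity for simple graphs):
an injective placement of the vertices such that two distinct edges, drawn as
closed segments, meet only in common endpoints. -/
def IsPlanar {V : Type} (G : SimpleGraph V) : Prop :=
  ∃ pos : V → ℝ × ℝ, Function.Injective pos ∧
    ∀ u v x y : V, G.Adj u v → G.Adj x y → s(u, v) ≠ s(x, y) →
      ∀ p : ℝ × ℝ, p ∈ segment ℝ (pos u) (pos v) → p ∈ segment ℝ (pos x) (pos y) →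
        (p = pos u ∨ p = pos v) ∧ (p = pos x ∨ p = pos y)

/-- A maximal planar graph (planar triangulation): planar, and no edge between
two non-adjacent vertices can be added while preserving planarity. -/
def IsMaximalPlanar {V : Type} [Fintype V] (G : SimpleGraph V) : Prop :=
  IsPlanar G ∧ ∀ u v : V, u ≠ v → ¬ G.Adj u v →
    ¬ IsPlanar (G ⊔ SimpleGraph.fromEdgeSet {s(u, v)})

/-- A minimum-order counterexample to the Four Color Theorem: a maximal planar
graph that is not 4-colorable, of minimum number of vertices among all such graphs. -/
def IsMinCounterexample {V : Type} [Fintype V] (G : SimpleGraph V) : Prop :=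
  IsMaximalPlanar G ∧ ¬ G.Colorable 4 ∧
    ∀ (W : Type) [Fintype W] (H : SimpleGraph W),
      IsMaximalPlanar H → ¬ H.Colorable 4 → Fintype.card V ≤ Fintype.card W

namespace FC

noncomputable def X {V : Type} (f x : V → ℝ) (c a : V) (h : ℝ) : ℝ :=
  x c + (h - f c) / (f a - f c) * (x a - x c)

lemma X_bot {V : Type} (f x : V → ℝ) (c a : V) : X f x c a (f c) = x c := by
  simp [X]

lemma X_top {V : Type} (f x : V → ℝ) (c a : V) (h : f c ≠ f a) : X f x c a (f a) = x a := by
  have : f a - f c ≠ 0 := sub_ne_zero.2 h.symm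
  simp [X, this]

lemma X_self {V : Type} (f x : V → ℝ) (c : V) (h : ℝ) : X f x c c h = x c := by
  simp [X]

def Aff (g : ℝ → ℝ) : Prop := ∃ α β : ℝ, ∀ h, g h = α + β * h

lemma aff_X {V : Type} (f x : V → ℝ) (c a : V) : Aff (X f x c a) :=
  ⟨x c - f c / (f a - f c) * (x a - x c), (x a - x c) / (f a - f c), fun h => by
    unfold X; ring⟩

lemma Aff.sub {g k : ℝ → ℝ} (hg : Aff g) (hk : Aff k) : Aff (fun h => g h - k h) := by
  obtain ⟨a, b, h1⟩ := hg
  obtain ⟨c, d, h2⟩ := hk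
  exact ⟨a - c, b - d, fun h => by simp only [h1, h2]; ring⟩

lemma aff_lin (s t : ℝ) : Aff (fun h => s * (h - t)) := ⟨-(s * t), s, fun h => by ring⟩

lemma Aff.neg_dir {g : ℝ → ℝ} (hg : Aff g) {h1 h h2 : ℝ} (h1h : h1 ≤ h) (hh2 : h ≤ h2)
    (hn : g h < 0) : g h1 < 0 ∨ g h2 < 0 := by
  obtain ⟨α, β, e⟩ := hg
  rw [e] at hn
  rw [e, e]
  by_contra hc
  push Not at hc
  rcases le_total 0 β with hb | hb <;> nlinarith [mul_le_mul_of_nonneg_left h1h (abs_nonneg β)]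

lemma Aff.zero_btw {g : ℝ → ℝ} (hg : Aff g) {h1 h2 : ℝ} (a1 : g h1 < 0) (a2 : 0 < g h2) :
    ∃ h, g h = 0 ∧ ((h1 < h ∧ h < h2) ∨ (h2 < h ∧ h < h1)) := by
  obtain ⟨α, β, e⟩ := hg
  rw [e] at a1 a2
  have hb : β ≠ 0 := by rintro rfl; linarith
  refine ⟨-α / β, ?_, ?_⟩
  · rw [e]; field_simp; ring
  · rcases lt_or_gt_of_ne hb with hb | hb
    · right
      constructor
      · rw [lt_div_iff_of_neg hb]; linarith
      · rw [div_lt_iff_of_neg hb]; linarith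
    · left
      constructor
      · rw [lt_div_iff₀ hb]; linarith
      · rw [div_lt_iff₀ hb]; linarith

/-- sign of an affine function between two points -/
lemma Aff.pos_btw {g : ℝ → ℝ} (hg : Aff g) {h1 h h2 : ℝ} (a1 : 0 ≤ g h1) (a2 : 0 < g h2)
    (h1h : h1 < h) (hh2 : h ≤ h2) : 0 < g h := by
  obtain ⟨α, β, e⟩ := hg
  rw [e] at *
  rcases le_total 0 β with hb | hb <;> nlinarith

structure Pre (V : Type) where
  G : SimpleGraph V
  f : V → ℝ
  x : V → ℝ
  inj : Function.Injective f
  p1 : ∀ c a c' a' h, G.Adj c a → G.Adj c' a' → f c < h → h < f a → f c' < h → h < f a' →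
    X f x c a h = X f x c' a' h → c = c' ∧ a = a'
  p2 : ∀ c a w, G.Adj c a → f c < f w → f w < f a → X f x c a (f w) ≠ x w

variable {V : Type}

def Pre.It (D : Pre V) (h : ℝ) (i : V × V) : Prop :=
  (D.G.Adj i.1 i.2 ∧ D.f i.1 < h ∧ h < D.f i.2) ∨ (i.1 = i.2 ∧ D.f i.1 = h)

noncomputable def Pre.xi (D : Pre V) (i : V × V) (h : ℝ) : ℝ := X D.f D.x i.1 i.2 h

def Pre.Cons (D : Pre V) (h : ℝ) (i j : V × V) : Prop :=
  D.It h i ∧ D.It h j ∧ D.xi i h < D.xi j h ∧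
    ∀ k, D.It h k → ¬ (D.xi i h < D.xi k h ∧ D.xi k h < D.xi j h)

def Pre.Uncr (D : Pre V) (p q : V) : Prop :=
  D.f p < D.f q ∧ (∀ y, D.f p < D.f y → D.f y < D.f q → X D.f D.x p q (D.f y) ≠ D.x y) ∧
  ∀ r t h, D.G.Adj r t → D.f r < h → h < D.f t → D.f p < h → h < D.f q →
    X D.f D.x r t h ≠ X D.f D.x p q h

structure Dr (V : Type) extends Pre V where
  mxr : ∀ c a z, toPre.Cons (f z) (z, z) (c, a) →
    (toPre.Uncr c z → G.Adj c z) ∧ (toPre.Uncr z a → G.Adj z a)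
  mxl : ∀ c a z, toPre.Cons (f z) (c, a) (z, z) →
    (toPre.Uncr c z → G.Adj c z) ∧ (toPre.Uncr z a → G.Adj z a)

/-! reflections -/
lemma X_negx (f x : V → ℝ) (c a : V) (h : ℝ) : X f (fun v => - x v) c a h = - X f x c a h := by
  unfold X; ring

lemma X_negf (f x : V → ℝ) (c a : V) (h : ℝ) (hne : f c = f a → c = a) :
    X (fun v => - f v) x a c (-h) = X f x c a h := by
  by_cases e : f c = f a
  · have := hne e; subst this; simp [X]
  · have h1 : f a - f c ≠ 0 := sub_ne_zero.2 (Ne.symm e)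
    have h2 : -f c - -f a ≠ 0 := by intro h; apply h1; linarith
    unfold X
    field_simp
    ring

def Pre.fx (D : Pre V) : Pre V where
  G := D.G
  f := D.f
  x := fun v => - D.x v
  inj := D.inj
  p1 := by
    intro c a c' a' h h1 h2 h3 h4 h5 h6 h7
    rw [X_negx, X_negx] at h7
    exact D.p1 c a c' a' h h1 h2 h3 h4 h5 h6 (by linarith)
  p2 := by
    intro c a w h1 h2 h3 h4
    rw [X_negx] at h4
    exact D.p2 c a w h1 h2 h3 (by linarith)

def Pre.ff (D : Pre V) : Pre V where
  G := D.G
  f := fun v => - D.f v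
  x := D.x
  inj := by intro a b h; exact D.inj (by simpa using h)
  p1 := by
    intro c a c' a' h h1 h2 h3 h4 h5 h6 h7
    have e1 := X_negf D.f D.x a c (-h) (fun e => D.inj e)
    have e2 := X_negf D.f D.x a' c' (-h) (fun e => D.inj e)
    rw [neg_neg] at e1 e2
    rw [e1, e2] at h7
    have := D.p1 a c a' c' (-h) h1.symm h2.symm (by linarith) (by linarith) (by linarith)
      (by linarith) h7
    exact ⟨this.2, this.1⟩
  p2 := by
    intro c a w h1 h2 h3 h4
    have e1 := X_negf D.f D.x a c (D.f w) (fun e => D.inj e)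
    rw [e1] at h4
    exact D.p2 a c w h1.symm (by linarith) (by linarith) h4

lemma Pre.fx_It (D : Pre V) (h : ℝ) (i : V × V) : D.fx.It h i ↔ D.It h i := Iff.rfl
lemma Pre.fx_xi (D : Pre V) (h : ℝ) (i : V × V) : D.fx.xi i h = - D.xi i h := X_negx _ _ _ _ _

lemma Pre.fx_Cons (D : Pre V) (h : ℝ) (i j : V × V) : D.fx.Cons h i j ↔ D.Cons h j i := by
  unfold Pre.Cons
  simp only [fx_It, fx_xi, neg_lt_neg_iff]
  constructor
  · rintro ⟨a, b, c, d⟩; exact ⟨b, a, c, fun k hk h => d k hk h.symm⟩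
  · rintro ⟨a, b, c, d⟩; exact ⟨b, a, c, fun k hk h => d k hk h.symm⟩

lemma Pre.fx_Uncr (D : Pre V) (p q : V) : D.fx.Uncr p q ↔ D.Uncr p q := by
  unfold Pre.Uncr
  show (D.f p < D.f q ∧ (∀ y, D.f p < D.f y → D.f y < D.f q → X D.f (fun v => - D.x v) p q (D.f y) ≠ - D.x y) ∧
  ∀ r t h, D.G.Adj r t → D.f r < h → h < D.f t → D.f p < h → h < D.f q →
    X D.f (fun v => - D.x v) r t h ≠ X D.f (fun v => - D.x v) p q h) ↔ _
  simp only [X_negx, ne_eq, neg_inj]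

lemma Pre.ff_It (D : Pre V) (h : ℝ) (i : V × V) : D.ff.It (-h) i ↔ D.It h i.swap := by
  unfold Pre.It Pre.ff
  simp only [neg_lt_neg_iff, neg_inj, Prod.fst_swap, Prod.snd_swap]
  constructor
  · rintro (⟨a, b, c⟩ | ⟨a, b⟩)
    · exact Or.inl ⟨a.symm, c, b⟩
    · exact Or.inr ⟨a.symm, a ▸ b⟩
  · rintro (⟨a, b, c⟩ | ⟨a, b⟩)
    · exact Or.inl ⟨a.symm, c, b⟩
    · exact Or.inr ⟨a.symm, a ▸ b⟩

lemma Pre.ff_xi (D : Pre V) (h : ℝ) (i : V × V) : D.ff.xi i (-h) = D.xi i.swap h :=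
  X_negf D.f D.x i.2 i.1 h (fun e => D.inj e)

lemma Pre.ff_Cons (D : Pre V) (h : ℝ) (i j : V × V) :
    D.ff.Cons (-h) i j ↔ D.Cons h i.swap j.swap := by
  unfold Pre.Cons
  simp only [ff_It, ff_xi]
  constructor
  · rintro ⟨a, b, c, d⟩; exact ⟨a, b, c, fun k hk h => d k.swap (by simpa using hk) (by simpa using h)⟩
  · rintro ⟨a, b, c, d⟩; exact ⟨a, b, c, fun k hk h => d k.swap (by simpa using hk) (by simpa using h)⟩

lemma Pre.ff_Uncr (D : Pre V) (p q : V) : D.ff.Uncr p q ↔ D.Uncr q p := by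
  unfold Pre.Uncr
  have hX : ∀ p q h, X D.ff.f D.ff.x p q (-h) = X D.f D.x q p h := fun p q h =>
    X_negf D.f D.x q p h (fun e => D.inj e)
  have hf : ∀ v, D.ff.f v = - D.f v := fun v => rfl
  have hx : ∀ v, D.ff.x v = D.x v := fun v => rfl
  have hG : D.ff.G = D.G := rfl
  simp only [hf, hx, hX, hG, neg_lt_neg_iff]
  constructor
  · rintro ⟨a, b, c⟩
    refine ⟨a, fun y h1 h2 => b y h2 h1, fun r t h h1 h2 h3 h4 h5 => ?_⟩
    have := c t r (-h) h1.symm (by linarith) (by linarith) (by linarith) (by linarith)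
    rwa [hX, hX] at this
  · rintro ⟨a, b, c⟩
    refine ⟨a, fun y h1 h2 => b y h2 h1, fun r t h h1 h2 h3 h4 h5 => ?_⟩
    have := c t r (-h) h1.symm (by linarith) (by linarith) (by linarith) (by linarith)
    rwa [← hX, ← hX, neg_neg] at this

def Dr.fx (D : Dr V) : Dr V where
  toPre := D.toPre.fx
  mxr := by
    intro c a z h
    rw [Pre.fx_Uncr, Pre.fx_Uncr]
    exact D.mxl c a z ((Pre.fx_Cons _ _ _ _).1 h)
  mxl := by
    intro c a z h
    rw [Pre.fx_Uncr, Pre.fx_Uncr]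
    exact D.mxr c a z ((Pre.fx_Cons _ _ _ _).1 h)

def Dr.ff (D : Dr V) : Dr V where
  toPre := D.toPre.ff
  mxr := by
    intro c a z h
    rw [Pre.ff_Uncr, Pre.ff_Uncr]
    have := D.mxr a c z ((Pre.ff_Cons _ _ _ _).1 h)
    exact ⟨fun h => (this.2 h).symm, fun h => (this.1 h).symm⟩
  mxl := by
    intro c a z h
    rw [Pre.ff_Uncr, Pre.ff_Uncr]
    have := D.mxl a c z ((Pre.ff_Cons _ _ _ _).1 h)
    exact ⟨fun h => (this.2 h).symm, fun h => (this.1 h).symm⟩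

lemma Pre.xi_vert (D : Pre V) (z : V) (h : ℝ) : D.xi (z, z) h = D.x z := X_self _ _ _ _

lemma Pre.xi_bot (D : Pre V) (c a : V) : D.xi (c, a) (D.f c) = D.x c := X_bot _ _ _ _
lemma Pre.xi_top (D : Pre V) (c a : V) : D.xi (c, a) (D.f a) = D.x a := by
  by_cases h : D.f c = D.f a
  · have := D.inj h; subst this; exact X_bot _ _ _ _
  · exact X_top _ _ _ _ h

lemma Pre.aff (D : Pre V) (i : V × V) : Aff (D.xi i) := aff_X _ _ _ _

lemma Pre.It_inj (D : Pre V) {h : ℝ} {i j : V × V} (hi : D.It h i) (hj : D.It h j)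
    (e : D.xi i h = D.xi j h) : i = j := by
  obtain ⟨c, a⟩ := i
  obtain ⟨c', a'⟩ := j
  rcases hi with ⟨h1, h2, h3⟩ | ⟨h1, h2⟩ <;> rcases hj with ⟨h4, h5, h6⟩ | ⟨h4, h5⟩ <;>
    simp only at *
  · obtain ⟨rfl, rfl⟩ := D.p1 c a c' a' h h1 h4 h2 h3 h5 h6 e; rfl
  · subst h4 h5; rw [D.xi_vert] at e; exact absurd e (D.p2 c a c' h1 h2 h3)
  · subst h1 h2; rw [D.xi_vert] at e; exact absurd e.symm (D.p2 c' a' c h4 h5 h6)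
  · subst h1 h4
    have := D.inj (h2.trans h5.symm); subst this; rfl

lemma Pre.It_edge {D : Pre V} {c a : V} {h : ℝ} (h1 : D.G.Adj c a) (h2 : D.f c < h)
    (h3 : h < D.f a) : D.It h (c, a) := Or.inl ⟨h1, h2, h3⟩
lemma Pre.It_vert (D : Pre V) (c : V) : D.It (D.f c) (c, c) := Or.inr ⟨rfl, rfl⟩

/-- order is preserved between levels -/
lemma Pre.ord (D : Pre V) {c a c' a' : V} {h1 h2 : ℝ} (e : D.G.Adj c a) (e' : D.G.Adj c' a')
    (b1 : D.f c ≤ h1) (b2 : h1 ≤ D.f a) (b3 : D.f c ≤ h2) (b4 : h2 ≤ D.f a)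
    (b1' : D.f c' ≤ h1) (b2' : h1 ≤ D.f a') (b3' : D.f c' ≤ h2) (b4' : h2 ≤ D.f a')
    (hl : D.xi (c, a) h1 < D.xi (c', a') h1) : D.xi (c, a) h2 ≤ D.xi (c', a') h2 := by
  by_contra hc
  push Not at hc
  obtain ⟨h, z, hb⟩ := ((D.aff (c, a)).sub (D.aff (c', a'))).zero_btw (h1 := h1) (h2 := h2)
    (by simpa using hl) (by simpa using hc)
  have := D.p1 c a c' a' h e e' (by rcases hb with ⟨_, _⟩ | ⟨_, _⟩ <;> linarith)
    (by rcases hb with ⟨_, _⟩ | ⟨_, _⟩ <;> linarith) (by rcases hb with ⟨_, _⟩ | ⟨_, _⟩ <;> linarith)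
    (by rcases hb with ⟨_, _⟩ | ⟨_, _⟩ <;> linarith) (sub_eq_zero.1 z)
  obtain ⟨rfl, rfl⟩ := this
  exact lt_irrefl _ hl

/-- strict version at a level interior to both edges -/
lemma Pre.ord' (D : Pre V) {c a c' a' : V} {h1 h2 : ℝ} (e : D.G.Adj c a) (e' : D.G.Adj c' a')
    (b1 : D.f c ≤ h1) (b2 : h1 ≤ D.f a) (b3 : D.f c < h2) (b4 : h2 < D.f a)
    (b1' : D.f c' ≤ h1) (b2' : h1 ≤ D.f a') (b3' : D.f c' < h2) (b4' : h2 < D.f a')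
    (hl : D.xi (c, a) h1 < D.xi (c', a') h1) : D.xi (c, a) h2 < D.xi (c', a') h2 := by
  rcases (D.ord e e' b1 b2 b3.le b4.le b1' b2' b3'.le b4'.le hl).lt_or_eq with h | h
  · exact h
  · obtain ⟨rfl, rfl⟩ := D.p1 c a c' a' h2 e e' b3 b4 b3' b4' h
    exact absurd hl (lt_irrefl _)

lemma Pre.Cons.edge_r {D : Pre V} {z c a : V} (h : D.Cons (D.f z) (z, z) (c, a)) :
    D.G.Adj c a ∧ D.f c < D.f z ∧ D.f z < D.f a := by
  obtain ⟨h1, h2, h3, h4⟩ := h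
  rcases h2 with h2 | ⟨h2, h5⟩
  · exact h2
  · simp only at h2 h5
    have := D.inj h5; subst this; subst h2
    exact absurd h3 (lt_irrefl _)

lemma Pre.Cons.left_unique {D : Pre V} {h : ℝ} {i i' j : V × V} (h1 : D.Cons h i j)
    (h2 : D.Cons h i' j) : i = i' := by
  apply D.It_inj h1.1 h2.1
  rcases lt_trichotomy (D.xi i h) (D.xi i' h) with l | l | l
  · exact absurd ⟨l, h2.2.2.1⟩ (h1.2.2.2 i' h2.1)
  · exact l
  · exact absurd ⟨l, h1.2.2.1⟩ (h2.2.2.2 i h1.1)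

lemma Pre.Cons.right_unique {D : Pre V} {h : ℝ} {i j j' : V × V} (h1 : D.Cons h i j)
    (h2 : D.Cons h i j') : j = j' := by
  rw [← Pre.fx_Cons] at h1 h2
  exact h1.left_unique h2

end FC

namespace FC
variable {V : Type}

def Pre.MinV (D : Pre V) (z c a : V) : Prop :=
  D.Cons (D.f z) (z, z) (c, a) ∧ ∀ y, D.Cons (D.f y) (y, y) (c, a) →
    D.xi (c, a) (D.f z) - D.x z ≤ D.xi (c, a) (D.f y) - D.x y

/-- slope identity -/
lemma Pre.xi_two (D : Pre V) {c a z : V} (h1 : D.f c < D.f z) (h2 : D.f c < D.f a) (h : ℝ) :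
    D.xi (c, z) h = D.xi (c, a) h -
      (D.xi (c, a) (D.f z) - D.x z) / (D.f z - D.f c) * (h - D.f c) := by
  have h3 : D.f z - D.f c ≠ 0 := by linarith
  have h4 : D.f a - D.f c ≠ 0 := by linarith
  unfold Pre.xi X
  simp only
  field_simp
  ring

lemma Pre.low [Finite V] (D : Pre V) {z c a : V} (hz : D.MinV z c a) (y : V)
    (h1 : D.f c < D.f y) (h2 : D.f y < D.f z) (h3 : D.xi (c, z) (D.f y) ≤ D.x y)
    (h4 : D.x y < D.xi (c, a) (D.f y)) : False := by
  obtain ⟨hc, hmin⟩ := hz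
  obtain ⟨ca, cz, za⟩ := hc.edge_r
  set s : V → ℝ := fun y => (D.xi (c, a) (D.f y) - D.x y) / (D.f y - D.f c) with hs
  have hsm : ∀ y, D.f c < D.f y → s y * (D.f y - D.f c) = D.xi (c, a) (D.f y) - D.x y := by
    intro y hy
    have : D.f y - D.f c ≠ 0 := by linarith
    simp only [hs]
    field_simp
  have hcz : ∀ h, D.xi (c, z) h = D.xi (c, a) h - s z * (h - D.f c) := D.xi_two cz (by linarith)
  let R : Set V := {y | D.f c < D.f y ∧ D.f y < D.f z ∧ D.x y < D.xi (c, a) (D.f y) ∧ s y ≤ s z}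
  have hyR : y ∈ R := by
    refine ⟨h1, h2, h4, ?_⟩
    rw [hcz, ← sub_nonneg] at h3
    have := hsm y h1
    by_contra hlt
    push Not at hlt
    nlinarith
  obtain ⟨y, ⟨y1, y2, y3, y4⟩, ymin⟩ := Set.exists_min_image R s (Set.toFinite _) ⟨y, hyR⟩
  have ey := hsm y y1
  have ez := hsm z cz
  have spos : 0 < s y := div_pos (by linarith) (by linarith)
  have hA : D.It (D.f y) (c, a) := Pre.It_edge ca y1 (by linarith)
  -- y is not visible
  have hnv : ¬ D.Cons (D.f y) (y, y) (c, a) := by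
    intro hv
    have := hmin y hv
    rw [← ey, ← ez] at this
    nlinarith
  have : ∃ k, D.It (D.f y) k ∧ (D.xi (y, y) (D.f y) < D.xi k (D.f y) ∧
      D.xi k (D.f y) < D.xi (c, a) (D.f y)) := by
    by_contra hne
    push Not at hne
    exact hnv ⟨D.It_vert y, hA, by rw [D.xi_vert]; exact y3, fun k hk hb =>
      absurd (hne k hk hb.1) (not_le.2 hb.2)⟩
  obtain ⟨⟨p, q⟩, hk, k1, k2⟩ := this
  rw [D.xi_vert] at k1
  rcases hk with ⟨pq, py, yq⟩ | ⟨e1, e2⟩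
  swap
  · simp only at e1 e2
    have := D.inj e2; subst this; subst e1
    rw [D.xi_vert] at k1; exact lt_irrefl _ k1
  simp only at pq py yq
  have haff : Aff (fun h => D.xi (c, a) h - D.xi (p, q) h - s y * (h - D.f c)) :=
    ((D.aff _).sub (D.aff _)).sub (aff_lin _ _)
  have hneg : (fun h => D.xi (c, a) h - D.xi (p, q) h - s y * (h - D.f c)) (D.f y) < 0 := by
    simp only; linarith
  -- vertex ends inside
  have hend : ∀ w, D.f c < D.f w → D.f w < D.f z → D.x w ≤ D.xi (c, a) (D.f w) →
      D.xi (c, a) (D.f w) - D.x w - s y * (D.f w - D.f c) < 0 → False := by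
    intro w w1 w2 w3 w4
    have w5 : D.x w < D.xi (c, a) (D.f w) :=
      lt_of_le_of_ne w3 (fun e => D.p2 c a w ca w1 (by linarith) e.symm)
    have ew := hsm w w1
    have : s w < s y := by
      by_contra hge
      push Not at hge
      nlinarith
    exact absurd (ymin w ⟨w1, w2, w5, by linarith⟩) (not_le.2 this)
  have hord : ∀ h, D.f c ≤ h → h ≤ D.f a → D.f p ≤ h → h ≤ D.f q →
      D.xi (p, q) h ≤ D.xi (c, a) h := fun h a1 a2 a3 a4 =>
    D.ord pq ca py.le yq.le a3 a4 y1.le (by linarith) a1 a2 k2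
  rcases haff.neg_dir (h1 := max (D.f p) (D.f c)) (h2 := min (D.f q) (D.f z))
    (max_le py.le y1.le) (le_min yq.le y2.le) hneg with hd | hd
  · rcases lt_or_ge (D.f c) (D.f p) with l | l
    · rw [max_eq_left l.le] at hd
      have := hord (D.f p) l.le (by linarith) le_rfl (by linarith)
      rw [D.xi_bot] at hd this
      exact hend p l (by linarith) this hd
    · rw [max_eq_right l] at hd
      have := hord (D.f c) le_rfl (by linarith) l (by linarith)
      linarith
  · rcases lt_or_ge (D.f q) (D.f z) with l | l
    · rw [min_eq_left l.le] at hd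
      have := hord (D.f q) (by linarith) (by linarith) (by linarith) le_rfl
      rw [D.xi_top] at hd this
      exact hend q (by linarith) l this hd
    · rw [min_eq_right l] at hd
      have hx : D.x z < D.xi (p, q) (D.f z) := by nlinarith
      rcases l.lt_or_eq with l | l
      · have := D.ord' (h2 := D.f z) pq ca py.le yq.le (by linarith) l y1.le (by linarith) cz za k2
        exact hc.2.2.2 (p, q) (Pre.It_edge pq (by linarith) l) ⟨by rw [D.xi_vert]; exact hx, this⟩
      · have := D.inj l; subst this
        rw [D.xi_top] at hx; exact lt_irrefl _ hx

lemma Pre.low_up [Finite V] (D : Pre V) {z c a r t : V} (hz : D.MinV z c a) {h : ℝ}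
    (rt : D.G.Adj r t) (h1 : D.f r < h) (h2 : h < D.f t) (h3 : D.f c < h) (h4 : h < D.f z)
    (h5 : D.xi (r, t) h < D.xi (c, a) h)
    (hd : D.xi (c, z) (min (D.f t) (D.f z)) ≤ D.xi (r, t) (min (D.f t) (D.f z))) : t = z := by
  obtain ⟨ca, cz, za⟩ := hz.1.edge_r
  rcases lt_trichotomy (D.f t) (D.f z) with l | l | l
  · exfalso
    rw [min_eq_left l.le, D.xi_top r t] at hd
    have := D.ord (h2 := D.f t) rt ca h1.le h2.le (by linarith) le_rfl h3.le (by linarith)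
      (by linarith) (by linarith) h5
    rw [D.xi_top] at this
    exact D.low hz t (by linarith) l hd
      (lt_of_le_of_ne this (fun e => D.p2 c a t ca (by linarith) (by linarith) e.symm))
  · exact D.inj l
  · exfalso
    rw [min_eq_right l.le, D.xi_top c z] at hd
    have := D.ord' (h2 := D.f z) rt ca h1.le h2.le (by linarith) l h3.le (by linarith) cz za h5
    refine hz.1.2.2.2 (r, t) (Pre.It_edge rt (by linarith) l) ⟨?_, this⟩
    rw [D.xi_vert]
    exact lt_of_le_of_ne hd (fun e => D.p2 r t z rt (by linarith) l e.symm)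

lemma Pre.low_down [Finite V] (D : Pre V) {z c a r t : V} (hz : D.MinV z c a) {h : ℝ}
    (rt : D.G.Adj r t) (h1 : D.f r < h) (h2 : h < D.f t) (h3 : D.f c < h) (h4 : h < D.f z)
    (h5 : D.xi (r, t) h < D.xi (c, a) h)
    (hd : D.xi (c, z) (max (D.f r) (D.f c)) ≤ D.xi (r, t) (max (D.f r) (D.f c))) : r = c := by
  obtain ⟨ca, cz, za⟩ := hz.1.edge_r
  rcases lt_trichotomy (D.f c) (D.f r) with l | l | l
  · exfalso
    rw [max_eq_left l.le, D.xi_bot r t] at hd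
    have := D.ord (h2 := D.f r) rt ca h1.le h2.le le_rfl (by linarith) h3.le (by linarith)
      (by linarith) (by linarith) h5
    rw [D.xi_bot] at this
    exact D.low hz r (by linarith) (by linarith) hd
      (lt_of_le_of_ne this (fun e => D.p2 c a r ca (by linarith) (by linarith) e.symm))
  · exact (D.inj l).symm
  · exfalso
    rw [max_eq_right l.le, D.xi_bot c z] at hd
    have := D.ord (h2 := D.f c) rt ca h1.le h2.le (by linarith) (by linarith) h3.le (by linarith)
      le_rfl (by linarith) h5
    rw [D.xi_bot c a] at this
    exact D.p2 r t c rt l (by linarith) (le_antisymm this hd)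

lemma Pre.xi_cz_lt (D : Pre V) {z c a : V} (hz : D.Cons (D.f z) (z, z) (c, a)) {h : ℝ}
    (h3 : D.f c < h) : D.xi (c, z) h < D.xi (c, a) h := by
  obtain ⟨ca, cz, za⟩ := hz.edge_r
  rw [D.xi_two cz (by linarith)]
  have := hz.2.2.1
  rw [D.xi_vert] at this
  have : 0 < (D.xi (c, a) (D.f z) - D.x z) / (D.f z - D.f c) := div_pos (by linarith) (by linarith)
  nlinarith

lemma Dr.adj_low [Finite V] (D : Dr V) {z c a : V} (hz : D.MinV z c a) : D.G.Adj c z := by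
  obtain ⟨ca, cz, za⟩ := hz.1.edge_r
  by_contra hn
  refine hn ((D.mxr c a z hz.1).1 ⟨cz, ?_, ?_⟩)
  · intro y y1 y2 e
    exact D.low hz y y1 y2 e.le (e ▸ D.xi_cz_lt hz.1 y1)
  · intro r t h rt h1 h2 h3 h4 e
    have e : D.xi (r, t) h = D.xi (c, z) h := e
    have h5 : D.xi (r, t) h < D.xi (c, a) h := e ▸ D.xi_cz_lt hz.1 h3
    have up := D.low_up hz rt h1 h2 h3 h4 h5
    have dn := D.low_down hz rt h1 h2 h3 h4 h5
    obtain ⟨α, β, hδ⟩ := (D.aff (r, t)).sub (D.aff (c, z))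
    simp only at hδ
    have hh := hδ h
    rw [← sub_nonneg, hδ] at up dn
    have m1 : max (D.f r) (D.f c) < h := max_lt h1 h3
    have m2 : h < min (D.f t) (D.f z) := lt_min h2 h4
    have key : r = c ∧ t = z := by
      rcases le_total 0 β with hb | hb
      · have tz := up (by nlinarith)
        have := hδ (D.f z)
        rw [← tz, D.xi_top, D.xi_top] at this
        have hb0 : β = 0 := by
          have : (D.f t - h) * β = 0 := by linarith
          rcases mul_eq_zero.1 this with h | h
          · linarith
          · exact h
        exact ⟨dn (by subst hb0; linarith), tz⟩
      · have rc := dn (by nlinarith)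
        have := hδ (D.f c)
        rw [← rc, D.xi_bot, D.xi_bot] at this
        have hb0 : β = 0 := by
          have : (D.f r - h) * β = 0 := by linarith
          rcases mul_eq_zero.1 this with h | h
          · linarith
          · exact h
        exact ⟨rc, up (by subst hb0; linarith)⟩
    rw [key.1, key.2] at rt
    exact hn rt

lemma Dr.cons_low [Finite V] (D : Dr V) {z c a : V} (hz : D.MinV z c a) {h : ℝ}
    (h1 : D.f c < h) (h2 : h < D.f z) : D.Cons h (c, z) (c, a) := by
  obtain ⟨ca, cz, za⟩ := hz.1.edge_r
  refine ⟨Pre.It_edge (D.adj_low hz) h1 h2, Pre.It_edge ca h1 (by linarith), D.xi_cz_lt hz.1 h1, ?_⟩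
  rintro ⟨r, t⟩ (⟨rt, a1, a2⟩ | ⟨a1, a2⟩) ⟨k1, k2⟩
  · simp only at rt a1 a2
    have up := D.low_up hz rt a1 a2 h1 h2 k2
    have dn := D.low_down hz rt a1 a2 h1 h2 k2
    obtain ⟨α, β, hδ⟩ := (D.aff (r, t)).sub (D.aff (c, z))
    simp only at hδ
    have hh := hδ h
    rw [← sub_nonneg, hδ] at up dn
    have m1 : max (D.f r) (D.f c) < h := max_lt a1 h1
    have m2 : h < min (D.f t) (D.f z) := lt_min a2 h2
    rcases le_total 0 β with hb | hb
    · have tz := up (by nlinarith)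
      have := hδ (D.f z)
      rw [← tz, D.xi_top, D.xi_top] at this
      nlinarith
    · have rc := dn (by nlinarith)
      have := hδ (D.f c)
      rw [← rc, D.xi_bot, D.xi_bot] at this
      nlinarith
  · simp only at a1 a2
    subst a1 a2
    rw [D.xi_vert] at k1 k2
    exact D.low hz r h1 h2 k1.le k2

def Pre.RF (D : Pre V) (b c a : V) : Prop :=
  D.f c < D.f b ∧ D.f b < D.f a ∧ D.G.Adj c b ∧ D.G.Adj b a ∧ D.G.Adj c a ∧
  D.Cons (D.f b) (b, b) (c, a) ∧ (∀ h, D.f c < h → h < D.f b → D.Cons h (c, b) (c, a)) ∧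
  (∀ h, D.f b < h → h < D.f a → D.Cons h (b, a) (c, a))

lemma Pre.MinV_ff {D : Pre V} {z c a : V} (hz : D.MinV z c a) : D.ff.MinV z a c := by
  refine ⟨(D.ff_Cons _ _ _).2 hz.1, fun y hy => ?_⟩
  have := hz.2 y ((D.ff_Cons _ _ _).1 hy)
  have e : ∀ y, D.ff.xi (a, c) (D.ff.f y) = D.xi (c, a) (D.f y) := fun y => D.ff_xi _ _
  rw [e, e]; exact this

lemma Dr.RF_of_MinV [Finite V] (D : Dr V) {z c a : V} (hz : D.MinV z c a) : D.RF z c a := by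
  obtain ⟨ca, cz, za⟩ := hz.1.edge_r
  have hz' : D.ff.MinV z a c := Pre.MinV_ff hz
  refine ⟨cz, za, D.adj_low hz, (D.ff.adj_low hz').symm, ca, hz.1, fun h => D.cons_low hz,
    fun h h1 h2 => ?_⟩
  have := D.ff.cons_low hz' (h := -h) (neg_lt_neg h2) (neg_lt_neg h1)
  exact (D.ff_Cons _ _ _).1 this

lemma Dr.RF_of_Cons [Finite V] (D : Dr V) {z c a : V} (hz : D.Cons (D.f z) (z, z) (c, a)) :
    D.RF z c a := by
  obtain ⟨z0, h0, hm⟩ := Set.exists_min_image {y | D.Cons (D.f y) (y, y) (c, a)}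
    (fun y => D.xi (c, a) (D.f y) - D.x y) (Set.toFinite _) ⟨z, hz⟩
  have hR := D.RF_of_MinV ⟨h0, fun y hy => hm y hy⟩
  obtain ⟨_, cz, za⟩ := hz.edge_r
  rcases lt_trichotomy (D.f z) (D.f z0) with l | l | l
  · have := hz.left_unique (hR.2.2.2.2.2.2.1 _ cz l)
    simp only [Prod.mk.injEq] at this
    rw [← this.1, ← this.2] at hR
    exact absurd hR.1 (lt_irrefl _)
  · rw [D.inj l]; exact hR
  · have := hz.left_unique (hR.2.2.2.2.2.2.2 _ l za)
    simp only [Prod.mk.injEq] at this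
    rw [← this.1, ← this.2] at hR
    exact absurd hR.2.1 (lt_irrefl _)

def Pre.LF (D : Pre V) (b c a : V) : Prop := D.fx.RF b c a

lemma Dr.LF_of_Cons [Finite V] (D : Dr V) {z c a : V} (hz : D.Cons (D.f z) (c, a) (z, z)) :
    D.LF z c a := D.fx.RF_of_Cons ((D.fx_Cons _ _ _).2 hz)

/-- left boundary item at level h of triangle with middle b -/
noncomputable def Pre.bd (D : Pre V) (b c a : V) (h : ℝ) : V × V :=
  if h < D.f b then (c, b) else if D.f b < h then (b, a) else (b, b)

lemma Pre.RF.cons {D : Pre V} {b c a : V} (hR : D.RF b c a) {h : ℝ} (h1 : D.f c < h)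
    (h2 : h < D.f a) : D.Cons h (D.bd b c a h) (c, a) := by
  unfold Pre.bd
  obtain ⟨_, _, _, _, _, q1, q2, q3⟩ := hR
  split_ifs with l1 l2
  · exact q2 h h1 l1
  · exact q3 h l2 h2
  · have : h = D.f b := le_antisymm (not_lt.1 l2) (not_lt.1 l1)
    subst this; exact q1

lemma Pre.LF.cons {D : Pre V} {b c a : V} (hR : D.LF b c a) {h : ℝ} (h1 : D.f c < h)
    (h2 : h < D.f a) : D.Cons h (c, a) (D.bd b c a h) :=
  (D.fx_Cons _ _ _).1 (Pre.RF.cons hR h1 h2)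

end FC

namespace FC
variable {V : Type}

lemma Pre.RF_ff {D : Pre V} {b c a : V} (h : D.ff.RF b a c) : D.RF b c a := by
  obtain ⟨q1, q2, q3, q4, q5, q6, q7, q8⟩ := h
  refine ⟨neg_lt_neg_iff.1 q2, neg_lt_neg_iff.1 q1, q4.symm, q3.symm, q5.symm,
    (D.ff_Cons _ _ _).1 q6, fun h h1 h2 => ?_, fun h h1 h2 => ?_⟩
  · exact (D.ff_Cons _ _ _).1 (q8 (-h) (neg_lt_neg h2) (neg_lt_neg h1))
  · exact (D.ff_Cons _ _ _).1 (q7 (-h) (neg_lt_neg h2) (neg_lt_neg h1))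

lemma Pre.LF_ff {D : Pre V} {b c a : V} (h : D.ff.LF b a c) : D.LF b c a :=
  Pre.RF_ff (D := D.fx) h

/-- half lemma: lowest vertex between consecutive edges -/
lemma Dr.half [Finite V] (D : Dr V) {h : ℝ} {c a c' a' y : V} (hC : D.Cons h (c, a) (c', a'))
    (ca : D.G.Adj c a) (e1 : D.f c < h) (ca' : D.G.Adj c' a')
    (e1' : D.f c' < h)
    (y1 : h < D.f y) (y2 : D.f y ≤ D.f a) (y3 : D.f y ≤ D.f a') (y4 : D.xi (c, a) (D.f y) ≤ D.x y)
    (y5 : D.x y < D.xi (c', a') (D.f y))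
    (ymin : ∀ w, h < D.f w → D.f w < D.f y → D.xi (c, a) (D.f w) ≤ D.x w →
      D.x w ≤ D.xi (c', a') (D.f w) → False) : D.RF y c' a' := by
  have y6 : D.f y < D.f a' := by
    rcases y3.lt_or_eq with l | l
    · exact l
    · have := D.inj l; subst this; rw [D.xi_top] at y5; exact absurd y5 (lt_irrefl _)
  apply D.RF_of_Cons
  refine ⟨D.It_vert y, Pre.It_edge ca' (by linarith) y6, by rw [D.xi_vert]; exact y5, ?_⟩
  rintro ⟨p, q⟩ (⟨pq, a1, a2⟩ | ⟨a1, a2⟩) ⟨k1, k2⟩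
  · simp only at pq a1 a2
    rw [D.xi_vert] at k1
    have k0 : D.xi (c, a) (D.f y) < D.xi (p, q) (D.f y) := by linarith
    rcases lt_trichotomy h (D.f p) with l | l | l
    · have l1 := D.ord (h2 := D.f p) ca pq (by linarith) y2 (by linarith) (by linarith) a1.le a2.le
        le_rfl (by linarith) k0
      have l2 := D.ord (h2 := D.f p) pq ca' a1.le a2.le le_rfl (by linarith) (by linarith) y6.le
        (by linarith) (by linarith) k2
      rw [D.xi_bot] at l1 l2
      exact ymin p l a1 l1 l2
    · have l1 := D.ord (h2 := D.f p) ca pq (by linarith) y2 (by linarith) (by linarith) a1.le a2.le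
        le_rfl (by linarith) k0
      have l2 := D.ord (h2 := D.f p) pq ca' a1.le a2.le le_rfl (by linarith) (by linarith) y6.le
        (by linarith) (by linarith) k2
      rw [D.xi_bot] at l1 l2
      subst l
      refine hC.2.2.2 (p, p) (D.It_vert p) ?_
      rw [D.xi_vert]
      exact ⟨lt_of_le_of_ne l1 (D.p2 c a p ca e1 (by linarith)),
        lt_of_le_of_ne l2 (D.p2 c' a' p ca' e1' (by linarith)).symm⟩
    · have l1 := D.ord' (h2 := h) ca pq (by linarith) y2 (by linarith) (by linarith) a1.le a2.le
        l (by linarith) k0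
      have l2 := D.ord' (h2 := h) pq ca' a1.le a2.le l (by linarith) (by linarith) y6.le
        (by linarith) (by linarith) k2
      exact hC.2.2.2 (p, q) (Pre.It_edge pq l (by linarith)) ⟨l1, l2⟩
  · simp only at a1 a2
    have := D.inj a2; subst this; subst a1
    exact lt_irrefl _ k1

lemma Dr.top [Finite V] (D : Dr V) {h : ℝ} {c a c' a' : V} (hC : D.Cons h (c, a) (c', a'))
    (ca : D.G.Adj c a) (e1 : D.f c < h) (e2 : h < D.f a) (ca' : D.G.Adj c' a')
    (e1' : D.f c' < h) (e2' : h < D.f a') :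
    (∃ b, D.RF b c' a') ∨ (∃ b, D.LF b c a) ∨ a = a' := by
  let T : Set V := {y | h < D.f y ∧ D.f y ≤ D.f a ∧ D.f y ≤ D.f a' ∧
    D.xi (c, a) (D.f y) ≤ D.x y ∧ D.x y ≤ D.xi (c', a') (D.f y)}
  have hT : T.Nonempty := by
    rcases le_total (D.f a) (D.f a') with l | l
    · refine ⟨a, e2, le_rfl, l, (D.xi_top _ _).le, ?_⟩
      have := D.ord (h2 := D.f a) ca ca' e1.le e2.le (by linarith) le_rfl e1'.le e2'.le (by linarith) l
        hC.2.2.1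
      rwa [D.xi_top] at this
    · refine ⟨a', e2', l, le_rfl, ?_, (D.xi_top _ _).ge⟩
      have := D.ord (h2 := D.f a') ca ca' e1.le e2.le (by linarith) l e1'.le e2'.le (by linarith) le_rfl
        hC.2.2.1
      rwa [D.xi_top c' a'] at this
  obtain ⟨y, ⟨y1, y2, y3, y4, y5⟩, ymin⟩ := Set.exists_min_image T D.f (Set.toFinite _) hT
  have ymin' : ∀ w, h < D.f w → D.f w < D.f y → D.xi (c, a) (D.f w) ≤ D.x w →
      D.x w ≤ D.xi (c', a') (D.f w) → False := fun w w1 w2 w3 w4 =>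
    absurd (ymin w ⟨w1, by linarith, by linarith, w3, w4⟩) (not_le.2 w2)
  rcases y5.lt_or_eq with y5' | y5'
  · exact Or.inl ⟨y, D.half hC ca e1 ca' e1' y1 y2 y3 y4 y5' ymin'⟩
  rcases y4.lt_or_eq with y4' | y4'
  · right; left
    refine ⟨y, D.fx.half ((D.fx_Cons _ _ _).2 hC) ca' e1' ca e1 y1 y3 y2 ?_ ?_ ?_⟩
    · rw [show D.fx.xi _ (D.fx.f y) = _ from D.fx_xi _ _]; exact neg_le_neg y5
    · rw [show D.fx.xi _ (D.fx.f y) = _ from D.fx_xi _ _]; exact neg_lt_neg y4'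
    · intro w w1 w2 w3 w4
      rw [show D.fx.xi _ (D.fx.f w) = _ from D.fx_xi _ _] at w3 w4
      exact ymin' w w1 w2 (neg_le_neg_iff.1 w4) (neg_le_neg_iff.1 w3)
  · right; right
    have l1 : y = a := by
      rcases y2.lt_or_eq with l | l
      · exact absurd y4' (D.p2 c a y ca (by linarith) l)
      · exact D.inj l
    have l2 : y = a' := by
      rcases y3.lt_or_eq with l | l
      · exact absurd y5'.symm (D.p2 c' a' y ca' (by linarith) l)
      · exact D.inj l
    exact l1.symm.trans l2

def Pre.FaceAt (D : Pre V) (h : ℝ) (i j : V × V) : Prop :=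
  (∃ b c a, D.RF b c a ∧ D.f c < h ∧ h < D.f a ∧ j = (c, a) ∧ i = D.bd b c a h) ∨
  (∃ b c a, D.LF b c a ∧ D.f c < h ∧ h < D.f a ∧ i = (c, a) ∧ j = D.bd b c a h)

lemma Dr.face [Finite V] (D : Dr V) {h : ℝ} {i j : V × V} (hC : D.Cons h i j) :
    D.FaceAt h i j := by
  obtain ⟨c, a⟩ := i
  obtain ⟨c', a'⟩ := j
  rcases hC.1 with ⟨ca, e1, e2⟩ | ⟨ca, e1⟩
  swap
  · simp only at ca e1
    subst ca e1
    have := D.RF_of_Cons hC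
    obtain ⟨_, l1, l2⟩ := hC.edge_r
    exact Or.inl ⟨c, c', a', this, l1, l2, rfl, by simp [Pre.bd]⟩
  rcases hC.2.1 with ⟨ca', e1', e2'⟩ | ⟨ca', e1'⟩
  swap
  · simp only at ca' e1'
    subst ca' e1'
    have := D.LF_of_Cons hC
    obtain ⟨_, l1, l2⟩ := ((D.fx_Cons _ _ _).2 hC).edge_r
    exact Or.inr ⟨c', c, a, this, l1, l2, rfl, by simp [Pre.bd]⟩
  simp only at ca e1 e2 ca' e1' e2'
  have fin : ((∃ b, D.RF b c' a') ∨ (∃ b, D.LF b c a)) → D.FaceAt h (c, a) (c', a') := by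
    rintro (⟨b, hb⟩ | ⟨b, hb⟩)
    · exact Or.inl ⟨b, c', a', hb, e1', e2', rfl, hC.left_unique (hb.cons e1' e2')⟩
    · exact Or.inr ⟨b, c, a, hb, e1, e2, rfl, hC.right_unique (hb.cons e1 e2)⟩
  rcases D.top hC ca e1 e2 ca' e1' e2' with h1 | h1 | h1
  · exact fin (Or.inl h1)
  · exact fin (Or.inr h1)
  have hC' : D.ff.Cons (-h) (a, c) (a', c') := (D.ff_Cons _ _ _).2 hC
  rcases D.ff.top hC' ca.symm (neg_lt_neg e2) (neg_lt_neg e1) ca'.symm (neg_lt_neg e2')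
    (neg_lt_neg e1') with ⟨b, h2⟩ | ⟨b, h2⟩ | h2
  · exact fin (Or.inl ⟨b, Pre.RF_ff h2⟩)
  · exact fin (Or.inr ⟨b, Pre.LF_ff h2⟩)
  · subst h1 h2
    exact absurd hC.2.2.1 (lt_irrefl _)

/-- oriented faces -/
def Pre.Fc (D : Pre V) (p q z : V) : Prop :=
  D.RF p z q ∨ D.RF z q p ∨ D.RF q p z ∨ D.LF p q z ∨ D.LF z p q ∨ D.LF q z p

lemma Pre.Fc.rot {D : Pre V} {p q z : V} (h : D.Fc p q z) : D.Fc q z p := by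
  unfold Pre.Fc at *; tauto

lemma Pre.fx_LF {D : Pre V} {b c a : V} : D.fx.LF b c a ↔ D.RF b c a := by
  have : D.fx.fx = D := by
    cases D; simp [Pre.fx]
  unfold Pre.LF
  rw [this]

lemma Pre.fx_Fc {D : Pre V} {p q z : V} : D.fx.Fc p q z ↔ D.Fc q p z := by
  unfold Pre.Fc
  simp only [Pre.fx_LF]
  change D.LF _ _ _ ∨ D.LF _ _ _ ∨ D.LF _ _ _ ∨ _ ↔ _
  tauto

lemma Pre.LF_lt {D : Pre V} {b c a : V} (h : D.LF b c a) : D.f c < D.f b ∧ D.f b < D.f a ∧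
    D.G.Adj c b ∧ D.G.Adj b a ∧ D.G.Adj c a := ⟨h.1, h.2.1, h.2.2.1, h.2.2.2.1, h.2.2.2.2.1⟩
lemma Pre.RF_lt {D : Pre V} {b c a : V} (h : D.RF b c a) : D.f c < D.f b ∧ D.f b < D.f a ∧
    D.G.Adj c b ∧ D.G.Adj b a ∧ D.G.Adj c a := ⟨h.1, h.2.1, h.2.2.1, h.2.2.2.1, h.2.2.2.2.1⟩

lemma Pre.Fc.adj {D : Pre V} {p q z : V} (h : D.Fc p q z) :
    D.G.Adj p q ∧ D.G.Adj q z ∧ D.G.Adj z p := by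
  rcases h with h | h | h | h | h | h <;>
    first
    | (obtain ⟨_, _, h1, h2, h3⟩ := Pre.RF_lt h; simp [h1, h2, h3, h1.symm, h2.symm, h3.symm]; done)
    | (obtain ⟨_, _, h1, h2, h3⟩ := Pre.LF_lt h; simp [h1, h2, h3, h1.symm, h2.symm, h3.symm]; done)

lemma Pre.Fc.up {D : Pre V} {p q z : V} (h : D.Fc p q z) (hl : D.f p < D.f q) :
    D.RF p z q ∨ D.RF q p z ∨ D.LF z p q := by
  rcases h with h | h | h | h | h | h
  · exact Or.inl h
  · have := Pre.RF_lt h; linarith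
  · exact Or.inr (Or.inl h)
  · have := Pre.LF_lt h; linarith
  · exact Or.inr (Or.inr h)
  · have := Pre.LF_lt h; linarith

lemma Pre.Fc.cons {D : Pre V} {p q z : V} (h : D.Fc p q z) {t : ℝ} (h1 : D.f p < t)
    (h2 : t < D.f q) (h3 : t ≠ D.f z) : D.Cons t (p, q) (z, q) ∨ D.Cons t (p, q) (p, z) := by
  rcases h.up (h1.trans h2) with h | h | h
  · exact Or.inl (h.2.2.2.2.2.2.2 t h1 h2)
  · exact Or.inr (h.2.2.2.2.2.2.1 t h1 h2)
  · have := h.cons h1 h2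
    unfold Pre.bd at this
    split_ifs at this with l1 l2
    · exact Or.inr this
    · exact Or.inl this
    · exact absurd (le_antisymm (not_lt.1 l2) (not_lt.1 l1)) h3

lemma Pre.Fc.unique_up {D : Pre V} {p q z z' : V} (h : D.Fc p q z) (h' : D.Fc p q z')
    (hl : D.f p < D.f q) : z = z' := by
  obtain ⟨t, ht, ht'⟩ : ∃ t, t ∈ Set.Ioo (D.f p) (D.f q) ∧ t ∉ ({D.f z, D.f z'} : Set ℝ) :=
    (Set.Ioo_infinite hl).exists_notMem_finite (Set.toFinite _)
  simp only [Set.mem_insert_iff, Set.mem_singleton_iff, not_or] at ht'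
  have a1 := h.adj
  have a2 := h'.adj
  rcases h.cons ht.1 ht.2 ht'.1 with c | c <;> rcases h'.cons ht.1 ht.2 ht'.2 with c' | c' <;>
    have e := c.right_unique c' <;> simp only [Prod.mk.injEq] at e
  · exact e.1
  · exact absurd e.1 a1.2.2.ne
  · exact absurd e.1.symm a2.2.2.ne
  · exact e.2

lemma Pre.Fc.unique {D : Pre V} {p q z z' : V} (h : D.Fc p q z) (h' : D.Fc p q z') : z = z' := by
  rcases lt_trichotomy (D.f p) (D.f q) with l | l | l
  · exact h.unique_up h' l
  · exact absurd (D.inj l) h.adj.1.ne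
  · exact (Pre.fx_Fc.2 h).unique_up (Pre.fx_Fc.2 h') l

lemma Pre.exists_cons [Finite V] (D : Pre V) {h : ℝ} {i k : V × V} (hi : D.It h i) (hk : D.It h k)
    (hl : D.xi i h < D.xi k h) : ∃ j, D.Cons h i j := by
  obtain ⟨j, ⟨j1, j2⟩, jm⟩ := Set.exists_min_image {j | D.It h j ∧ D.xi i h < D.xi j h}
    (fun j => D.xi j h) (Set.toFinite _) ⟨k, hk, hl⟩
  exact ⟨j, hi, j1, j2, fun k hk hb => absurd (jm k ⟨hk, hb.1⟩) (not_le.2 hb.2)⟩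

lemma Dr.Fc_of_cons [Finite V] (D : Dr V) {p q : V} {h : ℝ} {j : V × V} (h1 : D.f p < D.f q)
    (hc : D.Cons h (p, q) j) : ∃ z, D.Fc p q z := by
  rcases D.face hc with ⟨b, c, a, hR, _, _, _, hb⟩ | ⟨b, c, a, hR, _, _, hb, _⟩
  · unfold Pre.bd at hb
    split_ifs at hb with l1 l2 <;> simp only [Prod.mk.injEq] at hb <;> obtain ⟨rfl, rfl⟩ := hb
    · exact ⟨a, Or.inr (Or.inr (Or.inl hR))⟩
    · exact ⟨c, Or.inl hR⟩
    · exact absurd h1 (lt_irrefl _)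
  · simp only [Prod.mk.injEq] at hb
    obtain ⟨rfl, rfl⟩ := hb
    exact ⟨b, by unfold Pre.Fc; tauto⟩

/-- has something on the right at its level -/
def Pre.HR (D : Pre V) (w : V) : Prop := ∃ k, D.It (D.f w) k ∧ D.x w < D.xi k (D.f w)
def Pre.HL (D : Pre V) (w : V) : Prop := ∃ k, D.It (D.f w) k ∧ D.xi k (D.f w) < D.x w

lemma Pre.fx_HR {D : Pre V} {w : V} : D.fx.HR w ↔ D.HL w := by
  unfold Pre.HR Pre.HL
  refine exists_congr fun k => and_congr Iff.rfl ?_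
  rw [show D.fx.xi k (D.fx.f w) = _ from D.fx_xi _ _]
  exact neg_lt_neg_iff

lemma Pre.ff_HR {D : Pre V} {w : V} (h : D.HR w) : D.ff.HR w := by
  obtain ⟨k, h1, h2⟩ := h
  refine ⟨k.swap, (D.ff_It _ _).2 (by simpa using h1), ?_⟩
  rw [show D.ff.xi _ (D.ff.f w) = _ from D.ff_xi _ _]
  rw [Prod.swap_swap]; exact h2

lemma Pre.It_ne {D : Pre V} {w : V} {k : V × V} (hk : D.It (D.f w) k)
    (hx : D.xi k (D.f w) ≠ D.x w) : D.G.Adj k.1 k.2 ∧ D.f k.1 < D.f w ∧ D.f w < D.f k.2 := by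
  rcases hk with h | ⟨h, h'⟩
  · exact h
  · obtain ⟨k1, k2⟩ := k
    simp only at h h'
    have := D.inj h'; subst this; subst h
    exact absurd (D.xi_vert _ _) hx

lemma Dr.ex_up [Finite V] (D : Dr V) {p q : V} (pq : D.G.Adj p q) (hl : D.f p < D.f q)
    (hp : D.HR p ∨ D.HR q) : ∃ z, D.Fc p q z := by
  obtain ⟨w, hw1, hw2, hw3, hw⟩ : ∃ w, D.f p ≤ D.f w ∧ D.f w ≤ D.f q ∧ D.xi (p, q) (D.f w) = D.x w ∧
      D.HR w := by
    rcases hp with h | h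
    · exact ⟨p, le_rfl, hl.le, D.xi_bot _ _, h⟩
    · exact ⟨q, hl.le, le_rfl, D.xi_top _ _, h⟩
  obtain ⟨⟨c, a⟩, k1, k2⟩ := hw
  obtain ⟨ca, cw, wa⟩ := Pre.It_ne k1 (ne_of_gt k2)
  simp only at ca cw wa
  obtain ⟨t, t1, t2⟩ := exists_between (show max (D.f p) (D.f c) < min (D.f q) (D.f a) from
    max_lt (lt_min hl (by linarith)) (lt_min (by linarith) (by linarith)))
  obtain ⟨t1, t1'⟩ := max_lt_iff.1 t1
  obtain ⟨t2, t2'⟩ := lt_min_iff.1 t2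
  have := D.ord' (h2 := t) pq ca hw1 hw2 t1 t2 cw.le wa.le t1' t2' (by rw [hw3]; exact k2)
  obtain ⟨j, hj⟩ := D.exists_cons (Pre.It_edge pq t1 t2) (Pre.It_edge ca t1' t2') this
  exact D.Fc_of_cons hl hj

lemma Dr.ex_Fc [Finite V] (D : Dr V) {p q : V} (pq : D.G.Adj p q)
    (hp : (D.HR p ∧ D.HL p) ∨ (D.HR q ∧ D.HL q)) : ∃ z, D.Fc p q z := by
  rcases lt_trichotomy (D.f p) (D.f q) with l | l | l
  · exact D.ex_up pq l (by tauto)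
  · exact absurd (D.inj l) pq.ne
  · obtain ⟨z, hz⟩ := D.fx.ex_up (p := q) (q := p) pq.symm l (by
      rw [show D.fx.HR q ↔ _ from Pre.fx_HR, show D.fx.HR p ↔ _ from Pre.fx_HR]; tauto)
    exact ⟨z, Pre.fx_Fc.1 hz⟩

open Classical in
lemma Dr.K [Fintype V] (D : Dr V) {w : V} (hw : D.HR w ∧ D.HL w) (φ : V → ℝ) :
    ∑ y, ∑ z, (if D.Fc w y z then φ z - φ y else 0) = 0 := by
  have e1 : ∀ y, ∑ z, (if D.Fc w y z then φ y else 0) = if D.G.Adj w y then φ y else 0 := by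
    intro y
    split_ifs with h
    · obtain ⟨z, hz⟩ := D.ex_Fc h (Or.inl hw)
      rw [Finset.sum_eq_single z]
      · simp [hz]
      · intro z' _ hne
        rw [if_neg]; exact fun h' => hne (h'.unique hz)
      · simp
    · apply Finset.sum_eq_zero
      intro z _
      rw [if_neg]; exact fun h' => h h'.adj.1
  have e2 : ∀ z, ∑ y, (if D.Fc w y z then φ z else 0) = if D.G.Adj w z then φ z else 0 := by
    intro z
    split_ifs with h
    · obtain ⟨y, hy⟩ := D.ex_Fc h.symm (Or.inr hw)
      rw [Finset.sum_eq_single y]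
      · simp [hy.rot]
      · intro z' _ hne
        rw [if_neg]; exact fun h' => hne (h'.rot.rot.unique hy)
      · simp
    · apply Finset.sum_eq_zero
      intro y _
      rw [if_neg]; exact fun h' => h h'.adj.2.2.symm
  have : ∑ y, ∑ z, (if D.Fc w y z then φ z - φ y else 0) =
      (∑ y, ∑ z, if D.Fc w y z then φ z else 0) - ∑ y, ∑ z, if D.Fc w y z then φ y else 0 := by
    rw [← Finset.sum_sub_distrib]
    refine Finset.sum_congr rfl fun y _ => ?_
    rw [← Finset.sum_sub_distrib]
    refine Finset.sum_congr rfl fun z _ => ?_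
    split_ifs <;> simp
  rw [this, Finset.sum_comm]
  simp only [e1, e2, sub_self]

end FC

namespace FC
variable {V : Type}

structure Ct (V : Type) extends Dr V where
  u : V
  v : V
  uv : G.Adj u v
  luv : f u < f v
  gap : ∀ w, w ≠ u → f w < f v → f w < f u
  g : V → ℝ
  guv : g u = g v
  gm : ∀ p q, f p < f q → (p = u ∧ q = v) ∨ g p < g q

def Ct.fx (C : Ct V) : Ct V where
  toDr := C.toDr.fx
  u := C.u
  v := C.v
  uv := C.uv
  luv := C.luv
  gap := C.gap
  g := C.g
  guv := C.guv
  gm := C.gm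

def Ct.ff (C : Ct V) : Ct V where
  toDr := C.toDr.ff
  u := C.v
  v := C.u
  uv := C.uv.symm
  luv := neg_lt_neg C.luv
  gap := by
    intro w h1 h2
    have h2 : -C.f w < - C.f C.u := h2
    show -C.f w < - C.f C.v
    by_contra h3
    have : C.f w ≤ C.f C.v := by linarith
    rcases this.lt_or_eq with l | l
    · have := C.gap w (fun e => by subst e; exact absurd h2 (lt_irrefl _)) l
      linarith
    · exact h1 (C.inj l)
  g := fun w => - C.g w
  guv := by rw [C.guv]
  gm := by
    intro p q h
    have h : -C.f p < -C.f q := h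
    rcases C.gm q p (by linarith) with ⟨h1, h2⟩ | h1
    · exact Or.inl ⟨h2, h1⟩
    · exact Or.inr (neg_lt_neg h1)

lemma Ct.g_le (C : Ct V) {p q : V} (h : C.f p ≤ C.f q) : C.g p ≤ C.g q := by
  rcases h.lt_or_eq with h | h
  · rcases C.gm p q h with ⟨h1, h2⟩ | h1
    · rw [h1, h2, C.guv]
    · exact h1.le
  · rw [C.inj h]

lemma Ct.lt_of_g (C : Ct V) {p q : V} (h : C.g p < C.g q) : C.f p < C.f q := by
  by_contra h'
  exact absurd (C.g_le (not_lt.1 h')) (not_le.2 h)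

lemma Ct.g_eq (C : Ct V) {p q : V} (h : C.g p = C.g q) :
    p = q ∨ (p = C.u ∧ q = C.v) ∨ (p = C.v ∧ q = C.u) := by
  rcases lt_trichotomy (C.f p) (C.f q) with l | l | l
  · rcases C.gm p q l with h1 | h1
    · tauto
    · exact absurd h h1.ne
  · exact Or.inl (C.inj l)
  · rcases C.gm q p l with h1 | h1
    · tauto
    · exact absurd h h1.ne'

def Ct.Act (C : Ct V) (p q z : V) : Prop :=
  ¬ ((C.u = p ∨ C.u = q ∨ C.u = z) ∧ (C.v = p ∨ C.v = q ∨ C.v = z))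

lemma Ct.Act.g_lt {C : Ct V} {b c a : V} (h : C.Act b c a) (h1 : C.f c < C.f b)
    (h2 : C.f b < C.f a) : C.g c < C.g b ∧ C.g b < C.g a := by
  constructor
  · rcases C.gm c b h1 with ⟨rfl, rfl⟩ | h
    · exact absurd (by simp) h
    · exact h
  · rcases C.gm b a h2 with ⟨rfl, rfl⟩ | h
    · exact absurd (by simp) h
    · exact h

lemma Ct.transfer (C : Ct V) {w w' c a : V} (e : C.g w = C.g w') (ca : C.G.Adj c a)
    (h1 : C.g c < C.g w) (h2 : C.g w < C.g a) (hx : C.x w < C.xi (c, a) (C.f w)) :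
    C.x w' < C.xi (c, a) (C.f w') := by
  have l1 := C.lt_of_g h1
  have l2 := C.lt_of_g h2
  have l3 := C.lt_of_g (e ▸ h1)
  have l4 := C.lt_of_g (e ▸ h2)
  rcases C.g_eq e with rfl | ⟨rfl, rfl⟩ | ⟨rfl, rfl⟩
  · exact hx
  · have := C.ord (h2 := C.f C.v) C.uv ca le_rfl C.luv.le C.luv.le le_rfl l1.le l2.le l3.le l4.le
      (by rw [C.xi_bot]; exact hx)
    rw [C.xi_top] at this
    exact lt_of_le_of_ne this (C.p2 _ _ _ ca l3 l4).symm
  · have := C.ord (h2 := C.f C.u) C.uv ca C.luv.le le_rfl le_rfl C.luv.le l1.le l2.le l3.le l4.le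
      (by rw [C.xi_top]; exact hx)
    rw [C.xi_bot] at this
    exact lt_of_le_of_ne this (C.p2 _ _ _ ca l3 l4).symm

lemma Ct.RF_spans (C : Ct V) {b b' c a : V} (h : C.RF b c a) (ha : C.Act b c a)
    (e : C.g b = C.g b') : C.f c < C.f b' ∧ C.f b' < C.f a ∧ C.x b' < C.xi (c, a) (C.f b') := by
  obtain ⟨h1, h2, _, _, ca⟩ := Pre.RF_lt h
  obtain ⟨g1, g2⟩ := ha.g_lt h1 h2
  refine ⟨C.lt_of_g (e ▸ g1), C.lt_of_g (e ▸ g2), C.transfer e ca g1 g2 ?_⟩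
  have := h.2.2.2.2.2.1.2.2.1
  rwa [C.xi_vert] at this

lemma Ct.AR_unique_uv (C : Ct V) {c a c' a' : V} (h : C.RF C.u c a) (ha : C.Act C.u c a)
    (h' : C.RF C.v c' a') (ha' : C.Act C.v c' a') : False := by
  obtain ⟨h1, h2, _, _, ca⟩ := Pre.RF_lt h
  obtain ⟨h1', h2', _, _, ca'⟩ := Pre.RF_lt h'
  obtain ⟨i1, i2, i3⟩ := C.RF_spans h ha C.guv
  obtain ⟨j1, j2, j3⟩ := C.RF_spans h' ha' C.guv.symm
  have k1 : C.xi (c, a) (C.f C.u) ≤ C.xi (c', a') (C.f C.u) := by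
    by_contra hc
    exact h.2.2.2.2.2.1.2.2.2 (c', a') (Pre.It_edge ca' j1 j2)
      ⟨by rw [C.xi_vert]; exact j3, not_le.1 hc⟩
  have k2 : C.xi (c', a') (C.f C.v) ≤ C.xi (c, a) (C.f C.v) := by
    by_contra hc
    exact h'.2.2.2.2.2.1.2.2.2 (c, a) (Pre.It_edge ca i1 i2)
      ⟨by rw [C.xi_vert]; exact i3, not_le.1 hc⟩
  have e : (c, a) = (c', a') := by
    rcases k1.lt_or_eq with l | l
    · have := C.ord' (h2 := C.f C.v) ca ca' h1.le h2.le i1 i2 j1.le j2.le h1' h2' l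
      linarith
    · exact C.It_inj (Pre.It_edge ca h1 h2) (Pre.It_edge ca' j1 j2) l
  simp only [Prod.mk.injEq] at e
  obtain ⟨rfl, rfl⟩ := e
  have := h.2.2.2.2.2.1.left_unique (h'.cons h1 h2)
  unfold Pre.bd at this
  rw [if_pos C.luv] at this
  simp only [Prod.mk.injEq] at this
  exact C.uv.ne this.2

lemma Ct.AR_unique (C : Ct V) {b c a b' c' a' : V} (h : C.RF b c a) (ha : C.Act b c a)
    (h' : C.RF b' c' a') (ha' : C.Act b' c' a') (e : C.g b = C.g b') :
    b = b' ∧ c = c' ∧ a = a' := by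
  rcases C.g_eq e with rfl | ⟨rfl, rfl⟩ | ⟨rfl, rfl⟩
  · have := h.2.2.2.2.2.1.right_unique h'.2.2.2.2.2.1
    simp only [Prod.mk.injEq] at this
    exact ⟨rfl, this.1, this.2⟩
  · exact (C.AR_unique_uv h ha h' ha').elim
  · exact (C.AR_unique_uv h' ha' h ha).elim

lemma Ct.AR_exists [Finite V] (C : Ct V) {w p q : V} (pq : C.G.Adj p q) (h1 : C.g p < C.g w)
    (h2 : C.g w < C.g q) (hx : C.x w < C.xi (p, q) (C.f w)) :
    ∃ b c a, C.RF b c a ∧ C.Act b c a ∧ C.g b = C.g w ∧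
      C.xi (c, a) (C.f b) ≤ C.xi (p, q) (C.f b) := by
  have key : ∀ b, C.g b = C.g w → ∃ c a, C.RF b c a ∧
      C.xi (c, a) (C.f b) ≤ C.xi (p, q) (C.f b) := by
    intro b e
    have hit : C.It (C.f b) (p, q) :=
      Pre.It_edge pq (C.lt_of_g (e ▸ h1)) (C.lt_of_g (e ▸ h2))
    have hb := C.transfer e.symm pq h1 h2 hx
    obtain ⟨⟨c, a⟩, hj⟩ := C.exists_cons (C.It_vert b) hit (by rw [C.xi_vert]; exact hb)
    refine ⟨c, a, C.RF_of_Cons hj, ?_⟩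
    by_contra hc
    exact hj.2.2.2 (p, q) hit ⟨by rw [C.xi_vert]; exact hb, not_le.1 hc⟩
  by_cases hw : w = C.u ∨ w = C.v
  · have e : C.g C.u = C.g w ∧ C.g C.v = C.g w := by
      rcases hw with rfl | rfl
      · exact ⟨rfl, C.guv.symm⟩
      · exact ⟨C.guv, rfl⟩
    obtain ⟨c, a, hR, hl⟩ := key C.u e.1
    obtain ⟨c', a', hR', hl'⟩ := key C.v e.2
    by_cases hA : C.Act C.u c a
    · exact ⟨_, c, a, hR, hA, e.1, hl⟩
    by_cases hA' : C.Act C.v c' a'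
    · exact ⟨_, c', a', hR', hA', e.2, hl'⟩
    exfalso
    obtain ⟨i1, i2, _⟩ := Pre.RF_lt hR
    obtain ⟨j1, j2, _⟩ := Pre.RF_lt hR'
    have va : C.v = a := by
      have := (not_not.1 hA).2
      rcases this with h | h | h
      · exact absurd h C.uv.ne'
      · rw [← h] at i1; exact absurd i1 (not_lt.2 C.luv.le)
      · exact h
    have uc : C.u = c' := by
      have := (not_not.1 hA').1
      rcases this with h | h | h
      · exact absurd h C.uv.ne
      · exact h
      · rw [← h] at j2; exact absurd j2 (not_lt.2 C.luv.le)
    subst va uc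
    have f1 : C.Fc C.u C.v c := Or.inl hR
    have f2 : C.Fc C.u C.v a' := Or.inr (Or.inr (Or.inl hR'))
    have := f1.unique f2
    subst this
    linarith
  · obtain ⟨c, a, hR, hl⟩ := key w rfl
    refine ⟨w, c, a, hR, ?_, rfl, hl⟩
    rintro ⟨q1, q2⟩
    push Not at hw
    obtain ⟨i1, i2, _⟩ := Pre.RF_lt hR
    have : (C.u = c ∨ C.u = a) ∧ (C.v = c ∨ C.v = a) := ⟨by tauto, by tauto⟩
    obtain ⟨g1, g2⟩ : C.f c < C.f w ∧ C.f w < C.f a := ⟨i1, i2⟩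
    rcases this with ⟨rfl | rfl, h | h⟩
    · exact C.uv.ne h.symm
    · subst h
      have := C.gap w hw.1 i2; linarith
    · subst h; have := C.luv; linarith
    · exact C.uv.ne h.symm

lemma Ct.AL_exists [Finite V] (C : Ct V) {w p q : V} (pq : C.G.Adj p q) (h1 : C.g p < C.g w)
    (h2 : C.g w < C.g q) (hx : C.xi (p, q) (C.f w) < C.x w) :
    ∃ b c a, C.LF b c a ∧ C.Act b c a ∧ C.g b = C.g w ∧
      C.xi (p, q) (C.f b) ≤ C.xi (c, a) (C.f b) := by
  obtain ⟨b, c, a, q1, q2, q3, q4⟩ := C.fx.AR_exists (w := w) pq h1 h2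
    (by rw [show C.fx.xi (p, q) (C.fx.f w) = _ from C.fx_xi _ _]; exact neg_lt_neg hx)
  refine ⟨b, c, a, q1, q2, q3, ?_⟩
  rw [show C.fx.xi (p, q) (C.fx.f b) = _ from C.fx_xi _ _,
    show C.fx.xi (c, a) (C.fx.f b) = _ from C.fx_xi _ _] at q4
  exact neg_le_neg_iff.1 q4

/-! sum argument -/
noncomputable def Ct.S (C : Ct V) (y : V → ℝ) (p q : V) : ℝ := (y q - y p) / (C.g q - C.g p)

lemma Ct.S_symm (C : Ct V) (y : V → ℝ) (p q : V) : C.S y p q = C.S y q p := by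
  unfold Ct.S
  rw [← neg_sub (y p), ← neg_sub (C.g p), neg_div_neg_eq]

noncomputable def Ct.T (C : Ct V) (y : V → ℝ) (b c a : V) : ℝ := C.S y b a - C.S y c b

def Ct.Bal (C : Ct V) (y : V → ℝ) : Prop :=
  ∀ b c a b' c' a', C.RF b c a → C.Act b c a → C.LF b' c' a' → C.Act b' c' a' → C.g b = C.g b' →
    C.T y b c a = - C.T y b' c' a'

def Ct.SingR (C : Ct V) (y : V → ℝ) : Prop :=
  ∀ b c a, C.RF b c a → C.Act b c a →
    (∃ b' c' a', C.LF b' c' a' ∧ C.Act b' c' a' ∧ C.g b = C.g b') ∨ 0 ≤ C.T y b c a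
def Ct.SingL (C : Ct V) (y : V → ℝ) : Prop :=
  ∀ b c a, C.LF b c a → C.Act b c a →
    (∃ b' c' a', C.RF b' c' a' ∧ C.Act b' c' a' ∧ C.g b = C.g b') ∨ C.T y b c a ≤ 0

/-- identities for the slopes -/
lemma Ct.slopes (C : Ct V) (y : V → ℝ) {b c a : V} (h1 : C.g c < C.g b) (h2 : C.g b < C.g a) :
    ∃ l : ℝ, 0 < l ∧ l < 1 ∧ C.S y a b - C.S y a c = l * C.T y b c a ∧
      C.S y c a - C.S y c b = (1 - l) * C.T y b c a := by
  refine ⟨(C.g b - C.g c) / (C.g a - C.g c), div_pos (by linarith) (by linarith),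
    (div_lt_one (by linarith)).2 (by linarith), ?_, ?_⟩
  · unfold Ct.T Ct.S
    have e1 : C.g b - C.g a ≠ 0 := by linarith
    have e2 : C.g c - C.g a ≠ 0 := by linarith
    have e3 : C.g a - C.g c ≠ 0 := by linarith
    have e4 : C.g a - C.g b ≠ 0 := by linarith
    have e5 : C.g b - C.g c ≠ 0 := by linarith
    rw [← neg_sub (C.g a) (C.g b), ← neg_sub (C.g a) (C.g c)]
    field_simp
    ring
  · unfold Ct.T Ct.S
    have e1 : C.g b - C.g a ≠ 0 := by linarith
    have e2 : C.g c - C.g a ≠ 0 := by linarith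
    have e3 : C.g a - C.g c ≠ 0 := by linarith
    have e4 : C.g a - C.g b ≠ 0 := by linarith
    have e5 : C.g b - C.g c ≠ 0 := by linarith
    field_simp
    ring

lemma rot_sum [Fintype V] (F : V → V → V → ℝ) :
    ∑ p, ∑ q, ∑ z, (F p q z + F q z p + F z p q) = 3 * ∑ p, ∑ q, ∑ z, F p q z := by
  simp only [Finset.sum_add_distrib]
  have e1 : ∀ F : V → V → V → ℝ, ∑ p, ∑ q, ∑ z, F q z p = ∑ p, ∑ q, ∑ z, F p q z := by
    intro F
    rw [Finset.sum_comm]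
    refine Finset.sum_congr rfl fun q _ => ?_
    rw [Finset.sum_comm]
  have e2 := e1 (fun p q z => F q z p)
  rw [e2, e1 F]; ring

end FC

namespace FC
variable {V : Type}

def Ct.N (C : Ct V) (y : V → ℝ) (w : V) : Prop :=
  (∃ b c a, C.RF b c a ∧ C.Act b c a ∧ C.g b = C.g w ∧ C.T y b c a < 0) ∧
  (∃ b c a, C.LF b c a ∧ C.Act b c a ∧ C.g b = C.g w)

lemma Ct.HR_of (C : Ct V) {b c a w : V} (h : C.RF b c a) (ha : C.Act b c a)
    (e : C.g b = C.g w) : C.HR w := by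
  obtain ⟨i1, i2, i3⟩ := C.RF_spans h ha e
  exact ⟨(c, a), Pre.It_edge (Pre.RF_lt h).2.2.2.2 i1 i2, i3⟩

lemma Ct.HL_of (C : Ct V) {b c a w : V} (h : C.LF b c a) (ha : C.Act b c a)
    (e : C.g b = C.g w) : C.HL w := Pre.fx_HR.1 (C.fx.HR_of h ha e)

open Classical in
noncomputable def Ct.gN (C : Ct V) (y : V → ℝ) (p q z : V) : ℝ :=
  if C.N y p then C.S y p z - C.S y p q else 0

noncomputable def Ct.GG (C : Ct V) (y : V → ℝ) (p q z : V) : ℝ :=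
  C.gN y p q z + C.gN y q z p + C.gN y z p q

lemma Ct.GG_rot (C : Ct V) (y : V → ℝ) (p q z : V) : C.GG y p q z = C.GG y q z p := by
  unfold Ct.GG; ring

lemma Ct.GG_inact (C : Ct V) {y : V → ℝ} (hy : y C.u = y C.v) {p q z : V} (h : ¬ C.Act p q z) :
    C.GG y p q z = 0 := by
  have hS : ∀ q, C.S y C.u q = C.S y C.v q := by
    intro q; unfold Ct.S; rw [hy, C.guv]
  have hS' : ∀ q, C.S y q C.u = C.S y q C.v := by
    intro q; unfold Ct.S; rw [hy, C.guv]
  have h0 : C.S y C.v C.v = 0 := by simp [Ct.S]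
  have hN : C.N y C.u ↔ C.N y C.v := by unfold Ct.N; rw [C.guv]
  have hu := C.uv.ne
  unfold Ct.Act at h
  rw [not_not] at h
  unfold Ct.GG Ct.gN
  rcases h with ⟨rfl | rfl | rfl, h | h | h⟩ <;> try exact absurd h.symm hu
  all_goals subst h
  all_goals simp only [hS, hS', hN, h0]
  all_goals split_ifs <;> first | (exfalso; tauto) | simp [C.S_symm]

lemma Ct.N_RF (C : Ct V) {y : V → ℝ} (hB : C.Bal y) {b c a : V} (h : C.RF b c a)
    (ha : C.Act b c a) (hN : C.N y b) : C.T y b c a < 0 := by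
  obtain ⟨⟨b1, c1, a1, r1, r2, r3, r4⟩, b2, c2, a2, l1, l2, l3⟩ := hN
  have e1 := hB _ _ _ _ _ _ r1 r2 l1 l2 (r3.trans l3.symm)
  have e2 := hB _ _ _ _ _ _ h ha l1 l2 l3.symm
  linarith

lemma Ct.N_LF (C : Ct V) {y : V → ℝ} (hB : C.Bal y) {b c a : V} (h : C.LF b c a)
    (ha : C.Act b c a) (hN : C.N y b) : 0 < C.T y b c a := by
  obtain ⟨⟨b1, c1, a1, r1, r2, r3, r4⟩, b2, c2, a2, l1, l2, l3⟩ := hN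
  have e1 := hB _ _ _ _ _ _ r1 r2 h ha r3
  linarith

lemma Ct.nN_RF (C : Ct V) {y : V → ℝ} (hs : C.SingR y) {b c a : V} (h : C.RF b c a)
    (ha : C.Act b c a) (hN : ¬ C.N y b) : 0 ≤ C.T y b c a := by
  rcases hs b c a h ha with ⟨b', c', a', l1, l2, l3⟩ | h1
  · by_contra hc
    exact hN ⟨⟨b, c, a, h, ha, rfl, not_le.1 hc⟩, b', c', a', l1, l2, l3.symm⟩
  · exact h1

lemma Ct.nN_LF (C : Ct V) {y : V → ℝ} (hB : C.Bal y) (hs : C.SingL y) {b c a : V}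
    (h : C.LF b c a) (ha : C.Act b c a) (hN : ¬ C.N y b) : C.T y b c a ≤ 0 := by
  rcases hs b c a h ha with ⟨b', c', a', l1, l2, l3⟩ | h1
  · by_contra hc
    have := hB _ _ _ _ _ _ l1 l2 h ha l3.symm
    exact hN ⟨⟨b', c', a', l1, l2, l3.symm, by linarith⟩, b, c, a, h, ha, rfl⟩
  · exact h1

lemma Ct.GG_RF (C : Ct V) {y : V → ℝ} (hy : y C.u = y C.v) (hB : C.Bal y) (hs : C.SingR y)
    {b c a : V} (h : C.RF b c a) :
    0 ≤ C.GG y b a c ∧ (C.Act b c a → C.N y b → C.GG y b a c = 0 → C.N y a) := by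
  by_cases ha : C.Act b c a
  swap
  · refine ⟨(C.GG_inact hy ?_).ge, fun h => absurd h ha⟩
    unfold Ct.Act at *; tauto
  obtain ⟨g1, g2⟩ := ha.g_lt h.1 h.2.1
  obtain ⟨l, l0, l1, e1, e2⟩ := C.slopes y g1 g2
  have e3 : C.S y b c - C.S y b a = - C.T y b c a := by
    unfold Ct.T; rw [C.S_symm y b c]; ring
  unfold Ct.GG Ct.gN
  by_cases hb : C.N y b
  · have hT := C.N_RF hB h ha hb
    refine ⟨?_, fun _ _ h0 => ?_⟩
    · split_ifs <;> nlinarith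
    · by_contra hna
      rw [if_pos hb, if_neg hna] at h0
      split_ifs at h0 <;> nlinarith
  · have hT := C.nN_RF hs h ha hb
    refine ⟨?_, fun _ hN => absurd hN hb⟩
    split_ifs <;> nlinarith

lemma Ct.GG_LF (C : Ct V) {y : V → ℝ} (hy : y C.u = y C.v) (hB : C.Bal y) (hs : C.SingL y)
    {b c a : V} (h : C.LF b c a) : 0 ≤ C.GG y b c a := by
  by_cases ha : C.Act b c a
  swap
  · exact (C.GG_inact hy ha).ge
  obtain ⟨g1, g2⟩ := ha.g_lt h.1 h.2.1
  obtain ⟨l, l0, l1, e1, e2⟩ := C.slopes y g1 g2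
  have e3 : C.S y b c - C.S y b a = - C.T y b c a := by
    unfold Ct.T; rw [C.S_symm y b c]; ring
  unfold Ct.GG Ct.gN
  by_cases hb : C.N y b
  · have hT := C.N_LF hB h ha hb
    split_ifs <;> nlinarith
  · have hT := C.nN_LF hB hs h ha hb
    split_ifs <;> nlinarith

lemma Ct.GG_Fc (C : Ct V) {y : V → ℝ} (hy : y C.u = y C.v) (hB : C.Bal y) (hs : C.SingR y)
    (hs' : C.SingL y) {p q z : V} (h : C.Fc p q z) : 0 ≤ C.GG y p q z := by
  rcases h with h | h | h | h | h | h
  · exact (C.GG_RF hy hB hs h).1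
  · rw [C.GG_rot, C.GG_rot]; exact (C.GG_RF hy hB hs h).1
  · rw [C.GG_rot]; exact (C.GG_RF hy hB hs h).1
  · exact C.GG_LF hy hB hs' h
  · rw [C.GG_rot, C.GG_rot]; exact C.GG_LF hy hB hs' h
  · rw [C.GG_rot]; exact C.GG_LF hy hB hs' h

open Classical in
lemma Ct.GG_zero [Fintype V] (C : Ct V) {y : V → ℝ} (hy : y C.u = y C.v) (hB : C.Bal y)
    (hs : C.SingR y) (hs' : C.SingL y) {p q z : V} (h : C.Fc p q z) : C.GG y p q z = 0 := by
  set F : V → V → V → ℝ := fun p q z => if C.Fc p q z then C.gN y p q z else 0 with hF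
  have h0 : ∑ p, ∑ q, ∑ z, F p q z = 0 := by
    apply Finset.sum_eq_zero
    intro w _
    by_cases hw : C.N y w
    · have := C.K (w := w) ⟨?_, ?_⟩ (C.S y w)
      · simpa [hF, Ct.gN, hw] using this
      · obtain ⟨⟨b, c, a, h1, h2, h3, _⟩, _⟩ := hw
        exact C.HR_of h1 h2 h3
      · obtain ⟨_, b, c, a, h1, h2, h3⟩ := hw
        exact C.HL_of h1 h2 h3
    · simp [hF, Ct.gN, hw]
  have h1 := rot_sum F
  rw [h0, mul_zero] at h1
  have hnn : ∀ p q z, 0 ≤ F p q z + F q z p + F z p q := by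
    intro p q z
    by_cases h : C.Fc p q z
    · have := C.GG_Fc hy hB hs hs' h
      simpa [hF, h, h.rot, h.rot.rot, Ct.GG] using this
    · have h2 : ¬ C.Fc q z p := fun h' => h h'.rot.rot
      have h3 : ¬ C.Fc z p q := fun h' => h h'.rot
      simp [hF, h, h2, h3]
  have e1 := (Finset.sum_eq_zero_iff_of_nonneg (fun p _ =>
    Finset.sum_nonneg fun q _ => Finset.sum_nonneg fun z _ => hnn p q z)).1 h1 p (Finset.mem_univ _)
  have e2 := (Finset.sum_eq_zero_iff_of_nonneg (fun q _ =>
    Finset.sum_nonneg fun z _ => hnn p q z)).1 e1 q (Finset.mem_univ _)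
  have e3 := (Finset.sum_eq_zero_iff_of_nonneg (fun z _ => hnn p q z)).1 e2 z (Finset.mem_univ _)
  simpa [hF, h, h.rot, h.rot.rot, Ct.GG] using e3

def Ct.Pos (C : Ct V) (y : V → ℝ) : Prop :=
  (∀ b c a, C.RF b c a → C.Act b c a → 0 ≤ C.T y b c a) ∧
  (∀ b c a, C.LF b c a → C.Act b c a → C.T y b c a ≤ 0)

theorem Ct.sumArg [Fintype V] (C : Ct V) {y : V → ℝ} (hy : y C.u = y C.v) (hB : C.Bal y)
    (hs : C.SingR y) (hs' : C.SingL y) : C.Pos y := by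
  have hN : ∀ w, ¬ C.N y w := by
    by_contra hne
    push Not at hne
    obtain ⟨w, hw, hm⟩ := Set.exists_max_image {w | C.N y w} C.g (Set.toFinite _) hne
    obtain ⟨⟨b, c, a, h1, h2, h3, h4⟩, h5⟩ := id hw
    have hb : C.N y b := by
      unfold Ct.N at hw ⊢; rw [h3]; exact hw
    have := (C.GG_RF hy hB hs h1).2 h2 hb (C.GG_zero hy hB hs hs' (Or.inl h1))
    have h6 := hm a this
    have := (h2.g_lt h1.1 h1.2.1).2
    linarith
  exact ⟨fun b c a h1 h2 => C.nN_RF hs h1 h2 (hN b), fun b c a h1 h2 => C.nN_LF hB hs' h1 h2 (hN b)⟩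

end FC

namespace FC
variable {V : Type}

noncomputable def Ct.Y (C : Ct V) (y : V → ℝ) (i : V × V) (t : ℝ) : ℝ := X C.g y i.1 i.2 t

lemma Ct.Y_bot (C : Ct V) (y : V → ℝ) (c a : V) : C.Y y (c, a) (C.g c) = y c := X_bot _ _ _ _
lemma Ct.Y_top (C : Ct V) (y : V → ℝ) {c a : V} (h : C.g c ≠ C.g a) :
    C.Y y (c, a) (C.g a) = y a := X_top _ _ _ _ h
lemma Ct.Y_vert (C : Ct V) (y : V → ℝ) (c : V) (t : ℝ) : C.Y y (c, c) t = y c := X_self _ _ _ _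
lemma Ct.Y_aff (C : Ct V) (y : V → ℝ) (i : V × V) : Aff (C.Y y i) := aff_X _ _ _ _

lemma Ct.Y_S (C : Ct V) (y : V → ℝ) (c a : V) (t : ℝ) :
    C.Y y (c, a) t = y c + (t - C.g c) * C.S y c a := by
  unfold Ct.Y X Ct.S; ring

lemma Ct.Y_S' (C : Ct V) (y : V → ℝ) {c a : V} (h : C.g c ≠ C.g a) (t : ℝ) :
    C.Y y (c, a) t = y a + (t - C.g a) * C.S y c a := by
  have : C.g a - C.g c ≠ 0 := sub_ne_zero.2 h.symm
  unfold Ct.Y X Ct.S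
  field_simp
  ring

def Ct.Mt (C : Ct V) (h t : ℝ) : Prop :=
  ∀ w, (C.g w < t → C.f w < h) ∧ (t < C.g w → h < C.f w)

lemma Ct.Mt_vert (C : Ct V) (b : V) : C.Mt (C.f b) (C.g b) :=
  fun _ => ⟨C.lt_of_g, C.lt_of_g⟩

lemma Ct.Mt_exists [Fintype V] (C : Ct V) (t : ℝ) : ∃ h, C.Mt h t := by
  classical
  let s : Finset ℝ := (Finset.univ.filter (fun w => C.g w < t)).image C.f
  let r : Finset ℝ := (Finset.univ.filter (fun w => t < C.g w)).image C.f
  obtain ⟨h, h1, h2⟩ := Order.exists_between_finsets s r (by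
    intro a ha b hb
    simp only [s, r, Finset.mem_image, Finset.mem_filter, Finset.mem_univ, true_and] at ha hb
    obtain ⟨p, hp, rfl⟩ := ha
    obtain ⟨q, hq, rfl⟩ := hb
    exact C.lt_of_g (hp.trans hq))
  refine ⟨h, fun w => ⟨fun hw => h1 _ ?_, fun hw => h2 _ ?_⟩⟩
  · exact Finset.mem_image_of_mem _ (by simpa using hw)
  · exact Finset.mem_image_of_mem _ (by simpa using hw)

lemma Ct.Mt.ge {C : Ct V} {h t : ℝ} (m : C.Mt h t) {w : V} (hw : C.f w ≤ h) : C.g w ≤ t :=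
  not_lt.1 fun l => absurd ((m w).2 l) (not_lt.2 hw)
lemma Ct.Mt.le {C : Ct V} {h t : ℝ} (m : C.Mt h t) {w : V} (hw : h ≤ C.f w) : t ≤ C.g w :=
  not_lt.1 fun l => absurd ((m w).1 l) (not_lt.2 hw)

def Ct.E (C : Ct V) (t : ℝ) (i j : V × V) : Prop :=
  (C.g i.1 = C.g j.1 ∧ C.g i.2 = C.g j.2) ∨
    ((C.g i.1 = t ∨ C.g i.2 = t) ∧ (C.g j.1 = t ∨ C.g j.2 = t))

lemma Ct.E.symm {C : Ct V} {t : ℝ} {i j : V × V} (h : C.E t i j) : C.E t j i := by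
  rcases h with ⟨h1, h2⟩ | ⟨h1, h2⟩
  · exact Or.inl ⟨h1.symm, h2.symm⟩
  · exact Or.inr ⟨h2, h1⟩

lemma Ct.E.trans {C : Ct V} {t : ℝ} {i j k : V × V} (h : C.E t i j) (h' : C.E t j k) :
    C.E t i k := by
  unfold Ct.E at *
  rcases h with ⟨h1, h2⟩ | ⟨h1, h2⟩ <;> rcases h' with ⟨h1', h2'⟩ | ⟨h1', h2'⟩
  · exact Or.inl ⟨h1.trans h1', h2.trans h2'⟩
  · right; rw [h1, h2]; exact ⟨h1', h2'⟩
  · right; rw [← h1', ← h2']; exact ⟨h1, h2⟩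
  · exact Or.inr ⟨h1, h2'⟩

lemma Ct.gapR (C : Ct V) {y : V → ℝ} (hy : y C.u = y C.v) {b c a : V} (hR : C.RF b c a) {h t : ℝ}
    (h1 : C.f c < h) (h2 : h < C.f a) (m : C.Mt h t) :
    (C.Y y (C.bd b c a h) t = C.Y y (c, a) t ∧ C.E t (C.bd b c a h) (c, a)) ∨
    (C.Act b c a ∧ ∃ r, 0 ≤ r ∧ C.Y y (c, a) t - C.Y y (C.bd b c a h) t = r * C.T y b c a ∧
      (r = 0 → C.E t (C.bd b c a h) (c, a))) := by
  obtain ⟨l1, l2, _, _, ca⟩ := Pre.RF_lt hR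
  have m1 := m.ge h1.le
  have m2 := m.le h2.le
  by_cases ha : C.Act b c a
  · right
    refine ⟨ha, ?_⟩
    obtain ⟨g1, g2⟩ := ha.g_lt l1 l2
    obtain ⟨l, l0, l1, e1, e2⟩ := C.slopes y g1 g2
    unfold Pre.bd
    split_ifs with k1 k2
    · refine ⟨(t - C.g c) * (1 - l), mul_nonneg (by linarith) (by linarith), ?_, ?_⟩
      · rw [C.Y_S, C.Y_S, mul_assoc, ← e2]; ring
      · intro h0
        have : t = C.g c := by
          rcases mul_eq_zero.1 h0 with h | h <;> linarith
        exact Or.inr ⟨Or.inl this.symm, Or.inl this.symm⟩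
    · refine ⟨(C.g a - t) * l, mul_nonneg (by linarith) (by linarith), ?_, ?_⟩
      · rw [C.Y_S' y (by linarith), C.Y_S' y (by linarith), mul_assoc, ← e1, C.S_symm y c a,
          C.S_symm y b a]; ring
      · intro h0
        have : t = C.g a := by
          rcases mul_eq_zero.1 h0 with h | h <;> linarith
        exact Or.inr ⟨Or.inr this.symm, Or.inr this.symm⟩
    · have hb : h = C.f b := le_antisymm (not_lt.1 k2) (not_lt.1 k1)
      have tb : t = C.g b := le_antisymm (m.le hb.le) (m.ge hb.ge)
      have e3 : y b = y c + (C.g b - C.g c) * C.S y c b := by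
        rw [← C.Y_S, C.Y_top y (by linarith)]
      have hpos : 0 < (t - C.g c) * (1 - l) := mul_pos (by linarith) (by linarith)
      refine ⟨(t - C.g c) * (1 - l), hpos.le, ?_, fun h0 => absurd h0 hpos.ne'⟩
      rw [C.Y_vert, C.Y_S, mul_assoc, ← e2, e3, tb]; ring
  · left
    have hcase : (c = C.u ∧ b = C.v) ∨ (b = C.u ∧ a = C.v) := by
      obtain ⟨q1, q2⟩ := not_not.1 ha
      have hl := C.luv
      rcases q1 with rfl | rfl | rfl <;> rcases q2 with h | h | h
      · exact absurd h.symm C.uv.ne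
      · subst h; linarith
      · exact Or.inr ⟨rfl, h.symm⟩
      · exact Or.inl ⟨rfl, h.symm⟩
      · exact absurd h.symm C.uv.ne
      · subst h
        have := C.gap b (fun e => by subst e; exact lt_irrefl _ l1) l2
        linarith
      · subst h; linarith
      · subst h; linarith
      · exact absurd h.symm C.uv.ne
    rcases hcase with ⟨rfl, rfl⟩ | ⟨rfl, rfl⟩
    · unfold Pre.bd
      split_ifs with k1 k2
      · have tu : t = C.g C.u := le_antisymm (C.guv ▸ m.le k1.le) m1
        rw [tu, C.Y_bot, C.Y_bot]
        exact ⟨rfl, Or.inr ⟨Or.inl rfl, Or.inl rfl⟩⟩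
      · refine ⟨?_, Or.inl ⟨C.guv.symm, rfl⟩⟩
        unfold Ct.Y X
        simp only [hy, C.guv]
      · have hb : h = C.f C.v := le_antisymm (not_lt.1 k2) (not_lt.1 k1)
        have tb : t = C.g C.v := le_antisymm (m.le hb.le) (m.ge hb.ge)
        rw [tb, C.Y_vert, ← C.guv, C.Y_bot]
        exact ⟨hy.symm, Or.inr ⟨Or.inl C.guv.symm, Or.inl rfl⟩⟩
    · have gc : C.g c < C.g C.v := by
        rcases C.gm c C.u l1 with ⟨_, h⟩ | h
        · exact absurd h C.uv.ne
        · rwa [C.guv] at h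
      unfold Pre.bd
      split_ifs with k1 k2
      · refine ⟨?_, Or.inl ⟨rfl, C.guv⟩⟩
        unfold Ct.Y X
        simp only [hy, C.guv]
      · have tu : t = C.g C.v := le_antisymm m2 (C.guv ▸ m.ge k2.le)
        rw [tu, C.Y_top y gc.ne, ← C.guv, C.Y_bot]
        exact ⟨hy, Or.inr ⟨Or.inl rfl, Or.inr C.guv.symm⟩⟩
      · have hb : h = C.f C.u := le_antisymm (not_lt.1 k2) (not_lt.1 k1)
        have tb : t = C.g C.v := by
          rw [← C.guv]; exact le_antisymm (m.le hb.le) (m.ge hb.ge)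
        rw [tb, C.Y_vert, C.Y_top y gc.ne]
        exact ⟨hy, Or.inr ⟨Or.inl C.guv, Or.inr rfl⟩⟩

lemma Ct.Y_neg (C : Ct V) (y : V → ℝ) (i : V × V) (t : ℝ) :
    C.Y (fun v => - y v) i t = - C.Y y i t := X_negx _ _ _ _ _

lemma Ct.S_neg (C : Ct V) (y : V → ℝ) (p q : V) : C.S (fun v => - y v) p q = - C.S y p q := by
  unfold Ct.S; ring

lemma Ct.T_neg (C : Ct V) (y : V → ℝ) (b c a : V) :
    C.T (fun v => - y v) b c a = - C.T y b c a := by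
  unfold Ct.T; rw [C.S_neg, C.S_neg]; ring

lemma Ct.gapL (C : Ct V) {y : V → ℝ} (hy : y C.u = y C.v) {b c a : V} (hR : C.LF b c a) {h t : ℝ}
    (h1 : C.f c < h) (h2 : h < C.f a) (m : C.Mt h t) :
    (C.Y y (c, a) t = C.Y y (C.bd b c a h) t ∧ C.E t (c, a) (C.bd b c a h)) ∨
    (C.Act b c a ∧ ∃ r, 0 ≤ r ∧ C.Y y (C.bd b c a h) t - C.Y y (c, a) t = r * (- C.T y b c a) ∧
      (r = 0 → C.E t (c, a) (C.bd b c a h))) := by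
  have hm : C.fx.Mt h t := m
  have h0 : (fun v => - y v) C.fx.u = (fun v => - y v) C.fx.v := congrArg _ hy
  have key := C.fx.gapR (y := fun v => - y v) h0 hR h1 h2 hm
  have e1 : ∀ i, C.fx.Y (fun v => - y v) i t = - C.Y y i t := fun i => C.Y_neg y i t
  have e2 : C.fx.T (fun v => - y v) b c a = - C.T y b c a := C.T_neg y b c a
  have e3 : C.fx.bd b c a h = C.bd b c a h := rfl
  simp only [e1, e2, e3] at key
  rcases key with ⟨k1, k2⟩ | ⟨k1, r, k2, k3, k4⟩
  · exact Or.inl ⟨by linarith, Ct.E.symm k2⟩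
  · exact Or.inr ⟨k1, r, k2, by linarith, fun h => Ct.E.symm (k4 h)⟩

lemma Pre.chain [Finite V] (D : Pre V) {h : ℝ} (P : V × V → V × V → Prop)
    (hc : ∀ i j, D.Cons h i j → P i j) (tr : ∀ i j k, P i j → P j k → P i k) {i j : V × V}
    (hi : D.It h i) (hj : D.It h j) (hl : D.xi i h < D.xi j h) : P i j := by
  by_contra hn
  obtain ⟨j, ⟨j1, j2, j3⟩, jm⟩ := Set.exists_min_image
    {j | D.It h j ∧ D.xi i h < D.xi j h ∧ ¬ P i j}
    (fun j => D.xi j h) (Set.toFinite _) ⟨j, hj, hl, hn⟩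
  obtain ⟨k, ⟨k1, k2, k3⟩, km⟩ := Set.exists_max_image
    {k | D.It h k ∧ D.xi i h ≤ D.xi k h ∧ D.xi k h < D.xi j h}
    (fun j => D.xi j h) (Set.toFinite _) ⟨i, hi, le_rfl, j2⟩
  have hkj : D.Cons h k j := ⟨k1, j1, k3, fun l hl hb =>
    absurd (km l ⟨hl, by linarith, hb.2⟩) (not_le.2 hb.1)⟩
  rcases k2.lt_or_eq with l | l
  · by_cases hp : P i k
    · exact j3 (tr _ _ _ hp (hc _ _ hkj))
    · exact absurd (jm k ⟨k1, l, hp⟩) (not_le.2 k3)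
  · have := D.It_inj hi k1 l
    subst this
    exact j3 (hc _ _ hkj)

lemma Ct.mono [Finite V] (C : Ct V) {y : V → ℝ} (hy : y C.u = y C.v) (hp : C.Pos y) {h t : ℝ}
    (m : C.Mt h t) {i j : V × V} (hi : C.It h i) (hj : C.It h j) (hl : C.xi i h < C.xi j h) :
    C.Y y i t ≤ C.Y y j t := by
  refine C.chain (fun i j => C.Y y i t ≤ C.Y y j t) ?_ (fun _ _ _ h1 h2 => h1.trans h2) hi hj hl
  intro i j hc
  rcases C.face hc with ⟨b, c, a, hR, h1, h2, rfl, rfl⟩ | ⟨b, c, a, hR, h1, h2, rfl, rfl⟩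
  · rcases C.gapR hy hR h1 h2 m with ⟨h3, _⟩ | ⟨ha, r, r0, e, _⟩
    · exact h3.le
    · have := mul_nonneg r0 (hp.1 b c a hR ha); linarith
  · rcases C.gapL hy hR h1 h2 m with ⟨h3, _⟩ | ⟨ha, r, r0, e, _⟩
    · exact h3.le
    · have := mul_nonneg r0 (neg_nonneg.2 (hp.2 b c a hR ha)); linarith

def Ct.SPos (C : Ct V) (y : V → ℝ) : Prop :=
  (∀ b c a, C.RF b c a → C.Act b c a → 0 < C.T y b c a) ∧
  (∀ b c a, C.LF b c a → C.Act b c a → C.T y b c a < 0)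

lemma Ct.smono [Finite V] (C : Ct V) {y : V → ℝ} (hy : y C.u = y C.v) (hp : C.SPos y) {h t : ℝ}
    (m : C.Mt h t) {i j : V × V} (hi : C.It h i) (hj : C.It h j) (hl : C.xi i h < C.xi j h) :
    C.Y y i t ≤ C.Y y j t ∧ (C.Y y i t = C.Y y j t → C.E t i j) := by
  refine C.chain (fun i j => C.Y y i t ≤ C.Y y j t ∧ (C.Y y i t = C.Y y j t → C.E t i j)) ?_
    (fun i j k h1 h2 => ⟨h1.1.trans h2.1, fun e => ?_⟩) hi hj hl
  · intro i j hc
    rcases C.face hc with ⟨b, c, a, hR, h1, h2, rfl, rfl⟩ | ⟨b, c, a, hR, h1, h2, rfl, rfl⟩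
    · rcases C.gapR hy hR h1 h2 m with ⟨h3, h4⟩ | ⟨ha, r, r0, e, h4⟩
      · exact ⟨h3.le, fun _ => h4⟩
      · have hT := hp.1 b c a hR ha
        have := mul_nonneg r0 hT.le
        refine ⟨by linarith, fun e' => h4 ?_⟩
        rw [e', sub_self] at e
        exact (mul_eq_zero.1 e.symm).resolve_right hT.ne'
    · rcases C.gapL hy hR h1 h2 m with ⟨h3, h4⟩ | ⟨ha, r, r0, e, h4⟩
      · exact ⟨h3.le, fun _ => h4⟩
      · have hT := neg_pos.2 (hp.2 b c a hR ha)
        have := mul_nonneg r0 hT.le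
        refine ⟨by linarith, fun e' => h4 ?_⟩
        rw [e', sub_self] at e
        exact (mul_eq_zero.1 e.symm).resolve_right hT.ne'
  · have := h1.1
    have := h2.1
    exact (h1.2 (by linarith)).trans (h2.2 (by linarith))

lemma Ct.strict [Finite V] (C : Ct V) {y : V → ℝ} (hy : y C.u = y C.v) (hp : C.SPos y) {h t : ℝ}
    (m : C.Mt h t) {i j : V × V} (hi : C.It h i) (hj : C.It h j) (e : C.Y y i t = C.Y y j t) :
    C.E t i j := by
  rcases lt_trichotomy (C.xi i h) (C.xi j h) with l | l | l
  · exact (C.smono hy hp m hi hj l).2 e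
  · rw [C.It_inj hi hj l]; exact Or.inl ⟨rfl, rfl⟩
  · exact ((C.smono hy hp m hj hi l).2 e.symm).symm

lemma Aff.eq_of {g k : ℝ → ℝ} (hg : Aff g) (hk : Aff k) {s t : ℝ} (hst : s ≠ t) (h1 : g s = k s)
    (h2 : g t = k t) (r : ℝ) : g r = k r := by
  obtain ⟨a, b, e⟩ := hg
  obtain ⟨c, d, e'⟩ := hk
  rw [e, e'] at *
  have : (b - d) * (s - t) = 0 := by linarith
  rcases mul_eq_zero.1 this with h | h
  · have : b = d := by linarith
    subst this; linarith
  · exact absurd (by linarith) hst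

end FC

namespace FC
variable {V : Type}

def Ct.NP (C : Ct V) : Prop := ∀ w, (∃ p, C.g p < C.g w) → (∃ q, C.g w < C.g q) →
  ∃ c a, C.G.Adj c a ∧ C.g c < C.g w ∧ C.g w < C.g a
def Ct.HN (C : Ct V) : Prop := ∀ w, ∃ z, C.G.Adj w z ∧ C.g z ≠ C.g w

lemma Ct.allEq [Finite V] (C : Ct V) {y : V → ℝ} (hy : y C.u = y C.v) (hp : C.Pos y)
    (hn : C.Pos (fun v => - y v)) {h t : ℝ}
    (m : C.Mt h t) {i j : V × V} (hi : C.It h i) (hj : C.It h j) : C.Y y i t = C.Y y j t := by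
  have key : ∀ i j, C.It h i → C.It h j → C.xi i h < C.xi j h → C.Y y i t = C.Y y j t := by
    intro i j hi hj l
    have h1 := C.mono hy hp m hi hj l
    have h2 := C.mono (y := fun v => - y v) (congrArg _ hy) hn m hi hj l
    rw [C.Y_neg, C.Y_neg] at h2
    linarith
  rcases lt_trichotomy (C.xi i h) (C.xi j h) with l | l | l
  · exact key i j hi hj l
  · rw [C.It_inj hi hj l]
  · exact (key j i hj hi l).symm

lemma Ct.It_of_g (C : Ct V) {h t : ℝ} (m : C.Mt h t) {p q : V} (pq : C.G.Adj p q)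
    (h1 : C.g p < t) (h2 : t < C.g q) : C.It h (p, q) :=
  Pre.It_edge pq ((m p).1 h1) ((m q).2 h2)

lemma Ct.overlap [Fintype V] (C : Ct V) {y : V → ℝ} (hy : y C.u = y C.v) (hp : C.Pos y)
    (hn : C.Pos (fun v => - y v)) {p q r s : V} (pq : C.G.Adj p q) (rs : C.G.Adj r s)
    (h1 : C.g p < C.g q) (h2 : C.g p < C.g s) (h3 : C.g r < C.g q) (h4 : C.g r < C.g s) (t : ℝ) :
    C.Y y (p, q) t = C.Y y (r, s) t := by
  have hlt : max (C.g p) (C.g r) < min (C.g q) (C.g s) :=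
    max_lt (lt_min h1 h2) (lt_min h3 h4)
  obtain ⟨t1, a1, b1⟩ := exists_between hlt
  obtain ⟨t2, a2, b2⟩ := exists_between b1
  have key : ∀ t, max (C.g p) (C.g r) < t → t < min (C.g q) (C.g s) →
      C.Y y (p, q) t = C.Y y (r, s) t := by
    intro t a b
    obtain ⟨h, m⟩ := C.Mt_exists t
    rw [max_lt_iff] at a
    rw [lt_min_iff] at b
    exact C.allEq hy hp hn m (C.It_of_g m pq a.1 b.1) (C.It_of_g m rs a.2 b.2)
  exact (C.Y_aff y (p, q)).eq_of (C.Y_aff y (r, s)) a2.ne (key _ a1 b1) (key _ (a1.trans a2) b2) t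

lemma Ct.kernel [Fintype V] (C : Ct V) (hN : C.NP) (hH : C.HN) {y : V → ℝ} (hy : y C.u = y C.v)
    (hp : C.Pos y) (hn : C.Pos (fun v => - y v)) : ∃ l : ℝ → ℝ, Aff l ∧ ∀ w, y w = l (C.g w) := by
  haveI : Nonempty V := ⟨C.u⟩
  obtain ⟨w0, hw0⟩ := Finite.exists_min C.g
  obtain ⟨z0, hz, hz'⟩ := hH w0
  have hz0 := lt_of_le_of_ne (hw0 z0) hz'.symm
  have claim : ∀ p q, C.G.Adj p q → C.g p < C.g q → ∀ t, C.Y y (p, q) t = C.Y y (w0, z0) t := by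
    by_contra hc
    push Not at hc
    obtain ⟨p, q, h1, h2, t, h3⟩ := hc
    obtain ⟨⟨p, q⟩, ⟨h1, h2, t, h3⟩, hm⟩ := Set.exists_min_image
      {i : V × V | C.G.Adj i.1 i.2 ∧ C.g i.1 < C.g i.2 ∧ ∃ t, C.Y y i t ≠ C.Y y (w0, z0) t}
      (fun i => C.g i.1) (Set.toFinite _) ⟨(p, q), h1, h2, t, h3⟩
    rcases (hw0 p).lt_or_eq with l | l
    · obtain ⟨c, a, ca, h4, h5⟩ := hN p ⟨_, l⟩ ⟨_, h2⟩
      have e := C.overlap hy hp hn h1 ca h2 h5 (h4.trans h2) (h4.trans h5)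
      have := hm (c, a) ⟨ca, h4.trans h5, t, by rw [← e]; exact h3⟩
      exact absurd h4 (not_lt.2 this)
    · exact h3 (C.overlap hy hp hn h1 hz h2 (by rw [← l]; exact hz0)
        (by rw [l]; exact h2) hz0 t)
  refine ⟨_, C.Y_aff y (w0, z0), fun w => ?_⟩
  obtain ⟨z, wz, hne⟩ := hH w
  rcases lt_or_gt_of_ne hne with l | l
  · rw [← claim _ _ wz.symm l, C.Y_top y l.ne]
  · rw [← claim _ _ wz l, C.Y_bot y]

lemma Ct.AL_unique (C : Ct V) {b c a b' c' a' : V} (h : C.LF b c a) (ha : C.Act b c a)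
    (h' : C.LF b' c' a') (ha' : C.Act b' c' a') (e : C.g b = C.g b') :
    b = b' ∧ c = c' ∧ a = a' := C.fx.AR_unique h ha h' ha' e

noncomputable def Ct.Tl (C : Ct V) (b c a : V) : (V → ℝ) →ₗ[ℝ] ℝ where
  toFun y := C.T y b c a
  map_add' y z := by simp only [Ct.T, Ct.S, Pi.add_apply]; ring
  map_smul' r y := by
    simp only [Ct.T, Ct.S, Pi.smul_apply, smul_eq_mul, RingHom.id_apply]; ring

def Ct.Ext (C : Ct V) (w : V) : Prop := (∀ p, C.g p ≤ C.g w) ∨ (∀ p, C.g w ≤ C.g p)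
def Ct.AR (C : Ct V) (w : V) (i : V × V × V) : Prop :=
  C.RF i.1 i.2.1 i.2.2 ∧ C.Act i.1 i.2.1 i.2.2 ∧ C.g i.1 = C.g w
def Ct.AL (C : Ct V) (w : V) (i : V × V × V) : Prop :=
  C.LF i.1 i.2.1 i.2.2 ∧ C.Act i.1 i.2.1 i.2.2 ∧ C.g i.1 = C.g w

open Classical in
noncomputable def Ct.MR [Fintype V] (C : Ct V) (w : V) : (V → ℝ) →ₗ[ℝ] ℝ :=
  ∑ i : V × V × V, if C.AR w i then C.Tl i.1 i.2.1 i.2.2 else 0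
open Classical in
noncomputable def Ct.ML [Fintype V] (C : Ct V) (w : V) : (V → ℝ) →ₗ[ℝ] ℝ :=
  ∑ i : V × V × V, if C.AL w i then C.Tl i.1 i.2.1 i.2.2 else 0

lemma Ct.MR_eq [Fintype V] (C : Ct V) {w : V} {b c a : V} (h : C.AR w (b, c, a)) (y : V → ℝ) :
    C.MR w y = C.T y b c a := by
  classical
  unfold Ct.MR
  rw [Finset.sum_eq_single (b, c, a)]
  · rw [if_pos h]; rfl
  · intro i _ hi
    refine if_neg fun h' => hi ?_
    obtain ⟨e1, e2, e3⟩ := C.AR_unique h'.1 h'.2.1 h.1 h.2.1 (h'.2.2.trans h.2.2.symm)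
    exact Prod.ext e1 (Prod.ext e2 e3)
  · intro h; exact absurd (Finset.mem_univ _) h

lemma Ct.ML_eq [Fintype V] (C : Ct V) {w : V} {b c a : V} (h : C.AL w (b, c, a)) (y : V → ℝ) :
    C.ML w y = C.T y b c a := by
  classical
  unfold Ct.ML
  rw [Finset.sum_eq_single (b, c, a)]
  · rw [if_pos h]; rfl
  · intro i _ hi
    refine if_neg fun h' => hi ?_
    obtain ⟨e1, e2, e3⟩ := C.AL_unique h'.1 h'.2.1 h.1 h.2.1 (h'.2.2.trans h.2.2.symm)
    exact Prod.ext e1 (Prod.ext e2 e3)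
  · intro h; exact absurd (Finset.mem_univ _) h

lemma Ct.MR_zero [Fintype V] (C : Ct V) {w : V} (h : ¬ ∃ i, C.AR w i) : C.MR w = 0 := by
  classical
  exact Finset.sum_eq_zero fun i _ => if_neg fun h' => h ⟨i, h'⟩
lemma Ct.ML_zero [Fintype V] (C : Ct V) {w : V} (h : ¬ ∃ i, C.AL w i) : C.ML w = 0 := by
  classical
  exact Finset.sum_eq_zero fun i _ => if_neg fun h' => h ⟨i, h'⟩

def Ct.DD (C : Ct V) (w : V) : Prop := (∃ i, C.AR w i) ∧ ∃ i, C.AL w i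

open Classical in
noncomputable def Ct.Ph [Fintype V] (C : Ct V) : (V → ℝ) →ₗ[ℝ] (V → ℝ) :=
  LinearMap.pi fun w => if w = C.u then
      (LinearMap.proj C.u : (V → ℝ) →ₗ[ℝ] ℝ) - (LinearMap.proj C.v : (V → ℝ) →ₗ[ℝ] ℝ)
    else if C.Ext w then (LinearMap.proj w : (V → ℝ) →ₗ[ℝ] ℝ)
    else if C.DD w then C.MR w + C.ML w else C.MR w - C.ML w

lemma Ct.Act.ext {C : Ct V} {b c a w : V} (h : C.Act b c a) (h1 : C.f c < C.f b)
    (h2 : C.f b < C.f a) (e : C.g b = C.g w) : ¬ C.Ext w := by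
  obtain ⟨g1, g2⟩ := h.g_lt h1 h2
  rintro (h | h)
  · have := h a; linarith
  · have := h c; linarith

lemma Ct.rep (C : Ct V) (b : V) : ∃ w, w ≠ C.u ∧ C.g b = C.g w := by
  by_cases h : b = C.u
  · exact ⟨C.v, C.uv.ne', by rw [h, C.guv]⟩
  · exact ⟨b, h, rfl⟩

lemma Ct.Ph_cons [Fintype V] (C : Ct V) {y : V → ℝ} {k : ℝ} (hu : C.Ph y C.u = 0)
    (h0 : ∀ w, w ≠ C.u → ¬ C.Ext w → C.DD w → C.Ph y w = 0)
    (h1 : ∀ w, w ≠ C.u → ¬ C.Ext w → ¬ C.DD w → C.Ph y w = k) :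
    y C.u = y C.v ∧ C.Bal y ∧
    (∀ b c a, C.RF b c a → C.Act b c a → 
      (∃ b' c' a', C.LF b' c' a' ∧ C.Act b' c' a' ∧ C.g b = C.g b') ∨ C.T y b c a = k) ∧
    (∀ b c a, C.LF b c a → C.Act b c a → 
      (∃ b' c' a', C.RF b' c' a' ∧ C.Act b' c' a' ∧ C.g b = C.g b') ∨ C.T y b c a = - k) := by
  refine ⟨?_, ?_, ?_, ?_⟩
  · simp only [Ct.Ph, LinearMap.pi_apply, if_true, LinearMap.sub_apply, LinearMap.proj_apply] at hu
    linarith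
  · intro b c a b' c' a' hR ha hL ha' e
    obtain ⟨w, w1, w2⟩ := C.rep b
    have r1 : C.AR w (b, c, a) := ⟨hR, ha, w2⟩
    have r2 : C.AL w (b', c', a') := ⟨hL, ha', e ▸ w2⟩
    have hE := ha.ext hR.1 hR.2.1 w2
    have hD : C.DD w := ⟨⟨_, r1⟩, ⟨_, r2⟩⟩
    have := h0 w w1 hE hD
    simp only [Ct.Ph, LinearMap.pi_apply, if_neg w1, if_neg hE, if_pos hD, LinearMap.add_apply,
      C.MR_eq r1, C.ML_eq r2] at this
    linarith
  · intro b c a hR ha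
    obtain ⟨w, w1, w2⟩ := C.rep b
    have r1 : C.AR w (b, c, a) := ⟨hR, ha, w2⟩
    have hE := ha.ext hR.1 hR.2.1 w2
    by_cases h : ∃ i, C.AL w i
    · obtain ⟨⟨b', c', a'⟩, h2, h3, h4⟩ := h
      exact Or.inl ⟨b', c', a', h2, h3, w2.trans h4.symm⟩
    · right
      have hD : ¬ C.DD w := fun hd => h hd.2
      have := h1 w w1 hE hD
      simpa only [Ct.Ph, LinearMap.pi_apply, if_neg w1, if_neg hE, if_neg hD, LinearMap.sub_apply,
        C.MR_eq r1, C.ML_zero h, LinearMap.zero_apply, sub_zero] using this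
  · intro b c a hR ha
    obtain ⟨w, w1, w2⟩ := C.rep b
    have r1 : C.AL w (b, c, a) := ⟨hR, ha, w2⟩
    have hE := ha.ext hR.1 hR.2.1 w2
    by_cases h : ∃ i, C.AR w i
    · obtain ⟨⟨b', c', a'⟩, h2, h3, h4⟩ := h
      exact Or.inl ⟨b', c', a', h2, h3, w2.trans h4.symm⟩
    · right
      have hD : ¬ C.DD w := fun hd => h hd.1
      have := h1 w w1 hE hD
      simp only [Ct.Ph, LinearMap.pi_apply, if_neg w1, if_neg hE, if_neg hD, LinearMap.neg_apply,
        C.ML_eq r1, C.MR_zero h, zero_sub] at this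
      linarith

lemma Ct.sol [Fintype V] (C : Ct V) (hN : C.NP) (hH : C.HN) : ∃ y : V → ℝ, y C.u = y C.v ∧
    C.Bal y ∧ C.Pos y ∧
    (∀ b c a, C.RF b c a → C.Act b c a → 
      (∃ b' c' a', C.LF b' c' a' ∧ C.Act b' c' a' ∧ C.g b = C.g b') ∨ C.T y b c a = 1) ∧
    (∀ b c a, C.LF b c a → C.Act b c a → 
      (∃ b' c' a', C.RF b' c' a' ∧ C.Act b' c' a' ∧ C.g b = C.g b') ∨ C.T y b c a = - 1) := by
  classical
  have inj : Function.Injective C.Ph := by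
    rw [← LinearMap.ker_eq_bot, LinearMap.ker_eq_bot']
    intro y h
    obtain ⟨e1, e2, e3, e4⟩ := C.Ph_cons (k := 0) (congrFun h C.u) (fun w _ _ _ => congrFun h w)
      (fun w _ _ _ => congrFun h w)
    have p1 : C.Pos y := C.sumArg e1 e2 (fun b c a h1 h2 => (e3 b c a h1 h2).imp id fun h => h.ge)
      (fun b c a h1 h2 => (e4 b c a h1 h2).imp id fun h => by linarith)
    have p2 : C.Pos (fun v => - y v) := by
      refine C.sumArg (congrArg _ e1) ?_ ?_ ?_
      · intro b c a b' c' a' h1 h2 h3 h4 h5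
        rw [C.T_neg, C.T_neg, e2 b c a b' c' a' h1 h2 h3 h4 h5]
      · exact (fun b c a h1 h2 => (e3 b c a h1 h2).imp id fun h => by rw [C.T_neg]; linarith)
      · exact (fun b c a h1 h2 => (e4 b c a h1 h2).imp id fun h => by rw [C.T_neg]; linarith)
    obtain ⟨l, hl, e⟩ := C.kernel hN hH e1 p1 p2
    haveI : Nonempty V := ⟨C.u⟩
    have ext0 : ∀ w, C.Ext w → y w = 0 := by
      intro w hw
      obtain ⟨w', h1, h2⟩ := C.rep w
      have hw' : C.Ext w' := by unfold Ct.Ext at *; rw [← h2]; exact hw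
      rw [e, h2, ← e]
      have := congrFun h w'
      simpa only [Ct.Ph, LinearMap.pi_apply, if_neg h1, if_pos hw', LinearMap.proj_apply,
        Pi.zero_apply] using this
    obtain ⟨w0, h0⟩ := Finite.exists_min C.g
    obtain ⟨w1, h1⟩ := Finite.exists_max C.g
    have z0 := ext0 w0 (Or.inr h0)
    have z1 := ext0 w1 (Or.inl h1)
    have hne : C.g w0 ≠ C.g w1 := by
      intro he
      obtain ⟨z, _, hz⟩ := hH w0
      exact hz (le_antisymm ((h1 z).trans he.ge) (h0 z))
    funext w
    rw [e]
    exact hl.eq_of (k := fun _ => 0) ⟨0, 0, fun t => by ring⟩ hne (by rw [← e, z0])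
      (by rw [← e, z1]) _
  obtain ⟨y, hy⟩ := LinearMap.injective_iff_surjective.1 inj
    (fun w => if w = C.u ∨ C.DD w then 0 else 1)
  obtain ⟨e1, e2, e3, e4⟩ := C.Ph_cons (y := y) (k := 1) (by rw [hy]; simp)
    (fun w _ _ h => by rw [hy]; simp [h])
    (fun w h _ h' => by rw [hy]; simp [h, h'])
  refine ⟨y, e1, e2, C.sumArg e1 e2 ?_ ?_, e3, e4⟩
  · exact (fun b c a h1 h2 => (e3 b c a h1 h2).imp id fun h => by linarith)
  · exact (fun b c a h1 h2 => (e4 b c a h1 h2).imp id fun h => by linarith)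

end FC

namespace FC
variable {V : Type}

def Colr (G : SimpleGraph V) (u v : V) : Prop :=
  ∃ c : V → Fin 4, c u = c v ∧ ∀ p q, G.Adj p q → s(p, q) ≠ s(u, v) → c p ≠ c q

lemma Ct.y_g (C : Ct V) {y : V → ℝ} (hy : y C.u = y C.v) {p q : V} (e : C.g p = C.g q) :
    y p = y q := by
  rcases C.g_eq e with rfl | ⟨rfl, rfl⟩ | ⟨rfl, rfl⟩
  · rfl
  · exact hy
  · exact hy.symm

lemma Ct.cross_vert [Finite V] (C : Ct V) {y : V → ℝ} (hy : y C.u = y C.v) (hp : C.SPos y)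
    {p q w : V} (pq : C.G.Adj p q) (h1 : C.g p < C.g w) (h2 : C.g w < C.g q)
    (e : C.Y y (p, q) (C.g w) = y w) : False := by
  have m := C.Mt_vert w
  have := C.strict hy hp m (C.It_of_g m pq h1 h2) (C.It_vert w) (by rw [e, C.Y_vert])
  rcases this with ⟨h, _⟩ | ⟨h | h, _⟩
  · exact h1.ne h
  · exact h1.ne h
  · exact h2.ne' h

lemma Ct.cross [Fintype V] (C : Ct V) {y : V → ℝ} (hy : y C.u = y C.v) (hp : C.SPos y)
    {p q r s : V} (pq : C.G.Adj p q) (rs : C.G.Adj r s) (h : C.g p < C.g q) (h' : C.g r < C.g s)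
    {t : ℝ} (h1 : C.g p ≤ t) (h2 : t ≤ C.g q) (h3 : C.g r ≤ t) (h4 : t ≤ C.g s)
    (e : C.Y y (p, q) t = C.Y y (r, s) t) : C.E t (p, q) (r, s) := by
  by_cases a1 : C.g p = t ∨ C.g q = t
  · by_cases a2 : C.g r = t ∨ C.g s = t
    · exact Or.inr ⟨a1, a2⟩
    · push Not at a2
      exfalso
      rcases a1 with rfl | rfl
      · exact C.cross_vert hy hp rs (lt_of_le_of_ne h3 a2.1) (lt_of_le_of_ne h4 a2.2.symm)
          (by rw [← e, C.Y_bot])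
      · exact C.cross_vert hy hp rs (lt_of_le_of_ne h3 a2.1) (lt_of_le_of_ne h4 a2.2.symm)
          (by rw [← e, C.Y_top y h.ne])
  · push Not at a1
    by_cases a2 : C.g r = t ∨ C.g s = t
    · exfalso
      rcases a2 with rfl | rfl
      · exact C.cross_vert hy hp pq (lt_of_le_of_ne h1 a1.1) (lt_of_le_of_ne h2 a1.2.symm)
          (by rw [e, C.Y_bot])
      · exact C.cross_vert hy hp pq (lt_of_le_of_ne h1 a1.1) (lt_of_le_of_ne h2 a1.2.symm)
          (by rw [e, C.Y_top y h'.ne])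
    · push Not at a2
      obtain ⟨k, m⟩ := C.Mt_exists t
      exact C.strict hy hp m
        (C.It_of_g m pq (lt_of_le_of_ne h1 a1.1) (lt_of_le_of_ne h2 a1.2.symm))
        (C.It_of_g m rs (lt_of_le_of_ne h3 a2.1) (lt_of_le_of_ne h4 a2.2.symm)) e

lemma Ct.segY (C : Ct V) (y : V → ℝ) {a b : V} (h : C.g a < C.g b) {z : ℝ × ℝ}
    (hz : z ∈ segment ℝ (y a, C.g a) (y b, C.g b)) :
    z.1 = C.Y y (a, b) z.2 ∧ C.g a ≤ z.2 ∧ z.2 ≤ C.g b := by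
  obtain ⟨s, r, s0, r0, e, rfl⟩ := hz
  obtain rfl : s = 1 - r := by linarith
  simp only [Prod.smul_mk, smul_eq_mul, Prod.mk_add_mk]
  refine ⟨?_, by nlinarith, by nlinarith⟩
  unfold Ct.Y X
  have : C.g b - C.g a ≠ 0 := by linarith
  field_simp
  ring

def Ct.H (C : Ct V) : SimpleGraph {w // w ≠ C.u} where
  Adj a b := a ≠ b ∧ ∃ p q, C.g p = C.g a ∧ C.g q = C.g b ∧ C.G.Adj p q
  symm := ⟨fun _ _ ⟨h, p, q, h1, h2, h3⟩ => ⟨h.symm, q, p, h2, h1, h3.symm⟩⟩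
  loopless := ⟨fun _ h => h.1 rfl⟩

lemma Ct.g_eq' (C : Ct V) {p q : V} (hp : p ≠ C.u) (hq : q ≠ C.u) (h : C.g p = C.g q) : p = q := by
  rcases C.g_eq h with h | ⟨h, _⟩ | ⟨_, h⟩
  · exact h
  · exact absurd h hp
  · exact absurd h hq

lemma Ct.H_edge (C : Ct V) {y : V → ℝ} (hy : y C.u = y C.v) {a b : {w // w ≠ C.u}}
    (h : C.H.Adj a b) {z : ℝ × ℝ} (hz : z ∈ segment ℝ (y a, C.g a) (y b, C.g b)) :
    ∃ p q, C.G.Adj p q ∧ C.g p < C.g q ∧ z.1 = C.Y y (p, q) z.2 ∧ C.g p ≤ z.2 ∧ z.2 ≤ C.g q ∧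
    ((C.g p = C.g a ∧ C.g q = C.g b) ∨ (C.g p = C.g b ∧ C.g q = C.g a)) := by
  obtain ⟨hne, p, q, e1, e2, pq⟩ := h
  have hg : C.g a ≠ C.g b := fun e => hne (Subtype.ext (C.g_eq' a.2 b.2 e))
  rw [← C.y_g hy e1, ← e1, ← e2, ← C.y_g hy e2] at hz
  rw [← e1, ← e2] at hg
  rcases lt_or_gt_of_ne hg with l | l
  · obtain ⟨h1, h2, h3⟩ := C.segY y l hz
    exact ⟨p, q, pq, l, h1, h2, h3, Or.inl ⟨e1, e2⟩⟩
  · rw [segment_symm] at hz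
    obtain ⟨h1, h2, h3⟩ := C.segY y l hz
    exact ⟨q, p, pq.symm, l, h1, h2, h3, Or.inr ⟨e2, e1⟩⟩

lemma Ct.H_planar [Fintype V] (C : Ct V) {y : V → ℝ} (hy : y C.u = y C.v) (hp : C.SPos y) :
    IsPlanar C.H := by
  refine ⟨fun w => (y w, C.g w), ?_, ?_⟩
  · intro a b h
    simp only [Prod.mk.injEq] at h
    exact Subtype.ext (C.g_eq' a.2 b.2 h.2)
  · intro a b c d hab hcd hne z h1 h2
    obtain ⟨p, q, pq, l, e, l1, l2, e1⟩ := C.H_edge hy hab h1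
    obtain ⟨r, s, rs, l', e', l1', l2', e2⟩ := C.H_edge hy hcd h2
    have hE := C.cross hy hp pq rs l l' l1 l2 l1' l2' (e.symm.trans e')
    have inj : ∀ a b : {w // w ≠ C.u}, C.g a = C.g b → a = b := fun a b h =>
      Subtype.ext (C.g_eq' a.2 b.2 h)
    have key : ∀ {p q : V} {a b : {w // w ≠ C.u}}, C.g p < C.g q → z.1 = C.Y y (p, q) z.2 →
        ((C.g p = C.g a ∧ C.g q = C.g b) ∨ (C.g p = C.g b ∧ C.g q = C.g a)) →
        (C.g p = z.2 ∨ C.g q = z.2) → (z = (y a, C.g a) ∨ z = (y b, C.g b)) := by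
      intro p q a b l e h1 h2
      have : z = (y p, C.g p) ∨ z = (y q, C.g q) := by
        rcases h2 with h2 | h2
        · left; exact Prod.ext (by rw [e, ← h2, C.Y_bot]) h2.symm
        · right; exact Prod.ext (by rw [e, ← h2, C.Y_top y l.ne]) h2.symm
      rcases h1 with ⟨h1, h3⟩ | ⟨h1, h3⟩
      · rw [← h1, ← h3, ← C.y_g hy h1, ← C.y_g hy h3]; exact this
      · rw [← h1, ← h3, ← C.y_g hy h1, ← C.y_g hy h3]; exact this.symm
    rcases hE with ⟨q1, q2⟩ | ⟨q1, q2⟩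
    · exfalso
      apply hne
      simp only at q1 q2
      rw [Sym2.eq_iff]
      rcases e1 with ⟨e1, e1'⟩ | ⟨e1, e1'⟩ <;> rcases e2 with ⟨e2, e2'⟩ | ⟨e2, e2'⟩
      · exact Or.inl ⟨inj _ _ (by linarith), inj _ _ (by linarith)⟩
      · exact Or.inr ⟨inj _ _ (by linarith), inj _ _ (by linarith)⟩
      · exact Or.inr ⟨inj _ _ (by linarith), inj _ _ (by linarith)⟩
      · exact Or.inl ⟨inj _ _ (by linarith), inj _ _ (by linarith)⟩
    · exact ⟨key l e e1 q1, key l' e' e2 q2⟩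

def Small (n : ℕ) : Prop := ∀ (W : Type) [Fintype W] (H : SimpleGraph W), IsPlanar H →
  Fintype.card W < n → H.Colorable 4

lemma Ct.colr [Fintype V] (C : Ct V) {y : V → ℝ} (hy : y C.u = y C.v) (hp : C.SPos y)
    (hs : Small (Fintype.card V)) : Colr C.G C.u C.v := by
  classical
  obtain ⟨k⟩ := hs _ C.H (C.H_planar hy hp) (by
    rw [Fintype.card_subtype_compl, Fintype.card_subtype_eq]
    have := Fintype.card_pos_iff.2 ⟨C.u⟩
    omega)
  choose r hr hg using C.rep
  refine ⟨fun w => k ⟨r w, hr w⟩, ?_, ?_⟩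
  · have : r C.u = r C.v := C.g_eq' (hr _) (hr _) (by rw [← hg, ← hg, C.guv])
    simp only [this]
  · intro p q pq hne
    refine k.valid ⟨?_, p, q, hg p, hg q, pq⟩
    intro e
    have e := congrArg Subtype.val e
    simp only at e
    have : C.g p = C.g q := by rw [hg, hg q, e]
    rcases C.g_eq this with h | ⟨rfl, rfl⟩ | ⟨rfl, rfl⟩
    · exact pq.ne h
    · exact hne rfl
    · exact hne Sym2.eq_swap

end FC

namespace FC
variable {V : Type}

lemma Pre.Fc.cons_mem {D : Pre V} {p q z : V} (h : D.Fc p q z) {t : ℝ} (h1 : D.f p < t)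
    (h2 : t < D.f q) : ∃ j : V × V, D.Cons t (p, q) j ∧ (j.1 = p ∨ j.1 = q ∨ j.1 = z) ∧
      (j.2 = p ∨ j.2 = q ∨ j.2 = z) := by
  rcases h.up (h1.trans h2) with h | h | h
  · exact ⟨_, h.2.2.2.2.2.2.2 t h1 h2, by simp, by simp⟩
  · exact ⟨_, h.2.2.2.2.2.2.1 t h1 h2, by simp, by simp⟩
  · refine ⟨_, h.cons h1 h2, ?_⟩
    unfold Pre.bd
    split_ifs <;> simp

lemma Dr.rmost [Finite V] (D : Dr V) {S P : Set V} (hd : ∀ w ∈ S, D.HR w ∧ D.HL w) (hSP : S ⊆ P)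
    (hn : ∀ w ∈ S, ∀ p, D.G.Adj w p → p ∈ P) {w0 : V} (h0 : w0 ∈ S) :
    ∃ p q, D.G.Adj p q ∧ p ∈ P ∧ q ∈ P ∧ p ∉ S ∧ q ∉ S ∧ D.f p < D.f w0 ∧ D.f w0 < D.f q ∧
      D.x w0 < D.xi (p, q) (D.f w0) := by
  obtain ⟨⟨p, q⟩, ⟨i1, i2, i3⟩, im⟩ := Set.exists_max_image
    {i | D.It (D.f w0) i ∧ i.1 ∈ P ∧ i.2 ∈ P} (fun i => D.xi i (D.f w0)) (Set.toFinite _)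
    ⟨(w0, w0), D.It_vert w0, hSP h0, hSP h0⟩
  simp only at i2 i3
  have hge : D.x w0 ≤ D.xi (p, q) (D.f w0) := by
    have := im (w0, w0) ⟨D.It_vert w0, hSP h0, hSP h0⟩
    simp only [D.xi_vert] at this
    exact this
  have hne : (p, q) ≠ (w0, w0) := by
    intro e
    rw [e] at im
    obtain ⟨k, k1, k2⟩ := (hd w0 h0).1
    obtain ⟨⟨c, a⟩, hj⟩ := D.exists_cons (D.It_vert w0) k1 (by rw [D.xi_vert]; exact k2)
    obtain ⟨_, _, h1, h2, _⟩ := Pre.RF_lt (D.RF_of_Cons hj)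
    have := im (c, a) ⟨hj.2.1, hn w0 h0 c h1.symm, hn w0 h0 a h2⟩
    exact absurd hj.2.2.1 (not_lt.2 this)
  have hlt : D.x w0 < D.xi (p, q) (D.f w0) := by
    refine lt_of_le_of_ne hge fun e => hne (D.It_inj i1 (D.It_vert w0) ?_)
    rw [D.xi_vert]; exact e.symm
  obtain ⟨pq, l1, l2⟩ := Pre.It_ne i1 hlt.ne'
  simp only at pq l1 l2
  have main : ¬ (p ∈ S ∨ q ∈ S) := by
    intro hpq
    obtain ⟨z, hz⟩ := D.ex_Fc pq (hpq.imp (hd p) (hd q))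
    have hzP : z ∈ P := by
      rcases hpq with h | h
      · exact hn p h z hz.adj.2.2.symm
      · exact hn q h z hz.adj.2.1
    obtain ⟨j, j1, j2, j3⟩ := hz.cons_mem l1 l2
    have m1 : j.1 ∈ P := by rcases j2 with h | h | h <;> rw [h] <;> assumption
    have m2 : j.2 ∈ P := by rcases j3 with h | h | h <;> rw [h] <;> assumption
    exact absurd j1.2.2.1 (not_lt.2 (im j ⟨j1.2.1, m1, m2⟩))
  push Not at main
  exact ⟨p, q, pq, i2, i3, main.1, main.2, l1, l2, hlt⟩

lemma Dr.lmost [Finite V] (D : Dr V) {S P : Set V} (hd : ∀ w ∈ S, D.HR w ∧ D.HL w) (hSP : S ⊆ P)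
    (hn : ∀ w ∈ S, ∀ p, D.G.Adj w p → p ∈ P) {w0 : V} (h0 : w0 ∈ S) :
    ∃ p q, D.G.Adj p q ∧ p ∈ P ∧ q ∈ P ∧ p ∉ S ∧ q ∉ S ∧ D.f p < D.f w0 ∧ D.f w0 < D.f q ∧
      D.xi (p, q) (D.f w0) < D.x w0 := by
  have hHL : ∀ w, D.HR w → D.fx.HL w := by
    rintro w ⟨k, k1, k2⟩
    refine ⟨k, k1, ?_⟩
    rw [show D.fx.xi k (D.fx.f w) = _ from D.fx_xi _ _]
    exact neg_lt_neg k2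
  obtain ⟨p, q, h1, h2, h3, h4, h5, h6, h7, h8⟩ := D.fx.rmost
    (fun w hw => ⟨(Pre.fx_HR (D := D.toPre)).2 (hd w hw).2, hHL w (hd w hw).1⟩) hSP hn h0
  refine ⟨p, q, h1, h2, h3, h4, h5, h6, h7, ?_⟩
  rw [show D.fx.xi _ (D.fx.f w0) = _ from D.fx_xi _ _] at h8
  exact neg_lt_neg_iff.1 h8

lemma Ct.Y_at (C : Ct V) (y : V → ℝ) (p q : V) (t s : ℝ) :
    C.Y y (p, q) t = C.Y y (p, q) s + (t - s) * C.S y p q := by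
  rw [C.Y_S, C.Y_S]; ring

lemma Ct.up [Fintype V] (C : Ct V) {y : V → ℝ} (hy : y C.u = y C.v) (hp : C.Pos y)
    {w p q r s : V} (pq : C.G.Adj p q) (rs : C.G.Adj r s) (h1 : C.f p ≤ C.f w) (h2 : C.f r ≤ C.f w)
    (h3 : C.g w < C.g q) (h4 : C.g w < C.g s) (hx : C.xi (p, q) (C.f w) < C.xi (r, s) (C.f w))
    (e : C.Y y (p, q) (C.g w) = C.Y y (r, s) (C.g w)) : C.S y p q ≤ C.S y r s := by
  obtain ⟨t, t1, t2⟩ := exists_between (lt_min h3 h4)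
  obtain ⟨t2, t3⟩ := lt_min_iff.1 t2
  obtain ⟨h, m⟩ := C.Mt_exists t
  have k1 := (m w).1 t1
  have k2 := (m q).2 t2
  have k3 := (m s).2 t3
  have := C.mono hy hp m (i := (p, q)) (j := (r, s)) (Pre.It_edge pq (by linarith) k2)
    (Pre.It_edge rs (by linarith) k3)
    (C.ord' pq rs h1 (by linarith) (by linarith) k2 h2 (by linarith) (by linarith) k3 hx)
  rw [C.Y_at y p q t (C.g w), C.Y_at y r s t (C.g w), e] at this
  have h5 : 0 < t - C.g w := by linarith
  exact le_of_mul_le_mul_left (by linarith) h5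

lemma Ct.dn [Fintype V] (C : Ct V) {y : V → ℝ} (hy : y C.u = y C.v) (hp : C.Pos y)
    {w p q r s : V} (pq : C.G.Adj p q) (rs : C.G.Adj r s) (h1 : C.f w ≤ C.f q) (h2 : C.f w ≤ C.f s)
    (h3 : C.g p < C.g w) (h4 : C.g r < C.g w) (hx : C.xi (p, q) (C.f w) < C.xi (r, s) (C.f w))
    (e : C.Y y (p, q) (C.g w) = C.Y y (r, s) (C.g w)) : C.S y r s ≤ C.S y p q := by
  obtain ⟨t, t1, t2⟩ := exists_between (max_lt h3 h4)
  obtain ⟨t1, t3⟩ := max_lt_iff.1 t1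
  obtain ⟨h, m⟩ := C.Mt_exists t
  have k1 := (m w).2 t2
  have k2 := (m p).1 t1
  have k3 := (m r).1 t3
  have := C.mono hy hp m (i := (p, q)) (j := (r, s)) (Pre.It_edge pq k2 (by linarith))
    (Pre.It_edge rs k3 (by linarith))
    (C.ord' pq rs (by linarith) h1 k2 (by linarith) (by linarith) h2 k3 (by linarith) hx)
  rw [C.Y_at y p q t (C.g w), C.Y_at y r s t (C.g w), e] at this
  have h5 : 0 < C.g w - t := by linarith
  exact le_of_mul_le_mul_left (by linarith) h5

/-- degenerate vertices -/
def Ct.Sg (C : Ct V) (y : V → ℝ) (w : V) : Prop :=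
  (∃ b c a, C.RF b c a ∧ C.Act b c a ∧ C.g b = C.g w ∧ C.T y b c a = 0) ∧
  (∃ b c a, C.LF b c a ∧ C.Act b c a ∧ C.g b = C.g w ∧ C.T y b c a = 0)

lemma Ct.Sg.cl {C : Ct V} {y : V → ℝ} {w w' : V} (h : C.Sg y w) (e : C.g w = C.g w') :
    C.Sg y w' := by
  unfold Ct.Sg at *; rw [← e]; exact h

lemma Ct.T_zero (C : Ct V) {y : V → ℝ} {b c a : V} (h1 : C.g c < C.g b) (h2 : C.g b < C.g a) :
    C.T y b c a = 0 ↔ C.Y y (c, a) (C.g b) = y b := by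
  obtain ⟨l, l0, l1, e1, e2⟩ := C.slopes y h1 h2
  have e3 : y b = y c + (C.g b - C.g c) * C.S y c b := by
    rw [← C.Y_S, C.Y_top y (by linarith)]
  rw [C.Y_S, e3]
  have : C.S y c a = C.S y c b + (1 - l) * C.T y b c a := by linarith
  rw [this]
  constructor
  · intro h; rw [h]; ring
  · intro h
    have : (C.g b - C.g c) * (1 - l) * C.T y b c a = 0 := by linarith
    rcases mul_eq_zero.1 this with h | h
    · rcases mul_eq_zero.1 h with h | h <;> linarith
    · exact h

lemma Ct.Sg.ends {C : Ct V} {y : V → ℝ} (hy : y C.u = y C.v) {w : V} (h : C.Sg y w) :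
    ∃ c a c' a', C.G.Adj c a ∧ C.G.Adj c' a' ∧ C.g c < C.g w ∧ C.g w < C.g a ∧ C.g c' < C.g w ∧
    C.g w < C.g a' ∧ C.Y y (c, a) (C.g w) = y w ∧ C.Y y (c', a') (C.g w) = y w ∧
    (∀ w', C.g w = C.g w' → C.xi (c', a') (C.f w') < C.x w' ∧ C.x w' < C.xi (c, a) (C.f w')) ∧
    ∃ b, C.g b = C.g w ∧ C.G.Adj b c ∧ C.G.Adj b a := by
  obtain ⟨⟨b, c, a, q1, q2, q3, q4⟩, ⟨b', c', a', r1, r2, r3, r4⟩⟩ := h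
  obtain ⟨l1, l2, cb, ba, ca⟩ := Pre.RF_lt q1
  obtain ⟨l1', l2', _, _, ca'⟩ := Pre.LF_lt r1
  obtain ⟨g1, g2⟩ := q2.g_lt l1 l2
  obtain ⟨g1', g2'⟩ := r2.g_lt l1' l2'
  rw [C.T_zero g1 g2] at q4
  rw [C.T_zero g1' g2'] at r4
  refine ⟨c, a, c', a', ca, ca', by rwa [← q3], by rwa [← q3], by rwa [← r3], by rwa [← r3],
    by rw [← q3, q4, C.y_g hy q3], by rw [← r3, r4, C.y_g hy r3], ?_, b, q3, cb.symm, ba⟩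
  intro w' e
  refine ⟨?_, (C.RF_spans q1 q2 (q3.trans e)).2.2⟩
  have := (C.fx.RF_spans r1 r2 (r3.trans e)).2.2
  rw [show C.fx.xi _ (C.fx.f w') = _ from C.fx_xi _ _] at this
  exact neg_lt_neg_iff.1 this

lemma Ct.line [Fintype V] (C : Ct V) {y : V → ℝ} (hy : y C.u = y C.v) (hp : C.Pos y) {w : V}
    (hw : C.Sg y w) : ∃ l : ℝ → ℝ, Aff l ∧ y w = l (C.g w) ∧
      ∀ w' p, C.g w = C.g w' → C.G.Adj w' p → y p = l (C.g p) := by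
  obtain ⟨c, a, c', a', ca, ca', g1, g2, g1', g2', e1, e2, hx, _⟩ := hw.ends hy
  have hxw := hx w rfl
  have s1 := C.up hy hp ca' ca (C.lt_of_g g1').le (C.lt_of_g g1).le g2' g2 (hxw.1.trans hxw.2)
    (e2.trans e1.symm)
  have s2 := C.dn hy hp ca' ca (C.lt_of_g g2').le (C.lt_of_g g2).le g1' g1 (hxw.1.trans hxw.2)
    (e2.trans e1.symm)
  have s3 := le_antisymm s1 s2
  refine ⟨fun t => y w + (t - C.g w) * C.S y c a,
    ⟨y w - C.g w * C.S y c a, C.S y c a, fun t => by ring⟩, by simp, ?_⟩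
  intro w' p e wp
  have ey := C.y_g hy e
  obtain ⟨x1, x2⟩ := hx w' e
  rw [e] at g1 g2 g1' g2' e1 e2 ⊢
  rw [ey] at e1 e2 ⊢
  rcases lt_trichotomy (C.g p) (C.g w') with l | l | l
  · have k1 := C.dn hy hp wp.symm ca (le_refl (C.f w')) (C.lt_of_g g2).le l g1
      (by rw [C.xi_top]; exact x2) (by rw [C.Y_top y l.ne, e1])
    have k2 := C.dn hy hp ca' wp.symm (C.lt_of_g g2').le (le_refl (C.f w')) g1' l
      (by rw [C.xi_top]; exact x1) (by rw [C.Y_top y l.ne, e2])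
    have : C.S y p w' = C.S y c a := le_antisymm (by linarith) k1
    have h3 := C.Y_S y p w' (C.g w')
    rw [C.Y_top y l.ne, this] at h3
    show y p = y w' + (C.g p - C.g w') * _
    rw [h3]; ring
  · show y p = y w' + (C.g p - C.g w') * _
    rw [C.y_g hy l, l]; ring
  · have k1 := C.up hy hp wp ca (le_refl (C.f w')) (C.lt_of_g g1).le l g2
      (by rw [C.xi_bot]; exact x2) (by rw [C.Y_bot, e1])
    have k2 := C.up hy hp ca' wp (C.lt_of_g g1').le (le_refl (C.f w')) g2' l
      (by rw [C.xi_bot]; exact x1) (by rw [C.Y_bot, e2])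
    have : C.S y w' p = C.S y c a := le_antisymm k1 (by linarith)
    show y p = y w' + (C.g p - C.g w') * _
    rw [← this, ← C.Y_S, C.Y_top y l.ne]

end FC

namespace FC
variable {V : Type}

def OutTop (D : Pre V) (u v : V) : Prop := ∃ (S : Set V) (s w0 : V), w0 ∈ S ∧ u ∉ S ∧ v ∉ S ∧
  s ∉ S ∧ D.G.Adj u s ∧ D.G.Adj v s ∧ (∀ w ∈ S, ∀ p, D.G.Adj w p → p ∈ S ∨ p = u ∨ p = v ∨ p = s) ∧
  (∀ w ∈ S, D.f v < D.f w ∧ D.f w < D.f s) ∧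
  ((D.xi (u, s) (D.f w0) < D.x w0 ∧ D.x w0 < D.xi (v, s) (D.f w0)) ∨
   (D.xi (v, s) (D.f w0) < D.x w0 ∧ D.x w0 < D.xi (u, s) (D.f w0)))

structure Ct.Good (C : Ct V) (y : V → ℝ) : Prop where
  hy : y C.u = y C.v
  bal : C.Bal y
  pos : C.Pos y
  sR : ∀ b c a, C.RF b c a → C.Act b c a →
      (∃ b' c' a', C.LF b' c' a' ∧ C.Act b' c' a' ∧ C.g b = C.g b') ∨ C.T y b c a = 1
  sL : ∀ b c a, C.LF b c a → C.Act b c a →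
      (∃ b' c' a', C.RF b' c' a' ∧ C.Act b' c' a' ∧ C.g b = C.g b') ∨ C.T y b c a = - 1

lemma Ct.Good.Sg_R {C : Ct V} {y : V → ℝ} (h : C.Good y) {b c a : V} (hR : C.RF b c a)
    (ha : C.Act b c a) (hT : C.T y b c a = 0) : C.Sg y b := by
  rcases h.sR b c a hR ha with ⟨b', c', a', h1, h2, h3⟩ | h1
  · refine ⟨⟨b, c, a, hR, ha, rfl, hT⟩, ⟨b', c', a', h1, h2, h3.symm, ?_⟩⟩
    have := h.bal b c a b' c' a' hR ha h1 h2 h3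
    linarith
  · rw [h1] at hT; norm_num at hT

lemma Ct.Good.Sg_L {C : Ct V} {y : V → ℝ} (h : C.Good y) {b c a : V} (hR : C.LF b c a)
    (ha : C.Act b c a) (hT : C.T y b c a = 0) : C.Sg y b := by
  rcases h.sL b c a hR ha with ⟨b', c', a', h1, h2, h3⟩ | h1
  · refine ⟨⟨b', c', a', h1, h2, h3.symm, ?_⟩, ⟨b, c, a, hR, ha, rfl, hT⟩⟩
    have := h.bal b' c' a' b c a h1 h2 hR ha h3.symm
    linarith
  · rw [h1] at hT; norm_num at hT

lemma Ct.Good.ex_Sg {C : Ct V} {y : V → ℝ} (h : C.Good y) (hn : ¬ C.SPos y) : ∃ w, C.Sg y w := by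
  unfold Ct.SPos at hn
  by_contra hc
  push Not at hc
  refine hn ⟨fun b c a h1 h2 => lt_of_le_of_ne (h.pos.1 b c a h1 h2) fun e =>
    hc b (h.Sg_R h1 h2 e.symm), fun b c a h1 h2 => lt_of_le_of_ne (h.pos.2 b c a h1 h2) fun e =>
    hc b (h.Sg_L h1 h2 e)⟩

lemma Ct.Good.squeeze [Finite V] {C : Ct V} {y : V → ℝ} (h : C.Good y) {c a w : V}
    (ca : C.G.Adj c a) (h1 : C.g c < C.g w) (h2 : C.g w < C.g a)
    (e : C.Y y (c, a) (C.g w) = y w) : C.Sg y w := by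
  have hm : ∀ b, ∀ i j : V × V, C.It (C.f b) i → C.It (C.f b) j →
      C.xi i (C.f b) ≤ C.xi j (C.f b) → C.Y y i (C.g b) ≤ C.Y y j (C.g b) := by
    intro b i j hi hj hle
    rcases hle.lt_or_eq with l | l
    · exact C.mono h.hy h.pos (C.Mt_vert b) hi hj l
    · rw [C.It_inj hi hj l]
  rcases lt_or_gt_of_ne (C.p2 c a w ca (C.lt_of_g h1) (C.lt_of_g h2)) with l | l
  · obtain ⟨b, c1, a1, q1, q2, q3, q4⟩ := C.AL_exists ca h1 h2 l
    obtain ⟨l1, l2, _, _, ca1⟩ := Pre.LF_lt q1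
    obtain ⟨g1, g2⟩ := q2.g_lt l1 l2
    have i1 : C.It (C.f b) (c1, a1) := Pre.It_edge ca1 l1 l2
    have i2 : C.It (C.f b) (c, a) := Pre.It_edge ca (C.lt_of_g (by rwa [q3]))
      (C.lt_of_g (by rwa [q3]))
    have k1 := hm b _ _ i2 i1 q4
    have k2 := hm b _ (b, b) i1 (C.It_vert b) (by
      have := (q1.cons l1 l2).2.2.1
      unfold Pre.bd at this
      simp only [lt_irrefl, if_false] at this
      exact this.le)
    rw [C.Y_vert] at k2
    rw [q3, e, ← C.y_g h.hy q3] at k1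
    refine (h.Sg_L q1 q2 ((C.T_zero g1 g2).2 ?_)).cl q3
    rw [q3] at k2 ⊢
    exact le_antisymm k2 k1
  · obtain ⟨b, c1, a1, q1, q2, q3, q4⟩ := C.AR_exists ca h1 h2 l
    obtain ⟨l1, l2, _, _, ca1⟩ := Pre.RF_lt q1
    obtain ⟨g1, g2⟩ := q2.g_lt l1 l2
    have i1 : C.It (C.f b) (c1, a1) := Pre.It_edge ca1 l1 l2
    have i2 : C.It (C.f b) (c, a) := Pre.It_edge ca (C.lt_of_g (by rwa [q3]))
      (C.lt_of_g (by rwa [q3]))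
    have k1 := hm b _ _ i1 i2 q4
    have k2 := hm b (b, b) _ (C.It_vert b) i1 q1.2.2.2.2.2.1.2.2.1.le
    rw [C.Y_vert] at k2
    rw [q3, e, ← C.y_g h.hy q3] at k1
    refine (h.Sg_R q1 q2 ((C.T_zero g1 g2).2 ?_)).cl q3
    rw [q3] at k2 ⊢
    exact le_antisymm k1 k2

def Ct.Rel (C : Ct V) (y : V → ℝ) (p q : V) : Prop := C.Sg y q ∧ (C.g p = C.g q ∨ C.G.Adj p q)

theorem Ct.Good.out [Fintype V] {C : Ct V} {y : V → ℝ} (h : C.Good y) (hn : ¬ C.SPos y) :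
    OutTop C.toPre C.u C.v ∨ OutTop C.ff.toPre C.v C.u := by
  have hy := h.hy
  obtain ⟨w0, hw0⟩ := h.ex_Sg hn
  let S : Set V := {w | Relation.ReflTransGen (C.Rel y) w0 w}
  have h0 : w0 ∈ S := Relation.ReflTransGen.refl
  have step : ∀ p q, p ∈ S → C.Rel y p q → q ∈ S := fun p q hp hr => Relation.ReflTransGen.tail hp hr
  obtain ⟨l, hl, hl0, hl1⟩ := C.line hy h.pos hw0
  have hS : ∀ w ∈ S, C.Sg y w ∧ y w = l (C.g w) ∧
      ∀ w' p, C.g w = C.g w' → C.G.Adj w' p → y p = l (C.g p) := by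
    intro w hw
    induction hw with
    | refl => exact ⟨hw0, hl0, hl1⟩
    | @tail p q _ hr ih =>
      obtain ⟨i1, i2, i3⟩ := ih
      refine ⟨hr.1, ?_⟩
      by_cases e : C.g p = C.g q
      · exact ⟨by rw [← C.y_g hy e, i2, e], fun w' p' h' => i3 w' p' (e.trans h')⟩
      · have pq := hr.2.resolve_left e
        obtain ⟨l2, hl2, hl3, hl4⟩ := C.line hy h.pos hr.1
        have e1 := i3 p q rfl pq
        have e2 := hl4 q p rfl pq.symm
        have e3 := hl2.eq_of hl e (by rw [← e2, i2]) (by rw [← hl3, e1])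
        exact ⟨e1, fun w' p' h' h'' => by rw [← e3]; exact hl4 w' p' h' h''⟩
  have hcl : ∀ p q, p ∈ S → C.g p = C.g q → q ∈ S := fun p q hp e =>
    step p q hp ⟨(hS p hp).1.cl e, Or.inl e⟩
  let Q : Set V := {p | p ∈ S ∨ ∃ w ∈ S, C.G.Adj w p}
  have hQ : ∀ p ∈ Q, y p = l (C.g p) := by
    rintro p (hp | ⟨w, hw, wp⟩)
    · exact (hS p hp).2.1
    · exact (hS w hw).2.2 w p rfl wp
  have nb : ∀ w ∈ S, ∃ c ∈ Q, ∃ a ∈ Q, C.g c < C.g w ∧ C.g w < C.g a := by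
    intro w hw
    obtain ⟨c, a, c', a', _, _, g1, g2, _, _, _, _, _, b, e, bc, ba⟩ := (hS w hw).1.ends hy
    have hb := hcl w b hw e.symm
    exact ⟨c, Or.inr ⟨b, hb, bc⟩, a, Or.inr ⟨b, hb, ba⟩, g1, g2⟩
  obtain ⟨α, hα, αm⟩ := Set.exists_max_image Q C.g (Set.toFinite _) ⟨w0, Or.inl h0⟩
  obtain ⟨β, hβ, βm⟩ := Set.exists_min_image Q C.g (Set.toFinite _) ⟨w0, Or.inl h0⟩
  have Slt : ∀ w ∈ S, C.g β < C.g w ∧ C.g w < C.g α := by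
    intro w hw
    obtain ⟨c, hc, a, ha, g1, g2⟩ := nb w hw
    exact ⟨(βm c hc).trans_lt g1, g2.trans_le (αm a ha)⟩
  have αS : α ∉ S := fun hh => lt_irrefl _ (Slt α hh).2
  have βS : β ∉ S := fun hh => lt_irrefl _ (Slt β hh).1
  have key : ∀ z ∈ Q, z ∉ S → C.g z = C.g α ∨ C.g z = C.g β := by
    intro z hz hzS
    by_contra hc
    push Not at hc
    have z1 : C.g z < C.g α := lt_of_le_of_ne (αm z hz) hc.1
    have z2 : C.g β < C.g z := lt_of_le_of_ne (βm z hz) hc.2.symm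
    have zne : ∀ w ∈ S, C.g w ≠ C.g z := fun w hw e => hzS (hcl w z hw e)
    have no : ∀ c a, C.G.Adj c a → c ∈ Q → a ∈ Q → C.g c < C.g z → C.g z < C.g a → False := by
      intro c a ca hc ha l1 l2
      have hs : C.Sg y z := by
        refine h.squeeze ca l1 l2 ?_
        rw [hQ z hz]
        exact (C.Y_aff y (c, a)).eq_of hl (l1.trans l2).ne (by rw [C.Y_bot, hQ c hc])
          (by rw [C.Y_top y (l1.trans l2).ne, hQ a ha]) _
      obtain ⟨w, hw, wz⟩ := hz.resolve_left hzS
      exact hzS (step w z hw ⟨hs, Or.inr wz⟩)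
    have side : ∀ w ∈ S, (C.g w < C.g z ↔ C.g w0 < C.g z) := by
      intro w hw
      induction hw with
      | refl => exact Iff.rfl
      | @tail p q hp hr ih =>
        have hqS : q ∈ S := step p q hp hr
        rw [← ih]
        rcases hr.2 with e | pq
        · rw [e]
        · constructor
          · intro hlt
            by_contra hge
            exact no q p pq.symm (Or.inl hqS) (Or.inl hp) hlt
              (lt_of_le_of_ne (not_lt.1 hge) (zne p hp).symm)
          · intro hlt
            by_contra hge
            exact no p q pq (Or.inl hp) (Or.inl hqS) hlt
              (lt_of_le_of_ne (not_lt.1 hge) (zne q hqS).symm)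
    obtain ⟨wα, h1, h2⟩ := hα.resolve_left αS
    obtain ⟨wβ, h3, h4⟩ := hβ.resolve_left βS
    have k1 : ¬ C.g wα < C.g z := fun hh => no wα α h2 (Or.inl h1) hα hh z1
    have k2 : C.g wβ < C.g z := by
      by_contra hge
      exact no β wβ h4.symm hβ (Or.inl h3) z2 (lt_of_le_of_ne (not_lt.1 hge) (zne wβ h3).symm)
    exact k1 ((side wα h1).2 ((side wβ h3).1 k2))
  let P : Set V := {p | p ∈ S ∨ C.g p = C.g α ∨ C.g p = C.g β}
  have hnP : ∀ w ∈ S, ∀ p, C.G.Adj w p → p ∈ P := by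
    intro w hw p wp
    by_cases hp : p ∈ S
    · exact Or.inl hp
    · exact Or.inr (key p (Or.inr ⟨w, hw, wp⟩) hp)
  have hd : ∀ w ∈ S, C.HR w ∧ C.HL w := by
    intro w hw
    obtain ⟨⟨b, c, a, q1, q2, q3, _⟩, ⟨b', c', a', r1, r2, r3, _⟩⟩ := (hS w hw).1
    exact ⟨C.HR_of q1 q2 q3, C.HL_of r1 r2 r3⟩
  have hSP : S ⊆ P := fun w hw => Or.inl hw
  obtain ⟨p, q, pq, p1, q1, p2, q2, l1, l2, x1⟩ := C.rmost hd hSP hnP h0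
  obtain ⟨p', q', pq', p1', q1', p2', q2', l1', l2', x1'⟩ := C.lmost hd hSP hnP h0
  obtain ⟨b0, a0⟩ := Slt w0 h0
  have fin : ∀ p q, p ∈ P → q ∈ P → p ∉ S → q ∉ S → C.f p < C.f w0 → C.f w0 < C.f q →
      C.g p = C.g β ∧ C.g q = C.g α := by
    intro p q hp hq hp' hq' l1 l2
    have m1 := C.g_le l1.le
    have m2 := C.g_le l2.le
    rcases hp.resolve_left hp' with e | e
    · linarith
    · rcases hq.resolve_left hq' with e' | e'
      · exact ⟨e, e'⟩
      · linarith
  obtain ⟨ep, eq⟩ := fin p q p1 q1 p2 q2 l1 l2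
  obtain ⟨ep', eq'⟩ := fin p' q' p1' q1' p2' q2' l1' l2'
  have hαβ : C.g β < C.g α := b0.trans a0
  have nS : ∀ z, (C.g z = C.g α ∨ C.g z = C.g β) → z ∉ S := by
    rintro z (e | e) hz
    · have := (Slt z hz).2; linarith
    · have := (Slt z hz).1; linarith
  rcases C.g_eq (ep.trans ep'.symm) with e1 | e1
  · -- same bottom
    have hq : (q = C.u ∧ q' = C.v) ∨ (q = C.v ∧ q' = C.u) := by
      rcases C.g_eq (eq.trans eq'.symm) with e2 | e2
      · subst e1 e2
        exact absurd (x1.trans x1') (lt_irrefl _)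
      · exact e2
    subst e1
    have eu : C.g C.u = C.g α := by
      rcases hq with ⟨h1, h2⟩ | ⟨h1, h2⟩
      · rw [← h1, eq]
      · rw [← h2, eq']
    have ev : C.g C.v = C.g α := by rw [← C.guv, eu]
    have sing : ∀ z, C.g z = C.g p → z = p := by
      intro z ez
      rcases C.g_eq ez with h1 | ⟨h1, h2⟩ | ⟨h1, h2⟩
      · exact h1
      · rw [h2] at ep; linarith
      · rw [h2] at ep; linarith
    right
    refine ⟨S, p, w0, h0, nS _ (Or.inl ev), nS _ (Or.inl eu), nS _ (Or.inr ep), ?_, ?_, ?_, ?_, ?_⟩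
    · show C.G.Adj _ _
      rcases hq with ⟨h1, h2⟩ | ⟨h1, h2⟩
      · rw [← h2]; exact pq'.symm
      · rw [← h1]; exact pq.symm
    · show C.G.Adj _ _
      rcases hq with ⟨h1, h2⟩ | ⟨h1, h2⟩
      · rw [← h1]; exact pq.symm
      · rw [← h2]; exact pq'.symm
    · intro w hw z wz
      rcases hnP w hw z wz with h1 | h1 | h1
      · exact Or.inl h1
      · rcases C.g_eq (h1.trans ev.symm) with h2 | ⟨h2, _⟩ | ⟨_, h2⟩
        · tauto
        · tauto
        · exact absurd h2 C.uv.ne'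
      · have := sing z (h1.trans ep.symm)
        tauto
    · intro w hw
      obtain ⟨k1, k2⟩ := Slt w hw
      exact ⟨neg_lt_neg (C.lt_of_g (by rw [eu]; exact k2)), neg_lt_neg (C.lt_of_g (by rw [ep]; exact k1))⟩
    · rw [show C.ff.xi _ (C.ff.f w0) = _ from C.ff_xi _ _,
        show C.ff.xi _ (C.ff.f w0) = _ from C.ff_xi _ _]
      show (C.xi (p, C.v) _ < C.x w0 ∧ C.x w0 < C.xi (p, C.u) _) ∨
        (C.xi (p, C.u) _ < C.x w0 ∧ C.x w0 < C.xi (p, C.v) _)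
      rcases hq with ⟨h1, h2⟩ | ⟨h1, h2⟩
      · rw [h1] at x1; rw [h2] at x1'; exact Or.inl ⟨x1', x1⟩
      · rw [h1] at x1; rw [h2] at x1'; exact Or.inr ⟨x1', x1⟩
  · have eu : C.g C.u = C.g β := by
      rcases e1 with ⟨h1, h2⟩ | ⟨h1, h2⟩
      · rw [← h1, ep]
      · rw [← h2, ep']
    have ev : C.g C.v = C.g β := by rw [← C.guv, eu]
    have sing : ∀ z, C.g z = C.g q → z = q := by
      intro z ez
      rcases C.g_eq ez with h1 | ⟨h1, h2⟩ | ⟨h1, h2⟩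
      · exact h1
      · rw [h2] at eq; linarith
      · rw [h2] at eq; linarith
    have eqq : q' = q := sing q' (eq'.trans eq.symm)
    subst eqq
    left
    refine ⟨S, q', w0, h0, nS _ (Or.inr eu), nS _ (Or.inr ev), nS _ (Or.inl eq), ?_, ?_, ?_, ?_, ?_⟩
    · rcases e1 with ⟨h1, h2⟩ | ⟨h1, h2⟩
      · rw [← h1]; exact pq
      · rw [← h2]; exact pq'
    · rcases e1 with ⟨h1, h2⟩ | ⟨h1, h2⟩
      · rw [← h2]; exact pq'
      · rw [← h1]; exact pq
    · intro w hw z wz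
      rcases hnP w hw z wz with h1 | h1 | h1
      · exact Or.inl h1
      · have := sing z (h1.trans eq.symm)
        tauto
      · rcases C.g_eq (h1.trans ev.symm) with h2 | ⟨h2, _⟩ | ⟨_, h2⟩
        · tauto
        · tauto
        · exact absurd h2 C.uv.ne'
    · intro w hw
      obtain ⟨k1, k2⟩ := Slt w hw
      exact ⟨C.lt_of_g (by rw [ev]; exact k1), C.lt_of_g (by rw [eq]; exact k2)⟩
    · rcases e1 with ⟨h1, h2⟩ | ⟨h1, h2⟩
      · rw [h1] at x1; rw [h2] at x1'; exact Or.inr ⟨x1', x1⟩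
      · rw [h1] at x1; rw [h2] at x1'; exact Or.inl ⟨x1', x1⟩

theorem Ct.main [Fintype V] (C : Ct V) (hN : C.NP) (hH : C.HN) (hs : Small (Fintype.card V)) :
    Colr C.G C.u C.v ∨ OutTop C.toPre C.u C.v ∨ OutTop C.ff.toPre C.v C.u := by
  obtain ⟨y, h1, h2, h3, h4, h5⟩ := C.sol hN hH
  by_cases hp : C.SPos y
  · exact Or.inl (C.colr h1 hp hs)
  · exact Or.inr (Ct.Good.out ⟨h1, h2, h3, h4, h5⟩ hp)

end FC

namespace FC
variable {V : Type}

lemma small_of_min [Fintype V] {G : SimpleGraph V} (h : IsMinCounterexample G) :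
    Small (Fintype.card V) := by
  intro W _ H hH hc
  obtain ⟨K, hK, hm⟩ := (Set.toFinite {K : SimpleGraph W | IsPlanar K}).exists_le_maximal hH
  have hmax : IsMaximalPlanar K := by
    refine ⟨hm.1, fun a b hab hn hp => hn ?_⟩
    have := hm.2 hp le_sup_left
    apply this
    rw [SimpleGraph.sup_adj]
    exact Or.inr (by simp [hab])
  by_contra hn
  have h2 := h.2.2 W K hmax (fun hc => hn (hc.mono_left hK))
  omega

lemma planar_induce {G : SimpleGraph V} (h : IsPlanar G) (A : Set V) : IsPlanar (G.induce A) := by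
  obtain ⟨pos, h1, h2⟩ := h
  refine ⟨fun a => pos a, fun a b e => Subtype.ext (h1 e), ?_⟩
  intro a b c d hab hcd hne
  refine h2 a b c d hab hcd fun e => hne ?_
  rw [Sym2.eq_iff] at e ⊢
  simpa only [Subtype.ext_iff] using e

lemma part_color [Fintype V] {G : SimpleGraph V} (h : IsPlanar G) (hs : Small (Fintype.card V))
    (A : Set V) (hA : ∃ z, z ∉ A) :
    ∃ c : V → Fin 4, ∀ p q, p ∈ A → q ∈ A → G.Adj p q → c p ≠ c q := by
  classical
  obtain ⟨z, hz⟩ := hA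
  obtain ⟨k⟩ := hs A (G.induce A) (planar_induce h A) (by
    exact Fintype.card_subtype_lt hz)
  refine ⟨fun w => if hw : w ∈ A then k ⟨w, hw⟩ else 0, fun p q hp hq pq => ?_⟩
  simp only [hp, hq, dif_pos]
  exact k.valid pq

def Gl (G : SimpleGraph V) : Prop := ∀ S K : Set V, S.Nonempty → (∀ p ∈ K, ∀ q ∈ K, p ≠ q → G.Adj p q) →
  (∀ p ∈ S, p ∉ K) → (∀ p ∈ S, ∀ q, G.Adj p q → q ∈ S ∨ q ∈ K) → ∀ z, z ∈ S ∨ z ∈ K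

lemma glue [Fintype V] {G : SimpleGraph V} (h : IsPlanar G) (hs : Small (Fintype.card V))
    (hn : ¬ G.Colorable 4) : Gl G := by
  classical
  intro S K hS hK hSK hN z
  by_contra hz
  apply hn
  obtain ⟨c1, h1⟩ := part_color h hs (S ∪ K) ⟨z, hz⟩
  obtain ⟨w, hw⟩ := hS
  obtain ⟨c2, h2⟩ := part_color h hs Sᶜ ⟨w, fun h => h hw⟩
  have i1 : Set.InjOn c1 K := fun p hp q hq e => by
    by_contra hne
    exact h1 p q (Or.inr hp) (Or.inr hq) (hK p hp q hq hne) e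
  have i2 : Set.InjOn c2 K := fun p hp q hq e => by
    by_contra hne
    exact h2 p q (fun h => hSK p h hp) (fun h => hSK q h hq) (hK p hp q hq hne) e
  let e : {x // x ∈ c2 '' K} ≃ {x // x ∈ c1 '' K} :=
    (Equiv.Set.imageOfInjOn c2 K i2).symm.trans (Equiv.Set.imageOfInjOn c1 K i1)
  have he : ∀ k ∈ K, e.extendSubtype (c2 k) = c1 k := by
    intro k hk
    rw [Equiv.extendSubtype_apply_of_mem e (c2 k) ⟨k, hk, rfl⟩]
    have : (Equiv.Set.imageOfInjOn c2 K i2).symm ⟨c2 k, k, hk, rfl⟩ = ⟨k, hk⟩ := by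
      rw [Equiv.symm_apply_eq]; rfl
    show ((Equiv.Set.imageOfInjOn c1 K i1) ((Equiv.Set.imageOfInjOn c2 K i2).symm _) : Fin 4) = _
    rw [this]; rfl
  have cross : ∀ p q, p ∈ S → q ∉ S → G.Adj p q → c1 p ≠ e.extendSubtype (c2 q) := by
    intro p q hp hq pq
    have hk := (hN p hp q pq).resolve_left hq
    rw [he q hk]
    exact h1 p q (Or.inl hp) (Or.inr hk) pq
  refine ⟨SimpleGraph.Coloring.mk (fun w => if w ∈ S then c1 w else e.extendSubtype (c2 w)) ?_⟩
  intro p q pq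
  by_cases hp : p ∈ S <;> by_cases hq : q ∈ S <;> simp only [hp, hq, if_true, if_false]
  · exact h1 p q (Or.inl hp) (Or.inl hq) pq
  · exact cross p q hp hq pq
  · exact (cross q p hq hp pq.symm).symm
  · exact fun e' => h2 p q hp hq pq (e.extendSubtype.injective e')

lemma Colr.symm {G : SimpleGraph V} {u v : V} (h : Colr G u v) : Colr G v u := by
  obtain ⟨c, h1, h2⟩ := h
  exact ⟨c, h1.symm, fun p q h h' => h2 p q h (by rwa [Sym2.eq_swap (a := u)])⟩

lemma Colr.delete {G : SimpleGraph V} {u v : V} (h : Colr G u v) :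
    (G.deleteEdges {s(u, v)}).Colorable 4 := by
  obtain ⟨c, h1, h2⟩ := h
  refine ⟨SimpleGraph.Coloring.mk c ?_⟩
  intro p q pq
  rw [SimpleGraph.deleteEdges_adj] at pq
  exact h2 p q pq.1 pq.2

lemma Ct.np (C : Ct V) (hg : Gl C.G) : C.NP := by
  rintro w ⟨p, hp⟩ ⟨q, hq⟩
  by_contra hc
  push Not at hc
  have key : ∀ z, C.g w < C.g z ∨ C.g z = C.g w := by
    refine hg {z | C.g w < C.g z} {z | C.g z = C.g w} ⟨q, hq⟩ ?_ ?_ ?_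
    · intro a ha b hb hab
      rcases C.g_eq (Eq.trans ha (Eq.symm hb)) with h | ⟨rfl, rfl⟩ | ⟨rfl, rfl⟩
      · exact absurd h hab
      · exact C.uv
      · exact C.uv.symm
    · intro a ha hb
      exact (ne_of_gt ha) hb
    · intro a ha b ab
      rcases lt_trichotomy (C.g b) (C.g w) with l | l | l
      · exact absurd (hc b a ab.symm l) (not_le.2 ha)
      · exact Or.inr l
      · exact Or.inl l
  rcases key p with h | h
  · exact lt_asymm hp h
  · exact hp.ne h

lemma Ct.hn (C : Ct V) (hg : Gl C.G) (hc : ¬ C.G.Colorable 4) : C.HN := by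
  classical
  intro w
  by_contra hn
  push Not at hn
  have key : ∀ z, C.g z = C.g w := by
    have k2 : ∀ z, z = w ∨ (C.g z = C.g w ∧ z ≠ w) := by
     refine hg {w} {z | C.g z = C.g w ∧ z ≠ w} ⟨w, rfl⟩ ?_ ?_ ?_
     · intro a ha b hb hab
       rcases C.g_eq (ha.1.trans hb.1.symm) with h | ⟨rfl, rfl⟩ | ⟨rfl, rfl⟩
       · exact absurd h hab
       · exact C.uv
       · exact C.uv.symm
     · intro p hp hq
       exact hq.2 hp
     · rintro p hp q pq
       obtain rfl : p = w := hp
       exact Or.inr ⟨hn q pq, pq.ne'⟩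
    intro z
    rcases k2 z with rfl | h
    · rfl
    · exact h.1
  apply hc
  refine ⟨SimpleGraph.Coloring.mk (fun z => if z = C.u then 0 else 1) ?_⟩
  intro p q pq
  have e := (key p).trans (key q).symm
  rcases C.g_eq e with h | ⟨rfl, rfl⟩ | ⟨rfl, rfl⟩
  · exact absurd h pq.ne
  · simp [C.uv.ne']
  · simp [C.uv.ne']

end FC

namespace FC
variable {V : Type}

def Pre.sub (D : Pre V) (H : SimpleGraph V) (hH : H ≤ D.G) : Pre V where
  G := H
  f := D.f
  x := D.x
  inj := D.inj
  p1 := fun c a c' a' h h1 h2 => D.p1 c a c' a' h (hH h1) (hH h2)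
  p2 := fun c a w h1 => D.p2 c a w (hH h1)

lemma Pre.sub_Cons (D : Pre V) {v s : V} (hvs : D.f v < D.f s) {H : SimpleGraph V}
    (hH : H ≤ D.G) (hHd : ∀ p q, D.G.Adj p q → s(p, q) ≠ s(v, s) → H.Adj p q)
    {h : ℝ} {i j : V × V} (hc : (D.sub H hH).Cons h i j) :
    D.Cons h i j ∨ (D.f v < h ∧ h < D.f s ∧ D.xi i h < D.xi (v, s) h ∧ D.xi (v, s) h < D.xi j h) := by
  obtain ⟨h1, h2, h3, h4⟩ := hc
  have mono : ∀ k, (D.sub H hH).It h k → D.It h k := by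
    rintro k (⟨a, b⟩ | k)
    · exact Or.inl ⟨hH a, b⟩
    · exact Or.inr k
  by_cases hk : ∃ k, D.It h k ∧ D.xi i h < D.xi k h ∧ D.xi k h < D.xi j h
  · right
    obtain ⟨⟨p, q⟩, hk, hl⟩ := hk
    rcases hk with ⟨k1, k2, k3⟩ | k
    · by_cases e : s(p, q) = s(v, s)
      · rw [Sym2.eq_iff] at e
        rcases e with ⟨rfl, rfl⟩ | ⟨rfl, rfl⟩
        · exact ⟨k2, k3, hl⟩
        · exact absurd (lt_trans k2 k3) (lt_asymm hvs)
      · exact absurd hl (h4 (p, q) (Or.inl ⟨hHd p q k1 e, k2, k3⟩))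
    · exact absurd hl (h4 (p, q) (Or.inr k))
  · left
    exact ⟨mono _ h1, mono _ h2, h3, fun k hk' hl => hk ⟨k, hk', hl⟩⟩

lemma Ct.special [Fintype V] (C : Ct V) (hg : Gl C.G) (hH : C.HN) (hs : Small (Fintype.card V))
    {S : Set V} {s w0 : V} (hw0 : w0 ∈ S) (huS : C.u ∉ S) (hvS : C.v ∉ S) (hsS : s ∉ S)
    (us : C.G.Adj C.u s) (vs : C.G.Adj C.v s)
    (hN : ∀ w ∈ S, ∀ p, C.G.Adj w p → p ∈ S ∨ p = C.u ∨ p = C.v ∨ p = s)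
    (hf : ∀ w ∈ S, C.f C.v < C.f w ∧ C.f w < C.f s)
    (hl : C.xi (C.u, s) (C.f w0) < C.x w0) (hr : C.x w0 < C.xi (C.v, s) (C.f w0)) :
    Colr C.G C.u C.v := by
  classical
  have luv := C.luv
  have hw := hf w0 hw0
  have lvs : C.f C.v < C.f s := hw.1.trans hw.2
  have hK : ∀ p ∈ ({C.u, C.v, s} : Set V), ∀ q ∈ ({C.u, C.v, s} : Set V), p ≠ q → C.G.Adj p q := by
    rintro p (rfl | rfl | rfl) q (rfl | rfl | rfl) hne <;>
    first
    | exact absurd rfl hne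
    | exact C.uv
    | exact C.uv.symm
    | exact us
    | exact us.symm
    | exact vs
    | exact vs.symm
  have hall : ∀ z, z ∈ S ∨ z = C.u ∨ z = C.v ∨ z = s := by
    refine hg S {C.u, C.v, s} ⟨w0, hw0⟩ hK ?_ hN
    rintro p hp (rfl | rfl | rfl)
    · exact huS hp
    · exact hvS hp
    · exact hsS hp
  have hbot : ∀ z, C.f C.u ≤ C.f z := by
    intro z
    rcases hall z with h | rfl | rfl | rfl
    · have := hf z h; linarith
    · rfl
    · exact luv.le
    · linarith
  have htop : ∀ z, C.f z ≤ C.f s := by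
    intro z
    rcases hall z with h | rfl | rfl | rfl
    · exact (hf z h).2.le
    · linarith
    · exact lvs.le
    · rfl
  have step : ∀ w ∈ S, ∀ p ∈ S, C.G.Adj w p → C.xi (C.v, s) (C.f w) < C.x w →
      C.xi (C.v, s) (C.f p) < C.x p := by
    intro w hw p hp wp hlt
    have a1 := hf w hw
    have a2 := hf p hp
    refine lt_of_le_of_ne ?_ (C.p2 _ _ p vs a2.1 a2.2)
    rcases lt_trichotomy (C.f w) (C.f p) with l | l | l
    · rw [← C.xi_bot w p] at hlt
      have := C.ord vs wp a1.1.le a1.2.le a2.1.le a2.2.le le_rfl l.le l.le le_rfl hlt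
      rwa [C.xi_top] at this
    · exact absurd (C.inj l) wp.ne
    · rw [← C.xi_top p w] at hlt
      have := C.ord vs wp.symm a1.1.le a1.2.le a2.1.le a2.2.le l.le le_rfl le_rfl l.le hlt
      rwa [C.xi_bot] at this
  have hS1 : ∀ w ∈ S, C.x w < C.xi (C.v, s) (C.f w) := by
    intro w hw'
    have a1 := hf w hw'
    refine lt_of_le_of_ne ?_ (C.p2 _ _ w vs a1.1 a1.2).symm
    by_contra hc
    push Not at hc
    have : ∀ z, (z ∈ S ∧ C.xi (C.v, s) (C.f z) < C.x z) ∨ z ∈ ({C.u, C.v, s} : Set V) := by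
      refine hg {z | z ∈ S ∧ C.xi (C.v, s) (C.f z) < C.x z} {C.u, C.v, s} ⟨w, hw', hc⟩ hK ?_ ?_
      · rintro p ⟨hp, -⟩ (rfl | rfl | rfl)
        · exact huS hp
        · exact hvS hp
        · exact hsS hp
      · rintro p ⟨hp, hp'⟩ q pq
        rcases hN p hp q pq with h | h
        · exact Or.inl ⟨h, step p hp q h pq hp'⟩
        · exact Or.inr h
    rcases this w0 with h | rfl | rfl | rfl
    · exact lt_asymm hr h.2
    · exact huS hw0
    · exact hvS hw0
    · exact hsS hw0
  have hR : ∀ h c a, C.G.Adj c a → C.f c < h → h < C.f a → C.f C.v < h → h < C.f s →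
      ¬ C.xi (C.v, s) h < C.xi (c, a) h := by
    intro h c a ca h1 h2 h3 h4 hlt
    rcases hall c with hc | hc
    · have := C.ord vs ca h3.le h4.le (hf c hc).1.le (hf c hc).2.le h1.le h2.le le_rfl
        (h1.trans h2).le hlt
      rw [C.xi_bot] at this
      exact absurd (hS1 c hc) (not_lt.2 this)
    rcases hall a with ha | rfl | rfl | rfl
    · have := C.ord vs ca h3.le h4.le (hf a ha).1.le (hf a ha).2.le h1.le h2.le
        (h1.trans h2).le le_rfl hlt
      rw [C.xi_top] at this
      exact absurd (hS1 a ha) (not_lt.2 this)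
    · linarith
    · linarith
    rcases hc with rfl | rfl | rfl
    · have := C.ord' us vs (luv.trans hw.1).le hw.2.le h1 h2 hw.1.le hw.2.le h3 h4 (hl.trans hr)
      exact lt_asymm this hlt
    · exact lt_irrefl _ hlt
    · linarith
  -- delete the edge vs
  have hle : C.G.deleteEdges {s(C.v, s)} ≤ C.G := SimpleGraph.deleteEdges_le _
  have hdel : ∀ p q, C.G.Adj p q → s(p, q) ≠ s(C.v, s) → (C.G.deleteEdges {s(C.v, s)}).Adj p q := by
    intro p q h1 h2
    rw [SimpleGraph.deleteEdges_adj]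
    exact ⟨h1, h2⟩
  have hdel' : ∀ p q, (C.G.deleteEdges {s(C.v, s)}).Adj p q → s(p, q) ≠ s(C.v, s) := by
    intro p q h1
    rw [SimpleGraph.deleteEdges_adj] at h1
    exact h1.2
  have hu : ∀ c, C.f c < C.f C.v → c = C.u := by
    intro c hc
    by_contra hne
    exact absurd (C.gap c hne hc) (not_lt.2 (hbot c))
  have e1 : ∀ c z a, C.f z < C.f a → C.f c < C.f z → s(c, z) ≠ s(C.v, s) := by
    intro c z a h1 h2 e
    rw [Sym2.eq_iff] at e
    have := htop a
    have := htop z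
    rcases e with ⟨rfl, rfl⟩ | ⟨rfl, rfl⟩ <;> linarith
  have e2 : ∀ c z a, C.f z < C.f a → C.f c < C.f z → s(z, a) = s(C.v, s) →
      c = C.u ∧ z = C.v ∧ a = s := by
    intro c z a h1 h2 e
    rw [Sym2.eq_iff] at e
    have := htop a
    rcases e with ⟨rfl, rfl⟩ | ⟨rfl, rfl⟩
    · exact ⟨hu c h2, rfl, rfl⟩
    · linarith
  have ebd : C.bd C.v C.u s (C.f w0) = (C.v, s) := by
    unfold Pre.bd
    rw [if_neg (not_lt.2 hw.1.le), if_pos hw.1]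
  let D' := C.toPre.sub _ hle
  let C' : Ct V :=
    { toPre := D'
      mxr := by
        intro c a z hc
        have he := hc.edge_r
        rcases C.toPre.sub_Cons lvs hle hdel hc with h | ⟨h1, h2, h3, h4⟩
        · have hRF := C.RF_of_Cons h
          obtain ⟨l1, l2, b1, b2, b3⟩ := Pre.RF_lt hRF
          refine ⟨fun _ => hdel _ _ b1 (e1 c z a l2 l1), fun _ => hdel _ _ b2 fun e => ?_⟩
          obtain ⟨rfl, rfl, rfl⟩ := e2 c z a l2 l1 e
          have := hRF.cons (luv.trans hw.1) hw.2
          rw [ebd] at this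
          exact lt_asymm (hl.trans hr) this.2.2.1
        · exact absurd h4 (hR _ c a (hle he.1) he.2.1 he.2.2 h1 h2)
      mxl := by
        intro c a z hc
        rcases C.toPre.sub_Cons lvs hle hdel hc with h | ⟨h1, h2, h3, h4⟩
        · have hRF := C.LF_of_Cons h
          obtain ⟨l1, l2, b1, b2, b3⟩ := Pre.LF_lt hRF
          refine ⟨fun _ => hdel _ _ b1 (e1 c z a l2 l1), fun _ => hdel _ _ b2 fun e => ?_⟩
          obtain ⟨rfl, rfl, rfl⟩ := e2 c z a l2 l1 e
          have := hRF.cons (luv.trans hw.1) hw.2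
          rw [ebd] at this
          refine absurd ?_ (this.2.2.2 (w0, w0) (C.It_vert w0))
          rw [C.xi_vert]
          exact ⟨hl, hr⟩
        · rw [C.xi_vert] at h4
          exfalso
          rcases hall z with hz | rfl | rfl | rfl
          · exact lt_asymm h4 (hS1 z hz)
          · exact lt_asymm luv h1
          · exact lt_irrefl _ h1
          · exact lt_irrefl _ h2
      u := C.u
      v := C.v
      uv := hdel _ _ C.uv (by
        intro e
        rw [Sym2.eq_iff] at e
        rcases e with ⟨h, _⟩ | ⟨h, _⟩
        · exact C.uv.ne h
        · exact us.ne h)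
      luv := C.luv
      gap := C.gap
      g := C.g
      guv := C.guv
      gm := C.gm }
  have us' : C'.G.Adj C.u s := hdel _ _ us (by
    intro e
    rw [Sym2.eq_iff] at e
    rcases e with ⟨h, _⟩ | ⟨h, _⟩
    · exact C.uv.ne h
    · exact us.ne h)
  have gus : C.g C.u < C.g s := by
    rcases C.gm C.u s (luv.trans lvs) with ⟨_, h⟩ | h
    · exact absurd h vs.ne'
    · exact h
  have hS' : ∀ w ∈ S, ∀ p, C.G.Adj w p → C'.G.Adj w p := by
    intro w hwS p wp
    refine hdel _ _ wp fun e => ?_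
    rw [Sym2.eq_iff] at e
    rcases e with ⟨rfl, _⟩ | ⟨rfl, _⟩
    · exact hvS hwS
    · exact hsS hwS
  have gS : ∀ w ∈ S, C.g C.v < C.g w ∧ C.g w < C.g s := by
    intro w hw
    obtain ⟨h1, h2⟩ := hf w hw
    constructor
    · rcases C.gm _ _ h1 with ⟨h, _⟩ | h
      · exact absurd h C.uv.ne'
      · exact h
    · rcases C.gm _ _ h2 with ⟨h, _⟩ | h
      · rw [h] at hw; exact absurd hw huS
      · exact h
  have hNP : C'.NP := by
    rintro w ⟨p, hp⟩ ⟨q, hq⟩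
    refine ⟨C.u, s, us', ?_⟩
    have hp : C.g p < C.g w := hp
    have hq : C.g w < C.g q := hq
    have h1 := C.g_le (htop q)
    have h2 := C.g_le (hbot p)
    exact ⟨h2.trans_lt hp, hq.trans_le h1⟩
  have hHN : C'.HN := by
    intro w
    rcases hall w with h | rfl | rfl | rfl
    · obtain ⟨z, h1, h2⟩ := hH w
      exact ⟨z, hS' w h z h1, h2⟩
    · exact ⟨s, us', gus.ne'⟩
    · by_contra hc
      push Not at hc
      have : ∀ z, z ∈ S ∨ z ∈ ({C.u, s} : Set V) := by
        refine hg S {C.u, s} ⟨w0, hw0⟩ ?_ ?_ ?_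
        · rintro p (rfl | rfl) q (rfl | rfl) hne
          · exact absurd rfl hne
          · exact us
          · exact us.symm
          · exact absurd rfl hne
        · rintro p hp (rfl | rfl)
          · exact huS hp
          · exact hsS hp
        · intro p hp q pq
          rcases hN p hp q pq with h | rfl | rfl | rfl
          · exact Or.inl h
          · exact Or.inr (Or.inl rfl)
          · exact absurd (hc p (hS' p hp _ pq).symm) (gS p hp).1.ne'
          · exact Or.inr (Or.inr rfl)
      rcases this C.v with h | h | h
      · exact hvS h
      · exact C.uv.ne' h
      · exact vs.ne h
    · exact ⟨C.u, us'.symm, gus.ne⟩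
  rcases C'.main hNP hHN hs with h | h | h
  · obtain ⟨c, h1, h2⟩ := h
    have h1 : c C.u = c C.v := h1
    refine ⟨c, h1, fun p q pq hne => ?_⟩
    have key : c C.v ≠ c s := by
      rw [← h1]
      refine h2 _ _ us' fun e => ?_
      have e : s(C.u, s) = s(C.u, C.v) := e
      rw [Sym2.eq_iff] at e
      rcases e with ⟨_, h⟩ | ⟨h, _⟩
      · exact vs.ne' h
      · exact C.uv.ne h
    by_cases e : s(p, q) = s(C.v, s)
    · rw [Sym2.eq_iff] at e
      rcases e with ⟨rfl, rfl⟩ | ⟨rfl, rfl⟩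
      · exact key
      · exact key.symm
    · exact h2 p q (hdel p q pq e) hne
  · obtain ⟨S', s', w1, hw1, a1, a2, a3, a4, a5, a6, a7, -⟩ := h
    have a1 : C.u ∉ S' := a1
    have a2 : C.v ∉ S' := a2
    have a4 : C.G.Adj C.u s' := hle a4
    have a5 : (C.G.deleteEdges {s(C.v, s)}).Adj C.v s' := a5
    have hs' : s ∉ S' := fun h => absurd ((a7 s h).2 : C.f s < C.f s') (not_lt.2 (htop s'))
    have : ∀ z, z ∈ S' ∨ z ∈ ({C.u, C.v, s'} : Set V) := by
      refine hg S' {C.u, C.v, s'} ⟨w1, hw1⟩ ?_ ?_ ?_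
      · have a5 := hle a5
        rintro p (rfl | rfl | rfl) q (rfl | rfl | rfl) hne <;>
        first
        | exact absurd rfl hne
        | exact C.uv
        | exact C.uv.symm
        | exact a4
        | exact a4.symm
        | exact a5
        | exact a5.symm
      · rintro p hp (rfl | rfl | rfl)
        · exact a1 hp
        · exact a2 hp
        · exact a3 hp
      · intro p hp q pq
        refine a6 p hp q (hdel p q pq fun e => ?_)
        rw [Sym2.eq_iff] at e
        rcases e with ⟨rfl, _⟩ | ⟨rfl, _⟩
        · exact a2 hp
        · exact hs' hp
    rcases this s with h | h | h | h
    · exact absurd h hs'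
    · exact absurd h us.ne'
    · exact absurd h vs.ne'
    · obtain rfl : s = s' := h
      exact absurd rfl (hdel' _ _ a5)
  · obtain ⟨S', s', w1, hw1, -, -, -, -, -, -, a7, -⟩ := h
    have : -C.f C.u < - C.f w1 := (a7 w1 hw1).1
    have := hbot w1
    linarith

lemma Ct.outTop [Fintype V] (C : Ct V) (hg : Gl C.G) (hH : C.HN) (hs : Small (Fintype.card V))
    (ho : OutTop C.toPre C.u C.v) : Colr C.G C.u C.v := by
  obtain ⟨S, s, w0, h0, h1, h2, h3, h4, h5, h6, h7, ⟨h8, h9⟩ | ⟨h8, h9⟩⟩ := ho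
  · exact C.special hg hH hs h0 h1 h2 h3 h4 h5 h6 h7 h8 h9
  · refine Ct.special C.fx hg hH hs h0 h1 h2 h3 h4 h5 h6 h7 ?_ ?_
    · show C.toPre.fx.xi (C.u, s) (C.f w0) < - C.x w0
      rw [C.toPre.fx_xi]; linarith
    · show - C.x w0 < C.toPre.fx.xi (C.v, s) (C.f w0)
      rw [C.toPre.fx_xi]; linarith

theorem Ct.final [Fintype V] (C : Ct V) (hg : Gl C.G) (hc : ¬ C.G.Colorable 4)
    (hs : Small (Fintype.card V)) : Colr C.G C.u C.v := by
  rcases C.main (C.np hg) (C.hn hg hc) hs with h | h | h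
  · exact h
  · exact C.outTop hg (C.hn hg hc) hs h
  · exact (Ct.outTop C.ff hg (Ct.hn C.ff hg hc) hs h).symm

end FC

namespace FC
variable {V : Type}

def Ln (a b : ℝ) (z : ℝ × ℝ) : ℝ := a * z.1 + b * z.2

lemma Ln_inj {A B P Q : ℝ} (hd : A * Q - B * P ≠ 0) {z z' : ℝ × ℝ} (h1 : Ln A B z = Ln A B z')
    (h2 : Ln P Q z = Ln P Q z') : z = z' := by
  unfold Ln at h1 h2
  ext
  · have : (A * Q - B * P) * (z.1 - z'.1) = 0 := by linear_combination Q * h1 - B * h2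
    rcases mul_eq_zero.1 this with h | h
    · exact absurd h hd
    · linarith
  · have : (A * Q - B * P) * (z.2 - z'.2) = 0 := by linear_combination A * h2 - P * h1
    rcases mul_eq_zero.1 this with h | h
    · exact absurd h hd
    · linarith

lemma Ln_seg (a b θ : ℝ) (p q : ℝ × ℝ) :
    Ln a b (p + θ • (q - p)) = Ln a b p + θ * (Ln a b q - Ln a b p) := by
  simp only [Ln, Prod.fst_add, Prod.snd_add, Prod.smul_fst, Prod.smul_snd, Prod.fst_sub,
    Prod.snd_sub, smul_eq_mul]
  ring

lemma pt_exists (A B P Q : ℝ) (pos : V → ℝ × ℝ) {c a : V} {h : ℝ} (h1 : Ln A B (pos c) < h)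
    (h2 : h < Ln A B (pos a)) : ∃ z ∈ segment ℝ (pos c) (pos a), Ln A B z = h ∧
      Ln P Q z = X (fun w => Ln A B (pos w)) (fun w => Ln P Q (pos w)) c a h := by
  have hp : 0 < Ln A B (pos a) - Ln A B (pos c) := by linarith
  refine ⟨pos c + ((h - Ln A B (pos c)) / (Ln A B (pos a) - Ln A B (pos c))) • (pos a - pos c),
    ?_, ?_, ?_⟩
  · rw [segment_eq_image']
    refine ⟨_, ⟨div_nonneg (by linarith) hp.le, ?_⟩, rfl⟩
    rw [div_le_one hp]; linarith
  · rw [Ln_seg, div_mul_cancel₀ _ hp.ne']; ring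
  · rw [Ln_seg]; rfl

lemma pt_cases (A B P Q : ℝ) (pos : V → ℝ × ℝ) {c a : V} {z : ℝ × ℝ}
    (hz : z ∈ segment ℝ (pos c) (pos a)) (hca : Ln A B (pos c) < Ln A B (pos a)) :
    z = pos c ∨ z = pos a ∨ (Ln A B (pos c) < Ln A B z ∧ Ln A B z < Ln A B (pos a) ∧
      X (fun w => Ln A B (pos w)) (fun w => Ln P Q (pos w)) c a (Ln A B z) = Ln P Q z) := by
  rw [segment_eq_image'] at hz
  obtain ⟨θ, ⟨h0, h1⟩, rfl⟩ := hz
  have hp : 0 < Ln A B (pos a) - Ln A B (pos c) := by linarith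
  rcases h0.lt_or_eq with h0 | rfl
  · rcases h1.lt_or_eq with h1 | rfl
    · right; right
      simp only [Ln_seg]
      refine ⟨by nlinarith, by nlinarith, ?_⟩
      unfold X
      simp only [add_sub_cancel_left]
      rw [mul_div_cancel_right₀ _ hp.ne']
    · right; left; simp
  · left; simp

lemma mk_Dr {G : SimpleGraph V} {pos : V → ℝ × ℝ} (hi : Function.Injective pos)
    (hp : ∀ u v x y : V, G.Adj u v → G.Adj x y → s(u, v) ≠ s(x, y) →
      ∀ p : ℝ × ℝ, p ∈ segment ℝ (pos u) (pos v) → p ∈ segment ℝ (pos x) (pos y) →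
        (p = pos u ∨ p = pos v) ∧ (p = pos x ∨ p = pos y))
    (hm : ∀ u v : V, u ≠ v → ¬ G.Adj u v → ¬ IsPlanar (G ⊔ SimpleGraph.fromEdgeSet {s(u, v)}))
    (hn : ∀ w, ∃ y, G.Adj w y) (A B P Q : ℝ) (hd : A * Q - B * P ≠ 0)
    (hf : Function.Injective (fun w => Ln A B (pos w))) :
    ∃ D : Dr V, D.G = G ∧ D.f = fun w => Ln A B (pos w) := by
  let D : Pre V :=
    { G := G
      f := fun w => Ln A B (pos w)
      x := fun w => Ln P Q (pos w)
      inj := hf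
      p1 := by
        intro c a c' a' h ca ca' h1 h2 h3 h4 e
        obtain ⟨z, hz, z1, z2⟩ := pt_exists A B P Q pos h1 h2
        obtain ⟨z', hz', z1', z2'⟩ := pt_exists A B P Q pos h3 h4
        obtain rfl : z = z' := Ln_inj hd (z1.trans z1'.symm) (by rw [z2, z2', e])
        by_cases he : s(c, a) = s(c', a')
        · rw [Sym2.eq_iff] at he
          rcases he with he | ⟨rfl, rfl⟩
          · exact he
          · exact absurd (h1.trans h2) (lt_asymm (h3.trans h4))
        · rcases (hp c a c' a' ca ca' he z hz hz').1 with rfl | rfl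
          · exact absurd z1 h1.ne
          · exact absurd z1 h2.ne'
      p2 := by
        intro c a w ca h1 h2 e
        obtain ⟨z, hz, z1, z2⟩ := pt_exists A B P Q pos h1 h2
        obtain rfl : z = pos w := Ln_inj hd z1 (by rw [z2, e])
        obtain ⟨y, hy⟩ := hn w
        have hc : w ≠ c := by rintro rfl; exact lt_irrefl _ h1
        have ha : w ≠ a := by rintro rfl; exact lt_irrefl _ h2
        have := (hp c a w y ca hy (by
          intro e
          rw [Sym2.eq_iff] at e
          rcases e with ⟨h, _⟩ | ⟨_, h⟩
          · exact hc h.symm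
          · exact ha h.symm) _ hz (left_mem_segment _ _ _)).1
        rcases this with h | h
        · exact hc (hi h)
        · exact ha (hi h) }
  have k1 : ∀ p q c d z, D.Uncr p q → D.f c < D.f d → G.Adj c d →
      z ∈ segment ℝ (pos p) (pos q) → z ∈ segment ℝ (pos c) (pos d) →
      (z = pos p ∨ z = pos q) ∧ (z = pos c ∨ z = pos d) := by
    intro p q c d z hu hcd cd h1 h2
    obtain ⟨u1, u2, u3⟩ := hu
    rcases pt_cases A B P Q pos h1 u1 with rfl | rfl | ⟨a1, a2, a3⟩ <;>
      rcases pt_cases A B P Q pos h2 hcd with h | h | ⟨b1, b2, b3⟩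
    · exact ⟨Or.inl rfl, Or.inl h⟩
    · exact ⟨Or.inl rfl, Or.inr h⟩
    · exact absurd b3 (D.p2 c d p cd b1 b2)
    · exact ⟨Or.inr rfl, Or.inl h⟩
    · exact ⟨Or.inr rfl, Or.inr h⟩
    · exact absurd b3 (D.p2 c d q cd b1 b2)
    · subst h
      exact absurd a3 (u2 c a1 a2)
    · subst h
      exact absurd a3 (u2 d a1 a2)
    · exact absurd (b3.trans a3.symm) (u3 c d _ cd b1 b2 a1 a2)
  have k2 : ∀ p q c d z, D.Uncr p q → G.Adj c d →
      z ∈ segment ℝ (pos p) (pos q) → z ∈ segment ℝ (pos c) (pos d) →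
      (z = pos p ∨ z = pos q) ∧ (z = pos c ∨ z = pos d) := by
    intro p q c d z hu cd h1 h2
    rcases lt_trichotomy (D.f c) (D.f d) with l | l | l
    · exact k1 p q c d z hu l cd h1 h2
    · exact absurd (D.inj l) cd.ne
    · rw [segment_symm] at h2
      have := k1 p q d c z hu l cd.symm h1 h2
      exact ⟨this.1, this.2.symm⟩
  have k3 : ∀ p q a b c d z, D.Uncr p q → s(a, b) = s(p, q) → G.Adj c d →
      z ∈ segment ℝ (pos a) (pos b) → z ∈ segment ℝ (pos c) (pos d) →
      (z = pos a ∨ z = pos b) ∧ (z = pos c ∨ z = pos d) := by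
    intro p q a b c d z hu e cd h1 h2
    rw [Sym2.eq_iff] at e
    rcases e with ⟨rfl, rfl⟩ | ⟨rfl, rfl⟩
    · exact k2 a b c d z hu cd h1 h2
    · rw [segment_symm] at h1
      have := k2 b a c d z hu cd h1 h2
      exact ⟨this.1.symm, this.2⟩
  have mx : ∀ p q, D.Uncr p q → G.Adj p q := by
    intro p q hu
    by_contra hn
    have hne : p ≠ q := by rintro rfl; exact lt_irrefl _ hu.1
    refine hm p q hne hn ⟨pos, hi, ?_⟩
    intro a b c d hab hcd e z h1 h2
    rw [SimpleGraph.sup_adj, SimpleGraph.fromEdgeSet_adj] at hab hcd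
    rcases hab with hab | ⟨hab, -⟩ <;> rcases hcd with hcd | ⟨hcd, -⟩
    · exact hp a b c d hab hcd e z h1 h2
    · exact (k3 p q c d a b z hu hcd hab h2 h1).symm
    · exact k3 p q a b c d z hu hab hcd h1 h2
    · exact absurd (Eq.trans hab (Eq.symm hcd)) e
  exact ⟨{ toPre := D
           mxr := fun c a z _ => ⟨mx c z, mx z a⟩
           mxl := fun c a z _ => ⟨mx c z, mx z a⟩ }, rfl, rfl⟩

lemma ev_pos {a : ℝ} (b : ℝ) (ha : 0 < a) : ∀ᶠ e : ℝ in nhdsWithin 0 (Set.Ioi 0), 0 < a + e * b := by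
  have hc : Continuous (fun e : ℝ => a + e * b) := by fun_prop
  have := hc.tendsto 0
  simp only [zero_mul, add_zero] at this
  exact (this.eventually (lt_mem_nhds ha)).filter_mono nhdsWithin_le_nhds

lemma mk_Ct [Fintype V] {G : SimpleGraph V} (h : IsMinCounterexample G) (hg : Gl G) {u v : V}
    (uv : G.Adj u v) : ∃ C : Ct V, C.G = G ∧ C.u = u ∧ C.v = v := by
  classical
  obtain ⟨⟨⟨pos, hi, hp⟩, hm⟩, hc, -⟩ := h
  have hn : ∀ w, ∃ y, G.Adj w y := by
    intro w
    by_contra hw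
    push Not at hw
    have := hg {w} ∅ ⟨w, rfl⟩ (by simp) (by simp) (by
      rintro p rfl q pq
      exact absurd pq (hw q))
    have e : ∀ z, z = w := fun z => (this z).resolve_right (by simp)
    exact uv.ne ((e u).trans (e v).symm)
  obtain ⟨d1, hd1⟩ : ∃ d, d = (pos v).1 - (pos u).1 := ⟨_, rfl⟩
  obtain ⟨d2, hd2⟩ : ∃ d, d = (pos v).2 - (pos u).2 := ⟨_, rfl⟩
  have hdd : 0 < d1 ^ 2 + d2 ^ 2 := by
    by_contra hle
    have h1 : d1 = 0 := by nlinarith [sq_nonneg d1, sq_nonneg d2]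
    have h2 : d2 = 0 := by nlinarith [sq_nonneg d1, sq_nonneg d2]
    apply uv.ne
    apply hi
    ext <;> linarith
  obtain ⟨n, hnn⟩ : ∃ n : V → V → ℝ, ∀ p q, n p q =
    d1 * ((pos p).2 - (pos q).2) - d2 * ((pos p).1 - (pos q).1) := ⟨_, fun _ _ => rfl⟩
  obtain ⟨t, ht⟩ : ∃ t : V → V → ℝ, ∀ p q, t p q =
    d1 * ((pos p).1 - (pos q).1) + d2 * ((pos p).2 - (pos q).2) := ⟨_, fun _ _ => rfl⟩
  have hnt : ∀ p q, p ≠ q → n p q = 0 → t p q ≠ 0 := by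
    intro p q hne h1 h2
    rw [hnn] at h1
    rw [ht] at h2
    apply hne
    apply hi
    ext
    · have : (d1 ^ 2 + d2 ^ 2) * ((pos p).1 - (pos q).1) = 0 := by
        linear_combination d1 * h2 - d2 * h1
      rcases mul_eq_zero.1 this with h | h <;> linarith
    · have : (d1 ^ 2 + d2 ^ 2) * ((pos p).2 - (pos q).2) = 0 := by
        linear_combination d2 * h2 + d1 * h1
      rcases mul_eq_zero.1 this with h | h <;> linarith
  have hseg : ∀ w, w ≠ u → w ≠ v → n w u = 0 → t w u < 0 ∨ d1 ^ 2 + d2 ^ 2 < t w u := by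
    intro w hwu hwv h1
    by_contra hcon
    push Not at hcon
    obtain ⟨y, hy⟩ := hn w
    have hs : pos w ∈ segment ℝ (pos u) (pos v) := by
      rw [segment_eq_image']
      refine ⟨t w u / (d1 ^ 2 + d2 ^ 2), ⟨div_nonneg hcon.1 hdd.le, (div_le_one hdd).2 hcon.2⟩, ?_⟩
      rw [hnn] at h1
      rw [ht]
      ext
      · simp only [Prod.fst_add, Prod.smul_fst, Prod.fst_sub, smul_eq_mul, ← hd1]
        field_simp
        linear_combination d2 * h1
      · simp only [Prod.snd_add, Prod.smul_snd, Prod.snd_sub, smul_eq_mul, ← hd2]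
        field_simp
        linear_combination (-d1) * h1
    have := (hp u v w y uv hy (by
      intro e
      rw [Sym2.eq_iff] at e
      rcases e with ⟨h, _⟩ | ⟨_, h⟩
      · exact hwu h.symm
      · exact hwv h.symm) _ hs (left_mem_segment _ _ _)).1
    rcases this with h | h
    · exact hwu (hi h)
    · exact hwv (hi h)
  have ev : ∀ᶠ e : ℝ in nhdsWithin 0 (Set.Ioi 0), 0 < e ∧
      (∀ w, 0 < n w u → 0 < n w u + e * (t w u - (d1 ^ 2 + d2 ^ 2))) ∧
      (∀ w, n w u < 0 → n w u + e * t w u < 0) ∧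
      (∀ p q, p ≠ q → n p q + e * t p q ≠ 0) := by
    refine Filter.Eventually.and self_mem_nhdsWithin (Filter.Eventually.and ?_
      (Filter.Eventually.and ?_ ?_))
    · rw [Filter.eventually_all]
      intro w
      by_cases h : 0 < n w u
      · filter_upwards [ev_pos (t w u - (d1 ^ 2 + d2 ^ 2)) h] with e he _ using he
      · exact Filter.Eventually.of_forall fun e h' => absurd h' h
    · rw [Filter.eventually_all]
      intro w
      by_cases h : n w u < 0
      · filter_upwards [ev_pos (- t w u) (neg_pos.2 h)] with e he _
        linarith
      · exact Filter.Eventually.of_forall fun e h' => absurd h' h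
    · rw [Filter.eventually_all]
      intro p
      rw [Filter.eventually_all]
      intro q
      by_cases hne : p = q
      · exact Filter.Eventually.of_forall fun e h' => absurd hne h'
      rcases lt_trichotomy (n p q) 0 with h | h | h
      · filter_upwards [ev_pos (- t p q) (neg_pos.2 h)] with e he _ h0
        linarith
      · filter_upwards [self_mem_nhdsWithin] with e he _ h0
        rw [h, zero_add] at h0
        rcases mul_eq_zero.1 h0 with h0 | h0
        · exact (ne_of_gt he) h0
        · exact hnt p q hne h h0
      · filter_upwards [ev_pos (t p q) h] with e he _ h0
        linarith
  obtain ⟨e, he, hA, hB, hC⟩ := ev.exists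
  have hL : ∀ p q, Ln (-d2 + e * d1) (d1 + e * d2) (pos p) - Ln (-d2 + e * d1) (d1 + e * d2) (pos q)
      = n p q + e * t p q := by
    intro p q
    rw [hnn, ht]
    unfold Ln
    ring
  have hinj : Function.Injective (fun w => Ln (-d2 + e * d1) (d1 + e * d2) (pos w)) := by
    intro p q hpq
    by_contra hne
    exact hC p q hne (by rw [← hL]; exact sub_eq_zero.2 hpq)
  obtain ⟨D, hDG, hDf⟩ := mk_Dr hi hp hm hn (-d2 + e * d1) (d1 + e * d2) d1 d2 (by
    intro h0
    have : d1 ^ 2 + d2 ^ 2 = 0 := by linear_combination -h0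
    exact hdd.ne' this) hinj
  have hL' : ∀ p q, D.f p - D.f q = n p q + e * t p q := by
    intro p q
    rw [hDf]
    exact hL p q
  have hvu : D.f v - D.f u = e * (d1 ^ 2 + d2 ^ 2) := by
    rw [hL', hnn, ht, ← hd1, ← hd2]; ring
  have luv : D.f u < D.f v := by
    have : 0 < e * (d1 ^ 2 + d2 ^ 2) := mul_pos he hdd
    linarith
  have gap : ∀ w, w ≠ u → D.f w < D.f v → D.f w < D.f u := by
    intro w hwu hlt
    have hwv : w ≠ v := by rintro rfl; exact lt_irrefl _ hlt
    have e1 := hL' w u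
    rcases lt_trichotomy (n w u) 0 with h | h | h
    · have := hB w h
      linarith
    · rcases hseg w hwu hwv h with h' | h'
      · have : e * t w u < 0 := mul_neg_of_pos_of_neg he h'
        linarith
      · have : e * (d1 ^ 2 + d2 ^ 2) < e * t w u := mul_lt_mul_of_pos_left h' he
        linarith
    · have := hA w h
      linarith
  refine ⟨{ toDr := D
            u := u
            v := v
            uv := hDG ▸ uv
            luv := luv
            gap := gap
            g := fun w => if w = u then D.f v else D.f w
            guv := by simp
            gm := ?_ }, hDG, rfl, rfl⟩
  intro p q hpq
  by_cases h1 : p = u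
  · subst h1
    by_cases h2 : q = v
    · exact Or.inl ⟨rfl, h2⟩
    · right
      have h3 : q ≠ p := by rintro rfl; exact lt_irrefl _ hpq
      simp only [if_true, h3, if_false]
      by_contra hle
      push Not at hle
      rcases hle.lt_or_eq with hlt | heq
      · exact lt_asymm hpq (gap q h3 hlt)
      · exact h2 (D.inj heq)
  · right
    by_cases h2 : q = u
    · subst h2
      simp only [if_true, h1, if_false]
      exact hpq.trans luv
    · simp only [h1, h2, if_false]
      exact hpq

theorem all [Fintype V] {G : SimpleGraph V} (h : IsMinCounterexample G) {u v : V}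
    (uv : G.Adj u v) : (G.deleteEdges {s(u, v)}).Colorable 4 := by
  have hs := small_of_min h
  have hg := glue h.1.1 hs h.2.1
  obtain ⟨C, rfl, rfl, rfl⟩ := mk_Ct h hg uv
  exact (C.final hg h.2.1 hs).delete

end FC

/-- If `EP` is a minimum-order non-4-colorable maximal planar graph, then for every
edge `e`, the graph `EP - {e}` is 4-colorable. -/
theorem stmt_2 {V : Type} [Fintype V] (EP : SimpleGraph V)
    (hEP : IsMinCounterexample EP) (e : Sym2 V) (he : e ∈ EP.edgeSet) :
    (EP.deleteEdges {e}).Colorable 4 := by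
  induction e with
  | h u v => exact FC.all hEP he
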